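/- Given θ ∈ (0,1], there exist constants N = N(n,θ) ≥ 1 and ρ = ρ(n,θ) ∈ (0,1], depending only on the dimension n and on θ, such that the following holds: if u is a C^{2,1} function on B_4 × [0, 1/R^2] satisfying |Δu + ∂_t u| ≤ R^2|u| + R|∇u|, ‖u‖_{L^∞(B_4 × [0,1/R^2])} ≤ 1, ‖∇u‖_{L^∞(B_4 × [0,1/R^2])} ≤ R, and ‖u(·,0)‖_{L^2(B_ρ)} ≥ θ R^{-n/2}, then ‖u(·,0)‖_{L^2(B_r)} ≥ e^{-N R^2 log(N/r)} whenever 0 < r ≤ 1/2 and R ≥ N. -/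

import Mathlib

open MeasureTheory Real Set Metric

/-- The spatial Laplacian of `f : ℝⁿ → ℝ`. -/
noncomputable def slap {n : ℕ} (f : EuclideanSpace ℝ (Fin n) → ℝ)
    (x : EuclideanSpace ℝ (Fin n)) : ℝ :=
  ∑ i : Fin n, fderiv ℝ (fun y => fderiv ℝ f y (EuclideanSpace.single i 1)) x
    (EuclideanSpace.single i 1)

section Auxiliary

open scoped ContDiff Topology
open Filter

/-- Euclidean `n`-space. -/
abbrev Euc (n : ℕ) := EuclideanSpace ℝ (Fin n)

/-- The directional derivative of a function on space-time. -/
noncomputable def pd {n : ℕ} (v : Euc n × ℝ) (f : Euc n × ℝ → ℝ) (z : Euc n × ℝ) : ℝ :=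
  fderiv ℝ f z v

/-- The `i`-th spatial unit vector of space-time. -/
noncomputable def sdir {n : ℕ} (i : Fin n) : Euc n × ℝ := (EuclideanSpace.single i 1, 0)

/-- The unit time vector of space-time. -/
def tdir (n : ℕ) : Euc n × ℝ := (0, 1)

/-- The spatial Laplacian of a function on space-time. -/
noncomputable def lap {n : ℕ} (f : Euc n × ℝ → ℝ) (z : Euc n × ℝ) : ℝ :=
  ∑ i, pd (sdir i) (pd (sdir i) f) z

/-- The squared length of the spatial gradient of a function on space-time. -/
noncomputable def gsq {n : ℕ} (f : Euc n × ℝ → ℝ) (z : Euc n × ℝ) : ℝ :=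
  ∑ i, (pd (sdir i) f z) ^ 2

variable {n : ℕ}

lemma contDiff_pd {f : Euc n × ℝ → ℝ} (hf : ContDiff ℝ ∞ f) (v : Euc n × ℝ) :
    ContDiff ℝ ∞ (pd v f) := by
  unfold pd
  exact (hf.fderiv_right (m := ∞) (by simp)).clm_apply contDiff_const

lemma contDiff_lap {f : Euc n × ℝ → ℝ} (hf : ContDiff ℝ ∞ f) : ContDiff ℝ ∞ (lap f) := by
  unfold lap
  exact ContDiff.sum fun i _ => contDiff_pd (contDiff_pd hf _) _

lemma contDiff_gsq {f : Euc n × ℝ → ℝ} (hf : ContDiff ℝ ∞ f) : ContDiff ℝ ∞ (gsq f) := by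
  unfold gsq
  exact ContDiff.sum fun i _ => (contDiff_pd hf _).pow 2

lemma gsq_nonneg (f : Euc n × ℝ → ℝ) (z : Euc n × ℝ) : 0 ≤ gsq f z :=
  Finset.sum_nonneg fun _ _ => sq_nonneg _

lemma pd_comm {f : Euc n × ℝ → ℝ} (hf : ContDiff ℝ ∞ f) (u v : Euc n × ℝ) (z : Euc n × ℝ) :
    pd u (pd v f) z = pd v (pd u f) z := by
  have hs : IsSymmSndFDerivAt ℝ f z :=
    hf.contDiffAt.isSymmSndFDerivAt (by simpa using WithTop.coe_le_coe.2 (le_top (a := (2 : ℕ∞))))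
  have hd : DifferentiableAt ℝ (fderiv ℝ f) z :=
    ((hf.fderiv_right (m := ∞) (by simp)).differentiable (by simp)) z
  unfold pd
  rw [fderiv_clm_apply hd (differentiableAt_const _), fderiv_clm_apply hd (differentiableAt_const _)]
  simpa using hs u v

lemma hasFDerivAt_slice {f : Euc n × ℝ → ℝ} {x : Euc n} {t : ℝ}
    (hf : DifferentiableAt ℝ f (x, t)) :
    HasFDerivAt (fun y => f (y, t))
      ((fderiv ℝ f (x, t)).comp (ContinuousLinearMap.inl ℝ (Euc n) ℝ)) x := by
  have h1 : HasFDerivAt (fun y : Euc n => (y, t)) (ContinuousLinearMap.inl ℝ (Euc n) ℝ) x :=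
    hasFDerivAt_prodMk_left x t
  exact HasFDerivAt.comp x hf.hasFDerivAt h1

lemma fderiv_slice {f : Euc n × ℝ → ℝ} {x : Euc n} {t : ℝ}
    (hf : DifferentiableAt ℝ f (x, t)) (v : Euc n) :
    fderiv ℝ (fun y => f (y, t)) x v = pd (v, 0) f (x, t) := by
  rw [(hasFDerivAt_slice hf).fderiv]
  simp [pd]

lemma hasDerivAt_time {f : Euc n × ℝ → ℝ} {x : Euc n} {t : ℝ}
    (hf : DifferentiableAt ℝ f (x, t)) :
    HasDerivAt (fun s => f (x, s)) (pd (tdir n) f (x, t)) t := by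
  have h1 : HasDerivAt (fun s : ℝ => (x, s)) (tdir n) t :=
    (hasDerivAt_const t x).prodMk (hasDerivAt_id t)
  exact hf.hasFDerivAt.comp_hasDerivAt t h1

lemma norm_sq_eq_sum_apply_sq (l : Euc n →L[ℝ] ℝ) :
    ‖l‖ ^ 2 = ∑ i, (l (EuclideanSpace.single i 1)) ^ 2 := by
  set y := (InnerProductSpace.toDual ℝ (Euc n)).symm l with hy
  have h1 : ‖l‖ = ‖y‖ := by rw [hy, LinearIsometryEquiv.norm_map]
  have h2 : ∀ v, l v = inner ℝ y v := fun v => by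
    rw [hy, InnerProductSpace.toDual_symm_apply]
  rw [h1, EuclideanSpace.norm_sq_eq]
  refine Finset.sum_congr rfl fun i _ => ?_
  rw [h2]
  simp [EuclideanSpace.inner_single_right]

lemma slap_slice {f : Euc n × ℝ → ℝ} (hf : ContDiff ℝ ∞ f) (x : Euc n) (t : ℝ) :
    slap (fun y => f (y, t)) x = lap f (x, t) := by
  unfold slap lap
  refine Finset.sum_congr rfl fun i _ => ?_
  have h : (fun y => fderiv ℝ (fun y => f (y, t)) y (EuclideanSpace.single i 1)) =
      fun y => pd (sdir i) f (y, t) := by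
    ext y
    exact fderiv_slice ((hf.differentiable (by simp)) _) _
  rw [h, fderiv_slice (((contDiff_pd hf _).differentiable (by simp)) _)]
  rfl

/-- A space-time function whose spatial supports are locally uniformly bounded in time. -/
def SpaceBdd (f : Euc n × ℝ → ℝ) : Prop :=
  ∀ t₀ : ℝ, ∃ M : ℝ, ∀ t, |t - t₀| < 1 → ∀ x, M < ‖x‖ → f (x, t) = 0

lemma SpaceBdd.mul_right {f : Euc n × ℝ → ℝ} (hf : SpaceBdd f) (g : Euc n × ℝ → ℝ) :
    SpaceBdd (fun z => f z * g z) := fun t₀ => by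
  obtain ⟨M, hM⟩ := hf t₀
  exact ⟨M, fun t ht x hx => by simp [hM t ht x hx]⟩

lemma SpaceBdd.mul_left {f : Euc n × ℝ → ℝ} (hf : SpaceBdd f) (g : Euc n × ℝ → ℝ) :
    SpaceBdd (fun z => g z * f z) := fun t₀ => by
  obtain ⟨M, hM⟩ := hf t₀
  exact ⟨M, fun t ht x hx => by simp [hM t ht x hx]⟩

lemma SpaceBdd.add {f g : Euc n × ℝ → ℝ} (hf : SpaceBdd f) (hg : SpaceBdd g) :
    SpaceBdd (fun z => f z + g z) := fun t₀ => by
  obtain ⟨M, hM⟩ := hf t₀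
  obtain ⟨M', hM'⟩ := hg t₀
  exact ⟨max M M', fun t ht x hx => by
    simp [hM t ht x ((le_max_left _ _).trans_lt hx), hM' t ht x ((le_max_right _ _).trans_lt hx)]⟩

lemma SpaceBdd.sum {ι : Type*} {s : Finset ι} {f : ι → Euc n × ℝ → ℝ}
    (hf : ∀ i, SpaceBdd (f i)) : SpaceBdd (fun z => ∑ i ∈ s, f i z) := by
  classical
  induction s using Finset.induction_on with
  | empty => exact fun t₀ => ⟨0, fun t _ x _ => by simp⟩
  | insert a s ha ih =>
    simp only [Finset.sum_insert ha]
    exact (hf a).add ih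

lemma SpaceBdd.pd {f : Euc n × ℝ → ℝ} (hf : SpaceBdd f) (v : Euc n × ℝ) :
    SpaceBdd (pd v f) := fun t₀ => by
  obtain ⟨M, hM⟩ := hf t₀
  refine ⟨M, fun t ht x hx => ?_⟩
  have hev : f =ᶠ[𝓝 (x, t)] fun _ => 0 := by
    have h1 : ∀ᶠ z : Euc n × ℝ in 𝓝 (x, t), M < ‖z.1‖ :=
      (isOpen_lt continuous_const (by fun_prop)).mem_nhds hx
    have h2 : ∀ᶠ z : Euc n × ℝ in 𝓝 (x, t), |z.2 - t₀| < 1 :=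
      (isOpen_lt (by fun_prop) continuous_const).mem_nhds ht
    filter_upwards [h1, h2] with z hz1 hz2
    exact hM z.2 hz2 z.1 hz1
  unfold _root_.pd
  rw [hev.fderiv_eq]
  simp

lemma SpaceBdd.hasCompactSupport {f : Euc n × ℝ → ℝ} (hf : SpaceBdd f) (t : ℝ) :
    HasCompactSupport fun x => f (x, t) := by
  obtain ⟨M, hM⟩ := hf t
  refine HasCompactSupport.intro (isCompact_closedBall (0 : Euc n) M) fun x hx => ?_
  exact hM t (by simp) x (by simpa using hx)

lemma SpaceBdd.integrable {f : Euc n × ℝ → ℝ} (hf : SpaceBdd f) (hc : Continuous f) (t : ℝ) :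
    Integrable fun x => f (x, t) :=
  (hc.comp (by fun_prop : Continuous fun x : Euc n => (x, t))).integrable_of_hasCompactSupport
    (hf.hasCompactSupport t)

/-- Differentiation in time of a spatial integral. -/
lemma SpaceBdd.hasDerivAt_integral {f : Euc n × ℝ → ℝ} (hf : SpaceBdd f)
    (hc : ContDiff ℝ ∞ f) (t₀ : ℝ) :
    HasDerivAt (fun t => ∫ x, f (x, t)) (∫ x, _root_.pd (tdir n) f (x, t₀)) t₀ := by
  have hcd := (contDiff_pd hc (tdir n)).continuous
  obtain ⟨M, hM⟩ := hf.pd (tdir n) t₀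
  obtain ⟨C, hC⟩ := ((isCompact_closedBall (0 : Euc n) M).prod
    (isCompact_closedBall t₀ 1)).exists_bound_of_continuousOn hcd.continuousOn
  refine (hasDerivAt_integral_of_dominated_loc_of_deriv_le (bound :=
    (closedBall (0 : Euc n) M).indicator fun _ => C) (F' := fun t x => _root_.pd (tdir n) f (x, t))
    (ball_mem_nhds t₀ one_pos) ?_ (hf.integrable hc.continuous t₀) ?_ ?_ ?_ ?_).2
  · exact Eventually.of_forall fun t => (hf.integrable hc.continuous t).aestronglyMeasurable
  · exact ((hf.pd _).integrable hcd t₀).aestronglyMeasurable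
  · refine Eventually.of_forall fun x t ht => ?_
    by_cases hx : x ∈ closedBall (0 : Euc n) M
    · rw [indicator_of_mem hx]
      exact hC (x, t) ⟨hx, ball_subset_closedBall ht⟩
    · rw [indicator_of_notMem hx, hM t (by simpa [Real.dist_eq] using ht) x (by simpa using hx)]
      simp
  · exact (integrable_indicator_iff measurableSet_closedBall).2
      (integrableOn_const (by exact measure_closedBall_lt_top.ne))
  · exact Eventually.of_forall fun x t _ => hasDerivAt_time ((hc.differentiable (by simp)) _)

/-- Integration by parts in a spatial direction. -/
lemma integral_mul_pd {f g : Euc n × ℝ → ℝ} (hf : ContDiff ℝ ∞ f) (hg : ContDiff ℝ ∞ g)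
    (hs : SpaceBdd g) (i : Fin n) (t : ℝ) :
    ∫ x, f (x, t) * pd (sdir i) g (x, t) = -∫ x, pd (sdir i) f (x, t) * g (x, t) := by
  have hdf : Differentiable ℝ f := hf.differentiable (by simp)
  have hdg : Differentiable ℝ g := hg.differentiable (by simp)
  have e1 : ∀ x, fderiv ℝ (fun y => f (y, t)) x (EuclideanSpace.single i 1) =
    pd (sdir i) f (x, t) := fun x => fderiv_slice (hdf _) _
  have e2 : ∀ x, fderiv ℝ (fun y => g (y, t)) x (EuclideanSpace.single i 1) =
    pd (sdir i) g (x, t) := fun x => fderiv_slice (hdg _) _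
  have := integral_mul_fderiv_eq_neg_fderiv_mul_of_integrable (μ := (volume : Measure (Euc n)))
    (f := fun x => f (x, t)) (g := fun x => g (x, t)) (v := EuclideanSpace.single i 1)
    ?_ ?_ ?_ ?_ ?_
  · simpa only [e1, e2] using this
  · simp only [e1]
    exact (hs.mul_left (pd (sdir i) f)).integrable
      ((contDiff_pd hf _).continuous.mul hg.continuous) t
  · simp only [e2]
    exact ((hs.pd (sdir i)).mul_left f).integrable
      (hf.continuous.mul (contDiff_pd hg _).continuous) t
  · exact (hs.mul_left f).integrable (hf.continuous.mul hg.continuous) t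
  · exact fun x _ => (hasFDerivAt_slice (hdf _)).differentiableAt
  · exact fun x _ => (hasFDerivAt_slice (hdg _)).differentiableAt

/-- The Gaussian weight, as a function on space-time. -/
noncomputable def gau (z : Euc n × ℝ) : ℝ := rexp (-‖z.1‖ ^ 2 / 4)

/-- The Ornstein–Uhlenbeck operator that is symmetric for the weight `gau`. -/
noncomputable def ou (f : Euc n × ℝ → ℝ) (z : Euc n × ℝ) : ℝ :=
  lap f z - 1 / 2 * ∑ i, z.1 i * pd (sdir i) f z

lemma gau_pos (z : Euc n × ℝ) : 0 < gau z := exp_pos _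

lemma contDiff_gau : ContDiff ℝ ∞ (gau (n := n)) := by
  unfold gau
  exact (((contDiff_norm_sq ℝ).comp contDiff_fst).neg.div_const 4).exp

lemma contDiff_coord (i : Fin n) : ContDiff ℝ ∞ fun z : Euc n × ℝ => z.1 i :=
  ((EuclideanSpace.proj (𝕜 := ℝ) i).contDiff).comp contDiff_fst

lemma contDiff_ou {f : Euc n × ℝ → ℝ} (hf : ContDiff ℝ ∞ f) : ContDiff ℝ ∞ (ou f) := by
  unfold ou
  exact (contDiff_lap hf).sub (contDiff_const.mul
    (ContDiff.sum fun i _ => (contDiff_coord i).mul (contDiff_pd hf _)))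

lemma pd_mul {f g : Euc n × ℝ → ℝ} (hf : ContDiff ℝ ∞ f) (hg : ContDiff ℝ ∞ g)
    (v z : Euc n × ℝ) :
    pd v (fun z => f z * g z) z = pd v f z * g z + f z * pd v g z := by
  unfold pd
  rw [fderiv_fun_mul (hf.differentiable (by simp) z) (hg.differentiable (by simp) z)]
  simp
  ring

lemma pd_sum {f : Fin n → Euc n × ℝ → ℝ} (hf : ∀ i, ContDiff ℝ ∞ (f i)) (v z : Euc n × ℝ) :
    pd v (fun z => ∑ i, f i z) z = ∑ i, pd v (f i) z := by
  unfold pd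
  rw [fderiv_fun_sum fun i _ => (hf i).differentiable (by simp) z]
  simp

lemma pd_gau (v z : Euc n × ℝ) : pd v gau z = -(inner ℝ z.1 v.1 / 2) * gau z := by
  have h1 : HasFDerivAt (fun z : Euc n × ℝ => ‖z.1‖ ^ 2)
      (2 • (innerSL ℝ z.1).comp (ContinuousLinearMap.fst ℝ (Euc n) ℝ)) z :=
    (ContinuousLinearMap.fst ℝ (Euc n) ℝ).hasFDerivAt.norm_sq
  have h2 : HasFDerivAt (gau (n := n)) _ z := ((h1.neg.mul_const (1 / 4)).exp).congr_of_eventuallyEq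
    (Eventually.of_forall fun z => by simp [gau]; ring)
  unfold pd
  rw [h2.fderiv]
  simp [gau]
  ring_nf

lemma pd_sdir_gau (i : Fin n) (z : Euc n × ℝ) : pd (sdir i) gau z = -(z.1 i / 2) * gau z := by
  rw [pd_gau]
  simp [sdir, EuclideanSpace.inner_single_right]

lemma pd_tdir_gau (z : Euc n × ℝ) : pd (tdir n) gau z = 0 := by
  rw [pd_gau]
  simp [tdir]

/-- Integration by parts for the Ornstein–Uhlenbeck operator. -/
lemma integral_mul_ou {f g : Euc n × ℝ → ℝ} (hf : ContDiff ℝ ∞ f) (hg : ContDiff ℝ ∞ g)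
    (hs : SpaceBdd g) (t : ℝ) :
    ∫ x, f (x, t) * ou g (x, t) * gau (x, t) =
      -∫ x, (∑ i, pd (sdir i) f (x, t) * pd (sdir i) g (x, t)) * gau (x, t) := by
  have hfg : ContDiff ℝ ∞ (fun z => f z * gau z) := hf.mul contDiff_gau
  have key : ∀ i : Fin n,
      ∫ x, (f (x, t) * (pd (sdir i) (pd (sdir i) g) (x, t)
        - 1 / 2 * (x i * pd (sdir i) g (x, t))) * gau (x, t)) =
      -∫ x, pd (sdir i) f (x, t) * pd (sdir i) g (x, t) * gau (x, t) := by
    intro i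
    have hgi := contDiff_pd hg (sdir i)
    have h := integral_mul_pd hfg hgi (hs.pd _) i t
    have i1 : Integrable fun x => f (x, t) * gau (x, t) * pd (sdir i) (pd (sdir i) g) (x, t) :=
      ((((hs.pd (sdir i)).pd (sdir i)).mul_left _).integrable
        (hfg.continuous.mul (contDiff_pd hgi _).continuous) t :)
    have i2 : Integrable fun x => f (x, t) * (x i / 2) * gau (x, t) * pd (sdir i) g (x, t) :=
      (((hs.pd (sdir i)).mul_left fun z => f z * (z.1 i / 2) * gau z).integrable
        (((hf.mul ((contDiff_coord i).div_const 2)).mul contDiff_gau).mul hgi).continuous t :)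
    have i3 : Integrable fun x => pd (sdir i) f (x, t) * pd (sdir i) g (x, t) * gau (x, t) :=
      ((((hs.pd (sdir i)).mul_left (pd (sdir i) f)).mul_right gau).integrable
        (((contDiff_pd hf _).mul hgi).mul contDiff_gau).continuous t :)
    have e1 : ∀ x : Euc n, f (x, t) * (pd (sdir i) (pd (sdir i) g) (x, t)
        - 1 / 2 * (x i * pd (sdir i) g (x, t))) * gau (x, t) =
        f (x, t) * gau (x, t) * pd (sdir i) (pd (sdir i) g) (x, t)
          - f (x, t) * (x i / 2) * gau (x, t) * pd (sdir i) g (x, t) := fun x => by ring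
    have e2 : ∀ x : Euc n, pd (sdir i) (fun z => f z * gau z) (x, t) * pd (sdir i) g (x, t) =
        pd (sdir i) f (x, t) * pd (sdir i) g (x, t) * gau (x, t)
          - f (x, t) * (x i / 2) * gau (x, t) * pd (sdir i) g (x, t) := fun x => by
      rw [pd_mul hf contDiff_gau, pd_sdir_gau]
      ring
    simp only [e1, e2] at h ⊢
    rw [integral_sub i1 i2, h, integral_sub i3 i2]
    ring
  have i4 : ∀ i : Fin n, Integrable fun x => (f (x, t) * (pd (sdir i) (pd (sdir i) g) (x, t)
        - 1 / 2 * (x i * pd (sdir i) g (x, t))) * gau (x, t)) := fun i => by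
    have hb : SpaceBdd fun z => f z * (pd (sdir i) (pd (sdir i) g) z
        + (-(1 / 2) * z.1 i) * pd (sdir i) g z) * gau z :=
      ((((hs.pd (sdir i)).pd (sdir i)).add ((hs.pd (sdir i)).mul_left _)).mul_left f).mul_right gau
    refine (hb.integrable (((hf.mul ((contDiff_pd (contDiff_pd hg _) _).add
      ((contDiff_const.mul (contDiff_coord i)).mul (contDiff_pd hg _)))).mul
      contDiff_gau).continuous) t).congr (Eventually.of_forall fun x => ?_)
    simp only
    ring
  have i5 : ∀ i : Fin n, Integrable fun x =>
      pd (sdir i) f (x, t) * pd (sdir i) g (x, t) * gau (x, t) := fun i =>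
    ((((hs.pd (sdir i)).mul_left (pd (sdir i) f)).mul_right gau).integrable
      (((contDiff_pd hf _).mul (contDiff_pd hg _)).mul contDiff_gau).continuous t :)
  have e3 : ∀ x : Euc n, f (x, t) * ou g (x, t) * gau (x, t) =
      ∑ i, (f (x, t) * (pd (sdir i) (pd (sdir i) g) (x, t)
        - 1 / 2 * (x i * pd (sdir i) g (x, t))) * gau (x, t)) := fun x => by
    rw [← Finset.sum_mul, ← Finset.mul_sum, Finset.sum_sub_distrib, ← Finset.mul_sum]
    rfl
  simp only [e3, Finset.sum_mul]
  rw [integral_finsetSum _ fun i _ => i4 i, integral_finsetSum _ fun i _ => i5 i,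
    ← Finset.sum_neg_distrib]
  exact Finset.sum_congr rfl fun i _ => key i

/-- The weighted `L²` mass. -/
noncomputable def mass (f : Euc n × ℝ → ℝ) (t : ℝ) : ℝ := ∫ x, f (x, t) ^ 2 * gau (x, t)

/-- The weighted Dirichlet energy. -/
noncomputable def energy (f : Euc n × ℝ → ℝ) (t : ℝ) : ℝ := ∫ x, gsq f (x, t) * gau (x, t)

lemma SpaceBdd.gsq {f : Euc n × ℝ → ℝ} (hs : SpaceBdd f) : SpaceBdd (gsq f) :=
  SpaceBdd.sum fun i => by
    simpa [sq] using (hs.pd (sdir i)).mul_left (_root_.pd (sdir i) f)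

lemma SpaceBdd.ou {f : Euc n × ℝ → ℝ} (hs : SpaceBdd f) : SpaceBdd (ou f) := by
  have h1 : SpaceBdd (lap f) := SpaceBdd.sum fun i => (hs.pd (sdir i)).pd (sdir i)
  have h2 : SpaceBdd fun z : Euc n × ℝ => ∑ i, z.1 i * _root_.pd (sdir i) f z :=
    SpaceBdd.sum fun i => (hs.pd (sdir i)).mul_left fun z => z.1 i
  have := h1.add (h2.mul_left fun _ => -(1 / 2))
  intro t₀
  obtain ⟨M, hM⟩ := this t₀
  exact ⟨M, fun t ht x hx => by rw [← hM t ht x hx, _root_.ou]; ring⟩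

lemma energy_eq {f : Euc n × ℝ → ℝ} (hf : ContDiff ℝ ∞ f) (hs : SpaceBdd f) (t : ℝ) :
    energy f t = -∫ x, f (x, t) * ou f (x, t) * gau (x, t) := by
  rw [integral_mul_ou hf hf hs, neg_neg, energy]
  simp only [gsq, sq]

lemma hasDerivAt_mass {f : Euc n × ℝ → ℝ} (hf : ContDiff ℝ ∞ f) (hs : SpaceBdd f) (t : ℝ) :
    HasDerivAt (mass f) (2 * energy f t +
      2 * ∫ x, f (x, t) * (pd (tdir n) f (x, t) + ou f (x, t)) * gau (x, t)) t := by
  have hsm : ContDiff ℝ ∞ fun z => f z * (f z * gau z) := hf.mul (hf.mul contDiff_gau)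
  have h := (hs.mul_right fun z => f z * gau z).hasDerivAt_integral hsm t
  have e : (fun t => ∫ x, f (x, t) * (f (x, t) * gau (x, t))) = mass f := by
    ext t; simp only [mass, sq, mul_assoc]
  rw [e] at h
  convert h using 1
  have i1 : Integrable fun x => f (x, t) * (pd (tdir n) f (x, t) + ou f (x, t)) * gau (x, t) :=
    ((hs.mul_right fun z => pd (tdir n) f z + ou f z).mul_right gau).integrable
      ((hf.mul ((contDiff_pd hf _).add (contDiff_ou hf))).mul contDiff_gau).continuous t
  have i2 : Integrable fun x => f (x, t) * ou f (x, t) * gau (x, t) :=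
    ((hs.mul_right (ou f)).mul_right gau).integrable
      ((hf.mul (contDiff_ou hf)).mul contDiff_gau).continuous t
  rw [energy_eq hf hs, mul_neg, ← integral_const_mul, ← integral_const_mul, neg_add_eq_sub,
    ← integral_sub (i1.const_mul 2) (i2.const_mul 2)]
  refine integral_congr_ae (Eventually.of_forall fun x => ?_)
  simp only
  rw [pd_mul hf (hf.mul contDiff_gau), pd_mul hf contDiff_gau, pd_tdir_gau]
  ring

lemma hasDerivAt_energy {f : Euc n × ℝ → ℝ} (hf : ContDiff ℝ ∞ f) (hs : SpaceBdd f) (t : ℝ) :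
    HasDerivAt (energy f) (2 * (∫ x, ou f (x, t) ^ 2 * gau (x, t)) -
      2 * ∫ x, ou f (x, t) * (pd (tdir n) f (x, t) + ou f (x, t)) * gau (x, t)) t := by
  have hsm : ContDiff ℝ ∞ fun z => gsq f z * gau z := (contDiff_gsq hf).mul contDiff_gau
  have h : HasDerivAt (energy f) _ t := (hs.gsq.mul_right gau).hasDerivAt_integral hsm t
  convert h using 1
  have i1 : Integrable fun x => ou f (x, t) * (pd (tdir n) f (x, t) + ou f (x, t)) * gau (x, t) :=
    ((hs.ou.mul_right fun z => pd (tdir n) f z + ou f z).mul_right gau).integrable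
      (((contDiff_ou hf).mul ((contDiff_pd hf _).add (contDiff_ou hf))).mul
        contDiff_gau).continuous t
  have i2 : Integrable fun x => ou f (x, t) ^ 2 * gau (x, t) := by
    simpa only [sq] using ((hs.ou.mul_right (ou f)).mul_right gau).integrable
      (((contDiff_ou hf).mul (contDiff_ou hf)).mul contDiff_gau).continuous t
  have h3 := integral_mul_ou (contDiff_pd hf (tdir n)) hf hs t
  have e : ∀ x, pd (tdir n) (fun z => gsq f z * gau z) (x, t) =
      2 * ((∑ i, pd (sdir i) (pd (tdir n) f) (x, t) * pd (sdir i) f (x, t)) * gau (x, t)) := by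
    intro x
    rw [pd_mul (contDiff_gsq hf) contDiff_gau, pd_tdir_gau]
    have e2 : pd (tdir n) (gsq f) (x, t) =
        2 * ∑ i, pd (sdir i) (pd (tdir n) f) (x, t) * pd (sdir i) f (x, t) := by
      unfold gsq
      rw [pd_sum fun i => (contDiff_pd hf _).pow 2, Finset.mul_sum]
      refine Finset.sum_congr rfl fun i _ => ?_
      simp only [sq]
      rw [pd_mul (contDiff_pd hf _) (contDiff_pd hf _), pd_comm hf]
      ring
    rw [e2]
    ring
  simp only [e]
  rw [integral_const_mul, ← neg_eq_iff_eq_neg.2 h3, ← integral_neg, ← integral_const_mul,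
    ← integral_const_mul, ← integral_const_mul, ← integral_sub (i2.const_mul 2) (i1.const_mul 2)]
  refine integral_congr_ae (Eventually.of_forall fun x => ?_)
  ring

lemma integral_coord_sq_mul_sq_le {f : Euc n × ℝ → ℝ} (hf : ContDiff ℝ ∞ f) (hs : SpaceBdd f)
    (i : Fin n) (t : ℝ) :
    ∫ x : Euc n, x i ^ 2 * f (x, t) ^ 2 * gau (x, t) ≤
      4 * mass f t + 16 * ∫ x, pd (sdir i) f (x, t) ^ 2 * gau (x, t) := by
  have hc := contDiff_coord (n := n) i
  have hfi := contDiff_pd hf (sdir i)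
  have hsq : SpaceBdd fun z => f z ^ 2 := by simpa only [sq] using hs.mul_right f
  have hpc : ∀ z : Euc n × ℝ, pd (sdir i) (fun z : Euc n × ℝ => z.1 i) z = 1 := by
    intro z
    have h1 : HasFDerivAt (fun z : Euc n × ℝ => z.1 i) _ z :=
      ((EuclideanSpace.proj (𝕜 := ℝ) i).comp (ContinuousLinearMap.fst ℝ (Euc n) ℝ)).hasFDerivAt
    unfold pd
    rw [h1.fderiv]
    simp [sdir]
  have h := integral_mul_pd (hc.mul contDiff_gau) (hf.mul hf) (hs.mul_right f) i t
  have i0 : Integrable fun x : Euc n => x i ^ 2 * f (x, t) ^ 2 * gau (x, t) :=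
    ((hsq.mul_left fun z => z.1 i ^ 2).mul_right gau).integrable
      (((hc.pow 2).mul (hf.pow 2)).mul contDiff_gau).continuous t
  have i1 : Integrable fun x => f (x, t) ^ 2 * gau (x, t) :=
    (hsq.mul_right gau).integrable ((hf.pow 2).mul contDiff_gau).continuous t
  have i2 : Integrable fun x => pd (sdir i) f (x, t) ^ 2 * gau (x, t) := by
    have : SpaceBdd fun z => pd (sdir i) f z ^ 2 := by
      simpa only [sq] using (hs.pd (sdir i)).mul_right (pd (sdir i) f)
    exact (this.mul_right gau).integrable ((hfi.pow 2).mul contDiff_gau).continuous t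
  have i3 : Integrable fun x : Euc n => x i * gau (x, t) * pd (sdir i) (fun z => f z * f z) (x, t) :=
    (((hs.mul_right f).pd (sdir i)).mul_left fun z => z.1 i * gau z).integrable
      ((hc.mul contDiff_gau).mul (contDiff_pd (hf.mul hf) _)).continuous t
  have h1 : ∫ x : Euc n, x i * gau (x, t) * pd (sdir i) (fun z => f z * f z) (x, t) ≤
      1 / 4 * (∫ x : Euc n, x i ^ 2 * f (x, t) ^ 2 * gau (x, t)) +
        4 * ∫ x, pd (sdir i) f (x, t) ^ 2 * gau (x, t) := by
    rw [← integral_const_mul, ← integral_const_mul,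
      ← integral_add (i0.const_mul _) (i2.const_mul _)]
    refine integral_mono i3 ((i0.const_mul _).add (i2.const_mul _)) fun x => ?_
    simp only [pd_mul hf hf]
    nlinarith [mul_nonneg (gau_pos (x, t)).le
      (sq_nonneg (x i * f (x, t) / 2 - 2 * pd (sdir i) f (x, t)))]
  have h2 : ∫ x : Euc n, pd (sdir i) (fun z => z.1 i * gau z) (x, t) * (f (x, t) * f (x, t)) =
      mass f t - 1 / 2 * ∫ x : Euc n, x i ^ 2 * f (x, t) ^ 2 * gau (x, t) := by
    rw [mass, ← integral_const_mul, ← integral_sub i1 (i0.const_mul _)]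
    refine integral_congr_ae (Eventually.of_forall fun x => ?_)
    simp only [pd_mul hc contDiff_gau, pd_sdir_gau, hpc]
    ring
  rw [h2] at h
  linarith

/-- A Gaussian Hardy-type inequality. -/
lemma integral_norm_sq_mul_sq_le {f : Euc n × ℝ → ℝ} (hf : ContDiff ℝ ∞ f) (hs : SpaceBdd f)
    (t : ℝ) :
    ∫ x, ‖x‖ ^ 2 * f (x, t) ^ 2 * gau (x, t) ≤ 4 * n * mass f t + 16 * energy f t := by
  have hsq : SpaceBdd fun z => f z ^ 2 := by simpa only [sq] using hs.mul_right f
  have i0 : ∀ i : Fin n, Integrable fun x : Euc n => x i ^ 2 * f (x, t) ^ 2 * gau (x, t) :=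
    fun i => ((hsq.mul_left fun z => z.1 i ^ 2).mul_right gau).integrable
      ((((contDiff_coord i).pow 2).mul (hf.pow 2)).mul contDiff_gau).continuous t
  have i2 : ∀ i : Fin n, Integrable fun x => pd (sdir i) f (x, t) ^ 2 * gau (x, t) := fun i => by
    have : SpaceBdd fun z => pd (sdir i) f z ^ 2 := by
      simpa only [sq] using (hs.pd (sdir i)).mul_right (pd (sdir i) f)
    exact (this.mul_right gau).integrable
      (((contDiff_pd hf _).pow 2).mul contDiff_gau).continuous t
  have e : ∀ x : Euc n, ‖x‖ ^ 2 * f (x, t) ^ 2 * gau (x, t) =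
      ∑ i, x i ^ 2 * f (x, t) ^ 2 * gau (x, t) := fun x => by
    rw [← Finset.sum_mul, ← Finset.sum_mul, EuclideanSpace.norm_sq_eq]
    simp
  simp only [e, energy, gsq, Finset.sum_mul]
  rw [integral_finsetSum _ fun i _ => i0 i, integral_finsetSum _ fun i _ => i2 i, Finset.mul_sum]
  refine (Finset.sum_le_sum fun i _ => integral_coord_sq_mul_sq_le hf hs i t).trans ?_
  rw [Finset.sum_add_distrib]
  simp
  linarith

section

variable {f : Euc n × ℝ → ℝ} {t s R : ℝ} {h : Euc n → ℝ}

lemma mass_nonneg (f : Euc n × ℝ → ℝ) (t : ℝ) : 0 ≤ mass f t :=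
  integral_nonneg fun x => mul_nonneg (sq_nonneg _) (gau_pos (x, t)).le

lemma energy_nonneg (f : Euc n × ℝ → ℝ) (t : ℝ) : 0 ≤ energy f t :=
  integral_nonneg fun x => mul_nonneg (gsq_nonneg _ _) (gau_pos (x, t)).le

lemma integrable_mass (hf : ContDiff ℝ ∞ f) (hs : SpaceBdd f) (t : ℝ) :
    Integrable fun x => f (x, t) ^ 2 * gau (x, t) := by
  have hsq : SpaceBdd fun z => f z ^ 2 := by simpa only [sq] using hs.mul_right f
  exact (hsq.mul_right gau).integrable ((hf.pow 2).mul contDiff_gau).continuous t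

lemma integrable_energy (hf : ContDiff ℝ ∞ f) (hs : SpaceBdd f) (t : ℝ) :
    Integrable fun x => gsq f (x, t) * gau (x, t) :=
  (hs.gsq.mul_right gau).integrable ((contDiff_gsq hf).mul contDiff_gau).continuous t

/-- Almost monotonicity of the Gaussian mass. -/
lemma le_deriv_mass (hf : ContDiff ℝ ∞ f) (hs : SpaceBdd f) (hspos : 0 < s) (hR : 0 < R)
    (hh : Integrable fun x => h x ^ 2 * gau (x, t))
    (hF : ∀ x, |pd (tdir n) f (x, t) + ou f (x, t)| ≤
      s * R ^ 2 * |f (x, t)| + √s * R * √(gsq f (x, t)) + h x) :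
    -(4 * s * R ^ 2) * mass f t - (∫ x, h x ^ 2 * gau (x, t)) / (s * R ^ 2) ≤
      2 * energy f t + 2 * ∫ x, f (x, t) * (pd (tdir n) f (x, t) + ou f (x, t)) * gau (x, t) := by
  have i1 := integrable_mass hf hs t
  have i2 := integrable_energy hf hs t
  have i3 : Integrable fun x => f (x, t) * (pd (tdir n) f (x, t) + ou f (x, t)) * gau (x, t) :=
    ((hs.mul_right fun z => pd (tdir n) f z + ou f z).mul_right gau).integrable
      ((hf.mul ((contDiff_pd hf _).add (contDiff_ou hf))).mul contDiff_gau).continuous t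
  unfold mass energy
  rw [div_eq_inv_mul, ← integral_const_mul, ← integral_const_mul, ← integral_const_mul,
    ← integral_const_mul, ← integral_sub (i1.const_mul _) (hh.const_mul _),
    ← integral_add (i2.const_mul _) (i3.const_mul _)]
  refine integral_mono ((i1.const_mul _).sub (hh.const_mul _))
    ((i2.const_mul _).add (i3.const_mul _)) fun x => ?_
  simp only
  set w := f (x, t)
  set F := pd (tdir n) f (x, t) + ou f (x, t)
  set g := √(gsq f (x, t)) with hg
  have hg2 : gsq f (x, t) = g ^ 2 := (Real.sq_sqrt (gsq_nonneg _ _)).symm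
  set l := √s with hl
  have hl2 : s = l ^ 2 := (Real.sq_sqrt hspos.le).symm
  have h1 : -(|w| * (s * R ^ 2 * |w| + l * R * g + h x)) ≤ w * F := by
    have := mul_le_mul_of_nonneg_left (hF x) (abs_nonneg w)
    have h2 := neg_abs_le (w * F)
    rw [abs_mul] at h2
    linarith
  have hsR : 0 < s * R ^ 2 := by positivity
  have h3 : 2 * (|w| * h x) ≤ s * R ^ 2 * w ^ 2 + (s * R ^ 2)⁻¹ * h x ^ 2 := by
    have h4 : 0 ≤ (s * R ^ 2)⁻¹ * (s * R ^ 2 * |w| - h x) ^ 2 := by positivity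
    have h5 : (s * R ^ 2)⁻¹ * (s * R ^ 2 * |w| - h x) ^ 2 =
        s * R ^ 2 * |w| ^ 2 - 2 * (|w| * h x) + (s * R ^ 2)⁻¹ * h x ^ 2 := by
      field_simp
      ring
    rw [h5, sq_abs] at h4
    linarith
  have h6 : 2 * (|w| * (l * R * g)) ≤ 2 * g ^ 2 + s * R ^ 2 * w ^ 2 := by
    rw [hl2, ← sq_abs w]
    nlinarith [sq_nonneg (g - l * R * |w|), sq_nonneg g]
  have h7 : -(4 * s * R ^ 2) * w ^ 2 - (s * R ^ 2)⁻¹ * h x ^ 2 ≤ 2 * g ^ 2 + 2 * (w * F) := by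
    have h8 : |w| * |w| = w ^ 2 := by rw [← sq, sq_abs]
    have h9 : |w| * (s * R ^ 2 * |w|) = s * R ^ 2 * w ^ 2 := by rw [← h8]; ring
    nlinarith
  rw [hg2]
  have := mul_le_mul_of_nonneg_right h7 (gau_pos (x, t)).le
  linarith

/-- The Carleman-type differential inequality at a fixed time. -/
lemma frequency_deriv_le (hf : ContDiff ℝ ∞ f) (hs : SpaceBdd f) (hspos : 0 < s) (hs1 : s ≤ 1 / 10)
    {α : ℝ} (hα : α ≤ 2 * R ^ 2)
    (hh : Integrable fun x => h x ^ 2 * gau (x, t))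
    (hF : ∀ x, |pd (tdir n) f (x, t) + ou f (x, t)| ≤
      s * R ^ 2 * |f (x, t)| + √s * R * √(gsq f (x, t)) + h x) :
    -(10 * s * R ^ 4) * mass f t + α * (2 * energy f t +
      2 * ∫ x, f (x, t) * (pd (tdir n) f (x, t) + ou f (x, t)) * gau (x, t)) -
      (2 * (∫ x, ou f (x, t) ^ 2 * gau (x, t)) -
      2 * ∫ x, ou f (x, t) * (pd (tdir n) f (x, t) + ou f (x, t)) * gau (x, t)) -
      2 * α * (α * mass f t - energy f t) ≤
    -(3 * s * R ^ 4) * mass f t + 3 * ∫ x, h x ^ 2 * gau (x, t) := by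
  have i1 := integrable_mass hf hs t
  have i2 := integrable_energy hf hs t
  have hFs : ContDiff ℝ ∞ fun z => pd (tdir n) f z + ou f z :=
    (contDiff_pd hf _).add (contDiff_ou hf)
  have i3 : Integrable fun x => f (x, t) * (pd (tdir n) f (x, t) + ou f (x, t)) * gau (x, t) :=
    ((hs.mul_right fun z => pd (tdir n) f z + ou f z).mul_right gau).integrable
      ((hf.mul hFs).mul contDiff_gau).continuous t
  have i4 : Integrable fun x => ou f (x, t) * (pd (tdir n) f (x, t) + ou f (x, t)) * gau (x, t) :=
    ((hs.ou.mul_right fun z => pd (tdir n) f z + ou f z).mul_right gau).integrable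
      (((contDiff_ou hf).mul hFs).mul contDiff_gau).continuous t
  have i5 : Integrable fun x => ou f (x, t) ^ 2 * gau (x, t) := by
    simpa only [sq] using ((hs.ou.mul_right (ou f)).mul_right gau).integrable
      (((contDiff_ou hf).mul (contDiff_ou hf)).mul contDiff_gau).continuous t
  have i6 : Integrable fun x => f (x, t) * ou f (x, t) * gau (x, t) :=
    ((hs.mul_right (ou f)).mul_right gau).integrable
      ((hf.mul (contDiff_ou hf)).mul contDiff_gau).continuous t
  have hE := energy_eq hf hs t
  set m := mass f t with hm
  set E := energy f t with hEE
  have key : 0 ≤ ∫ x, (3 * (h x ^ 2 * gau (x, t)) +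
      (3 * s ^ 2 * R ^ 4 + 9 / 4 * s ^ 2 * R ^ 4) *
        (f (x, t) ^ 2 * gau (x, t)) +
      3 * s * R ^ 2 * (gsq f (x, t) * gau (x, t)) +
      3 * s * R ^ 2 * (f (x, t) * ou f (x, t) * gau (x, t)) +
      3 * s * R ^ 2 * α * (f (x, t) ^ 2 * gau (x, t)) +
      2 * (ou f (x, t) ^ 2 * gau (x, t)) +
      4 * α * (f (x, t) * ou f (x, t) * gau (x, t)) +
      2 * α ^ 2 * (f (x, t) ^ 2 * gau (x, t)) -
      2 * (ou f (x, t) * (pd (tdir n) f (x, t) + ou f (x, t)) * gau (x, t)) -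
      2 * α * (f (x, t) * (pd (tdir n) f (x, t) + ou f (x, t)) * gau (x, t))) := by
    refine integral_nonneg fun x => ?_
    show 0 ≤ _
    set w := f (x, t)
    set P := ou f (x, t)
    set F := pd (tdir n) f (x, t) + P
    set g := √(gsq f (x, t)) with hg
    have hg2 : gsq f (x, t) = g ^ 2 := (Real.sq_sqrt (gsq_nonneg _ _)).symm
    set l := √s with hl
    have hl2 : s = l ^ 2 := (Real.sq_sqrt hspos.le).symm
    have h1 : F ^ 2 ≤ 3 * (s ^ 2 * R ^ 4 * w ^ 2 + s * R ^ 2 * g ^ 2 + h x ^ 2) := by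
      have h2 : F ^ 2 ≤ (s * R ^ 2 * |w| + l * R * g + h x) ^ 2 := by
        rw [← sq_abs F]
        exact pow_le_pow_left₀ (abs_nonneg _) (hF x) 2
      have h3 : (s * R ^ 2 * |w|) ^ 2 = s ^ 2 * R ^ 4 * w ^ 2 := by rw [mul_pow, sq_abs]; ring
      have h4 : (l * R * g) ^ 2 = s * R ^ 2 * g ^ 2 := by rw [hl2]; ring
      nlinarith [sq_nonneg (s * R ^ 2 * |w| - l * R * g), sq_nonneg (s * R ^ 2 * |w| - h x),
        sq_nonneg (l * R * g - h x)]
    have h5 : 0 ≤ (P + α * w - F) ^ 2 + (P + α * w + 3 / 2 * s * R ^ 2 * w) ^ 2 := by positivity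
    have h6 : 0 ≤ 3 * h x ^ 2 +
      (3 * s ^ 2 * R ^ 4 + 9 / 4 * s ^ 2 * R ^ 4) * w ^ 2 +
      3 * s * R ^ 2 * g ^ 2 + 3 * s * R ^ 2 * (w * P) + 3 * s * R ^ 2 * α * w ^ 2 + 2 * P ^ 2 +
      4 * α * (w * P) + 2 * α ^ 2 * w ^ 2 - 2 * (P * F) - 2 * α * (w * F) := by
      nlinarith
    rw [hg2]
    have := mul_nonneg h6 (gau_pos (x, t)).le
    linarith
  rw [integral_sub, integral_sub, integral_add, integral_add, integral_add, integral_add,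
    integral_add, integral_add, integral_add] at key
  · simp only [integral_const_mul] at key
    rw [← mass, ← energy, ← hm, ← hEE] at key
    have hm0 : 0 ≤ m := mass_nonneg f t
    have h7 : 3 * s * R ^ 2 * α * m ≤ 6 * s * R ^ 4 * m := by
      have : 3 * s * R ^ 2 * α ≤ 6 * s * R ^ 4 := by
        nlinarith [mul_le_mul_of_nonneg_left hα (by positivity : 0 ≤ 3 * s * R ^ 2)]
      exact mul_le_mul_of_nonneg_right this hm0
    have h8 : (3 * s ^ 2 * R ^ 4 + 9 / 4 * s ^ 2 * R ^ 4) * m ≤ s * R ^ 4 * m := by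
      have : 3 * s ^ 2 * R ^ 4 + 9 / 4 * s ^ 2 * R ^ 4 ≤ s * R ^ 4 := by
        have : 0 ≤ s * R ^ 4 := by positivity
        nlinarith
      exact mul_le_mul_of_nonneg_right this hm0
    have h9 : ∫ x, f (x, t) * ou f (x, t) * gau (x, t) = -E := by rw [hE]; ring
    rw [h9] at key
    linarith
  all_goals
    first
    | exact hh.const_mul _
    | exact i1.const_mul _
    | fun_prop (disch := assumption)

end

section

/-- Parabolic self-similar coordinates centred at the space-time point `(0, t₀ - a)`. -/
noncomputable def selfSim (t₀ a : ℝ) (z : Euc n × ℝ) : Euc n × ℝ :=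
  (rexp (z.2 / 2) • z.1, t₀ + rexp z.2 - a)

variable {w : Euc n × ℝ → ℝ} {t₀ a : ℝ}

lemma contDiff_selfSim : ContDiff ℝ ∞ (selfSim (n := n) t₀ a) := by
  unfold selfSim
  fun_prop

lemma contDiff_comp_selfSim (hw : ContDiff ℝ ∞ w) :
    ContDiff ℝ ∞ fun z => w (selfSim t₀ a z) :=
  hw.comp contDiff_selfSim

lemma spaceBdd_comp_selfSim (hw : ∀ x t, 5 ≤ ‖x‖ → w (x, t) = 0) :
    SpaceBdd fun z => w (selfSim t₀ a z) := by
  intro τ₀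
  refine ⟨5 * rexp (-((τ₀ - 1) / 2)), fun t ht x hx => hw _ _ ?_⟩
  rw [norm_smul, norm_of_nonneg (exp_pos _).le]
  have h1 : rexp ((τ₀ - 1) / 2) ≤ rexp (t / 2) := by
    rw [abs_lt] at ht
    exact exp_le_exp.2 (by linarith)
  have h2 : 5 = rexp ((τ₀ - 1) / 2) * (5 * rexp (-((τ₀ - 1) / 2))) := by
    rw [exp_neg]
    field_simp
  rw [h2]
  exact mul_le_mul h1 hx.le (by positivity) (exp_pos _).le

lemma hasFDerivAt_selfSim (z : Euc n × ℝ) : ∃ L : Euc n × ℝ →L[ℝ] Euc n × ℝ,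
    HasFDerivAt (selfSim (n := n) t₀ a) L z ∧
    ∀ v, L v = (rexp (z.2 / 2) • v.1 + (rexp (z.2 / 2) * (v.2 / 2)) • z.1, rexp z.2 * v.2) := by
  have h2 : HasFDerivAt (fun z : Euc n × ℝ => z.2) (ContinuousLinearMap.snd ℝ (Euc n) ℝ) z :=
    (ContinuousLinearMap.snd ℝ (Euc n) ℝ).hasFDerivAt
  have h1 : HasFDerivAt (fun z : Euc n × ℝ => z.1) (ContinuousLinearMap.fst ℝ (Euc n) ℝ) z :=
    (ContinuousLinearMap.fst ℝ (Euc n) ℝ).hasFDerivAt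
  have h3 := ((h2.mul_const (1 / 2)).exp.smul h1).prodMk ((h2.exp.const_add t₀).sub_const a)
  refine ⟨_, h3.congr_of_eventuallyEq (Eventually.of_forall fun z => ?_), fun v => ?_⟩
  · simp [selfSim, div_eq_mul_inv]
  · simp [div_eq_mul_inv]
    ring_nf

lemma pd_comp_selfSim (hw : ContDiff ℝ ∞ w) (v z : Euc n × ℝ) :
    pd v (fun z => w (selfSim t₀ a z)) z = fderiv ℝ w (selfSim t₀ a z)
      (rexp (z.2 / 2) • v.1 + (rexp (z.2 / 2) * (v.2 / 2)) • z.1, rexp z.2 * v.2) := by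
  obtain ⟨L, hL, hLv⟩ := hasFDerivAt_selfSim (t₀ := t₀) (a := a) z
  have h : HasFDerivAt (fun z => w (selfSim t₀ a z)) _ z :=
    ((hw.differentiable (by simp)) (selfSim t₀ a z)).hasFDerivAt.comp z hL
  rw [pd, h.fderiv]
  simp [hLv]

lemma pd_sdir_comp_selfSim (hw : ContDiff ℝ ∞ w) (i : Fin n) (z : Euc n × ℝ) :
    pd (sdir i) (fun z => w (selfSim t₀ a z)) z =
      rexp (z.2 / 2) * pd (sdir i) w (selfSim t₀ a z) := by
  rw [pd_comp_selfSim hw, pd, ← smul_eq_mul (rexp (z.2 / 2)) (fderiv _ _ _ _), ← map_smul]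
  simp [sdir]

lemma pd_tdir_comp_selfSim (hw : ContDiff ℝ ∞ w) (z : Euc n × ℝ) :
    pd (tdir n) (fun z => w (selfSim t₀ a z)) z =
      1 / 2 * (rexp (z.2 / 2) * ∑ i, z.1 i * pd (sdir i) w (selfSim t₀ a z)) +
        rexp z.2 * pd (tdir n) w (selfSim t₀ a z) := by
  rw [pd_comp_selfSim hw]
  have e : (rexp (z.2 / 2) • (tdir n).1 + (rexp (z.2 / 2) * ((tdir n).2 / 2)) • z.1,
      rexp z.2 * (tdir n).2) = (1 / 2 * rexp (z.2 / 2)) • (∑ i, z.1 i • sdir i) +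
      rexp z.2 • tdir n := by
    have h : ∑ i, z.1 i • sdir i = ((z.1, 0) : Euc n × ℝ) := by
      refine Prod.ext ?_ ?_
      · rw [Prod.fst_sum]
        ext j
        simp [sdir, Pi.single_apply]
      · rw [Prod.snd_sum]
        simp [sdir]
    rw [h]
    refine Prod.ext ?_ ?_
    · simp [tdir, mul_comm]
    · simp [tdir]
  rw [e, map_add, map_smul, map_smul, map_sum]
  simp [pd]
  ring

lemma lap_comp_selfSim (hw : ContDiff ℝ ∞ w) (z : Euc n × ℝ) :
    lap (fun z => w (selfSim t₀ a z)) z = rexp z.2 * lap w (selfSim t₀ a z) := by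
  unfold lap
  rw [Finset.mul_sum]
  refine Finset.sum_congr rfl fun i _ => ?_
  have h1 : pd (sdir i) (fun z => w (selfSim t₀ a z)) =
      fun z => rexp (z.2 / 2) * pd (sdir i) w (selfSim t₀ a z) :=
    funext fun z => pd_sdir_comp_selfSim hw i z
  have h2 : pd (sdir i) (fun z : Euc n × ℝ => rexp (z.2 / 2)) z = 0 := by
    have h2 : HasFDerivAt (fun z : Euc n × ℝ => z.2) (ContinuousLinearMap.snd ℝ (Euc n) ℝ) z :=
      (ContinuousLinearMap.snd ℝ (Euc n) ℝ).hasFDerivAt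
    have h3 : HasFDerivAt (fun z : Euc n × ℝ => rexp (z.2 / 2)) _ z :=
      (h2.mul_const (2⁻¹)).exp
    rw [pd, h3.fderiv]
    simp [sdir]
  rw [h1, pd_mul (by fun_prop) (contDiff_comp_selfSim (contDiff_pd hw _)), h2,
    pd_sdir_comp_selfSim (contDiff_pd hw _), zero_mul, zero_add, ← mul_assoc, ← exp_add,
    add_halves]

lemma gsq_comp_selfSim (hw : ContDiff ℝ ∞ w) (z : Euc n × ℝ) :
    gsq (fun z => w (selfSim t₀ a z)) z = rexp z.2 * gsq w (selfSim t₀ a z) := by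
  unfold gsq
  rw [Finset.mul_sum]
  refine Finset.sum_congr rfl fun i _ => ?_
  rw [pd_sdir_comp_selfSim hw, mul_pow, ← exp_nat_mul]
  congr 2
  push_cast
  ring

lemma pd_add_ou_comp_selfSim (hw : ContDiff ℝ ∞ w) (z : Euc n × ℝ) :
    pd (tdir n) (fun z => w (selfSim t₀ a z)) z + ou (fun z => w (selfSim t₀ a z)) z =
      rexp z.2 * (lap w (selfSim t₀ a z) + pd (tdir n) w (selfSim t₀ a z)) := by
  unfold ou
  rw [pd_tdir_comp_selfSim hw, lap_comp_selfSim hw]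
  simp only [pd_sdir_comp_selfSim hw]
  have : ∑ i, z.1 i * (rexp (z.2 / 2) * pd (sdir i) w (selfSim t₀ a z)) =
      rexp (z.2 / 2) * ∑ i, z.1 i * pd (sdir i) w (selfSim t₀ a z) := by
    rw [Finset.mul_sum]
    exact Finset.sum_congr rfl fun i _ => by ring
  rw [this]
  ring

end

section

/-- The total mass of a slowly decaying Gaussian, which dominates all Gaussian tails. -/
noncomputable def gconst (n : ℕ) : ℝ := 1 + ∫ x : Euc n, rexp (-‖x‖ ^ 2 / 8)

lemma integrable_exp_neg_norm_sq {b : ℝ} (hb : 0 < b) :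
    Integrable fun x : Euc n => rexp (-‖x‖ ^ 2 / b) := by
  have := GaussianFourier.integrable_cexp_neg_mul_sq_norm_add (V := Euc n) (b := (1 / b : ℝ))
    (by simpa using hb) 0 0
  refine this.re.congr (Eventually.of_forall fun x => ?_)
  simp only [zero_mul, add_zero]
  have : (-((1 / b : ℝ) : ℂ) * (‖x‖ : ℂ) ^ 2) = ((-‖x‖ ^ 2 / b : ℝ) : ℂ) := by
    push_cast
    ring
  rw [this]
  exact Complex.exp_ofReal_re _

lemma one_le_gconst : 1 ≤ gconst n := by
  unfold gconst
  have : 0 ≤ ∫ x : Euc n, rexp (-‖x‖ ^ 2 / 8) := integral_nonneg fun x => (exp_pos _).le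
  linarith

lemma gau_le (x : Euc n) (t : ℝ) : gau (x, t) ≤ rexp (-‖x‖ ^ 2 / 8) := by
  unfold gau
  exact exp_le_exp.2 (by nlinarith [sq_nonneg ‖x‖])

lemma integrable_mul_gau {G : Euc n → ℝ} (hG : Continuous G) {M : ℝ} (hM : ∀ x, |G x| ≤ M)
    (t : ℝ) : Integrable fun x => G x * gau (x, t) := by
  have h4 : Integrable fun x : Euc n => gau (x, t) := integrable_exp_neg_norm_sq (by norm_num)
  exact h4.bdd_mul (c := M) hG.aestronglyMeasurable (Eventually.of_forall fun x => hM x)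

lemma setIntegral_smul_ball {G : Euc n → ℝ} {l : ℝ} (hl : 0 < l) (r : ℝ) :
    ∫ x in ball (0 : Euc n) (r / l), G (l • x) = (l ^ n)⁻¹ * ∫ x in ball (0 : Euc n) r, G x := by
  have := Measure.setIntegral_comp_smul_of_pos (volume : Measure (Euc n)) G
    (ball (0 : Euc n) (r / l)) hl
  rw [this, _root_.smul_ball hl.ne', smul_zero, norm_of_nonneg hl.le, mul_div_cancel₀ _ hl.ne']
  simp

lemma le_gaussian_integral {G : Euc n → ℝ} (hG : Continuous G) (h0 : ∀ x, 0 ≤ G x)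
    {M : ℝ} (hM : ∀ x, G x ≤ M) {l : ℝ} (hl : 0 < l) (r t : ℝ) :
    rexp (-r ^ 2 / (4 * l ^ 2)) * ((l ^ n)⁻¹ * ∫ x in ball (0 : Euc n) r, G x) ≤
      ∫ x : Euc n, G (l • x) * gau (x, t) := by
  have hGl : Continuous fun x : Euc n => G (l • x) := hG.comp (continuous_const_smul l)
  have i1 := integrable_mul_gau hGl (fun x => (abs_of_nonneg (h0 _)).trans_le (hM (l • x))) t
  rw [← setIntegral_smul_ball hl, ← integral_const_mul]
  refine (setIntegral_mono_on ?_ i1.integrableOn measurableSet_ball fun x hx => ?_).trans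
    (setIntegral_le_integral i1 (Eventually.of_forall fun x =>
      mul_nonneg (h0 _) (gau_pos (x, t)).le))
  · exact ((hGl.continuousOn.integrableOn_compact (isCompact_closedBall _ _)).mono_set
      ball_subset_closedBall).const_mul _
  · rw [mul_comm]
    refine mul_le_mul_of_nonneg_left ?_ (h0 _)
    unfold gau
    refine exp_le_exp.2 ?_
    have h1 : ‖x‖ < r / l := by simpa using hx
    have h2 : ‖x‖ ^ 2 ≤ (r / l) ^ 2 := pow_le_pow_left₀ (norm_nonneg _) h1.le 2
    have h3 : -r ^ 2 / (4 * l ^ 2) = -((r / l) ^ 2) / 4 := by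
      field_simp
    rw [h3]
    simp only
    linarith

lemma gaussian_integral_le {G : Euc n → ℝ} (hG : Continuous G) (h0 : ∀ x, 0 ≤ G x)
    {M : ℝ} (hM : ∀ x, G x ≤ M) {l : ℝ} (hl : 0 < l) {r : ℝ} (hr : 0 ≤ r) (t : ℝ) :
    ∫ x : Euc n, G (l • x) * gau (x, t) ≤
      (l ^ n)⁻¹ * (∫ x in ball (0 : Euc n) r, G x) +
        M * (rexp (-r ^ 2 / (8 * l ^ 2)) * gconst n) := by
  have hM0 : 0 ≤ M := (h0 0).trans (hM 0)
  have hGl : Continuous fun x : Euc n => G (l • x) := hG.comp (continuous_const_smul l)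
  have i1 := integrable_mul_gau hGl (fun x => (abs_of_nonneg (h0 _)).trans_le (hM (l • x))) t
  have i2 : IntegrableOn (fun x : Euc n => G (l • x)) (ball 0 (r / l)) :=
    (hGl.continuousOn.integrableOn_compact (isCompact_closedBall _ _)).mono_set
      ball_subset_closedBall
  have i3 : Integrable fun x : Euc n => rexp (-‖x‖ ^ 2 / 8) :=
    integrable_exp_neg_norm_sq (by norm_num)
  rw [← setIntegral_smul_ball hl, ← integral_add_compl (measurableSet_ball (x := 0) (ε := r / l)) i1]
  refine add_le_add (setIntegral_mono_on i1.integrableOn i2 measurableSet_ball fun x hx => ?_) ?_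
  · refine mul_le_of_le_one_right (h0 _) ?_
    unfold gau
    exact exp_le_one_iff.2 (by simp only; nlinarith [sq_nonneg ‖x‖])
  · calc ∫ x in (ball (0 : Euc n) (r / l))ᶜ, G (l • x) * gau (x, t)
        ≤ ∫ x in (ball (0 : Euc n) (r / l))ᶜ,
          M * rexp (-r ^ 2 / (8 * l ^ 2)) * rexp (-‖x‖ ^ 2 / 8) := by
          refine setIntegral_mono_on i1.integrableOn (i3.const_mul _).integrableOn
            measurableSet_ball.compl fun x hx => ?_
          rw [mul_assoc]
          refine mul_le_mul (hM _) ?_ (gau_pos (x, t)).le hM0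
          rw [← exp_add]
          unfold gau
          refine exp_le_exp.2 ?_
          have h1 : r / l ≤ ‖x‖ := by simpa using hx
          have h2 : (r / l) ^ 2 ≤ ‖x‖ ^ 2 := pow_le_pow_left₀ (by positivity) h1 2
          have h3 : -r ^ 2 / (8 * l ^ 2) = -((r / l) ^ 2) / 8 := by
            field_simp
          rw [h3]
          simp only
          linarith
      _ ≤ ∫ x : Euc n, M * rexp (-r ^ 2 / (8 * l ^ 2)) * rexp (-‖x‖ ^ 2 / 8) :=
          setIntegral_le_integral (i3.const_mul _) (Eventually.of_forall fun x => by positivity)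
      _ ≤ _ := by
          rw [integral_const_mul, mul_assoc]
          refine mul_le_mul_of_nonneg_left (mul_le_mul_of_nonneg_left ?_ (exp_pos _).le) hM0
          unfold gconst
          linarith

end

/-- A smooth function on space-time that satisfies the differential inequality up to a
continuous error `e` which is small in mean square near the spatial origin. -/
structure AlmostSol (w e : Euc n × ℝ → ℝ) (R C t₀ T κ : ℝ) : Prop where
  smooth : ContDiff ℝ ∞ w
  supp : ∀ x t, 5 ≤ ‖x‖ → w (x, t) = 0
  abs_le : ∀ z, |w z| ≤ 1
  gsq_le : ∀ z, gsq w z ≤ (C * R) ^ 2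
  cont : Continuous e
  err_le : ∀ z, |e z| ≤ C * R ^ 2
  ineq : ∀ x, ∀ t ∈ Icc t₀ (t₀ + T), |lap w (x, t) + pd (tdir n) w (x, t)| ≤
    R ^ 2 * |w (x, t)| + R * √(gsq w (x, t)) + e (x, t)
  small : ∫ t in t₀..(t₀ + T), ∫ x in closedBall (0 : Euc n) 2, e (x, t) ^ 2 ≤ κ

lemma sub_le_of_deriv_le {f f' k : ℝ → ℝ} (hk : Continuous k) {τ₀ τ₁ t₀ a c₁ c₂ : ℝ}
    (hτ : τ₀ ≤ τ₁) (hf : ∀ τ, HasDerivAt f (f' τ) τ)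
    (hle : ∀ τ ∈ Icc τ₀ τ₁, f' τ ≤ rexp τ * (c₁ * k (t₀ + rexp τ - a) + c₂)) :
    f τ₁ - f τ₀ ≤ c₁ * (∫ t in (t₀ + rexp τ₀ - a)..(t₀ + rexp τ₁ - a), k t) +
      c₂ * (rexp τ₁ - rexp τ₀) := by
  have h1 : ∀ τ, HasDerivAt (fun τ => f τ - (c₁ * (∫ t in t₀..(t₀ + rexp τ - a), k t) +
      c₂ * rexp τ)) (f' τ - (c₁ * (k (t₀ + rexp τ - a) * rexp τ) + c₂ * rexp τ)) τ := fun τ => by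
    have h2 : HasDerivAt (fun τ => t₀ + rexp τ - a) (rexp τ) τ :=
      ((hasDerivAt_exp τ).const_add t₀).sub_const a
    have h3 := (hk.integral_hasStrictDerivAt t₀ (t₀ + rexp τ - a)).hasDerivAt.comp τ h2
    exact (hf τ).sub ((h3.const_mul c₁).add ((hasDerivAt_exp τ).const_mul c₂))
  have h4 : AntitoneOn (fun τ => f τ - (c₁ * (∫ t in t₀..(t₀ + rexp τ - a), k t) +
      c₂ * rexp τ)) (Icc τ₀ τ₁) := by
    refine antitoneOn_of_deriv_nonpos (convex_Icc _ _)
      (fun τ _ => (h1 τ).continuousAt.continuousWithinAt)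
      (fun τ _ => (h1 τ).differentiableAt.differentiableWithinAt) fun τ hτ => ?_
    rw [interior_Icc] at hτ
    rw [(h1 τ).deriv]
    have := hle τ (Ioo_subset_Icc_self hτ)
    linarith
  have h5 := h4 (left_mem_Icc.2 hτ) (right_mem_Icc.2 hτ) hτ
  have h6 : (∫ t in (t₀ + rexp τ₀ - a)..(t₀ + rexp τ₁ - a), k t) =
      (∫ t in t₀..(t₀ + rexp τ₁ - a), k t) - ∫ t in t₀..(t₀ + rexp τ₀ - a), k t := by
    rw [← intervalIntegral.integral_interval_sub_left] <;> exact hk.intervalIntegrable _ _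
  rw [h6]
  simp only at h5
  linarith

namespace AlmostSol

variable {w e : Euc n × ℝ → ℝ} {R C t₀ T κ a τ τ₀ τ₁ : ℝ}

/-- The local mean square of the error. -/
noncomputable def err (e : Euc n × ℝ → ℝ) (t : ℝ) : ℝ :=
  ∫ x in closedBall (0 : Euc n) 2, e (x, t) ^ 2

lemma continuous_err (h : AlmostSol w e R C t₀ T κ) : Continuous (err e) := by
  unfold err
  refine continuous_parametric_integral_of_continuous (f := fun t x => e (x, t) ^ 2) ?_
    (isCompact_closedBall _ _)
  exact (h.cont.comp continuous_swap).pow 2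

lemma err_nonneg (t : ℝ) : 0 ≤ err e t := integral_nonneg fun _ => sq_nonneg _

lemma integral_err_le (h : AlmostSol w e R C t₀ T κ) (h0 : a ≤ rexp τ₀) (h1 : τ₀ ≤ τ₁)
    (h2 : rexp τ₁ ≤ T + a) :
    ∫ t in (t₀ + rexp τ₀ - a)..(t₀ + rexp τ₁ - a), err e t ≤ κ := by
  have h3 : rexp τ₀ ≤ rexp τ₁ := exp_le_exp.2 h1
  refine le_trans ?_ h.small
  exact intervalIntegral.integral_mono_interval (by linarith) (by linarith) (by linarith)
    (Eventually.of_forall err_nonneg) (h.continuous_err.intervalIntegrable _ _)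

/-- The Gaussian mean square of the error at parabolic scale. -/
lemma gaussian_err_le (h : AlmostSol w e R C t₀ T κ) (a τ : ℝ) :
    ∫ x : Euc n, (rexp τ * e (selfSim t₀ a (x, τ))) ^ 2 * gau (x, τ) ≤
      rexp τ ^ 2 * ((rexp (τ / 2) ^ n)⁻¹ * err e (t₀ + rexp τ - a) +
        C ^ 2 * R ^ 4 * gconst n * rexp (-(1 / (2 * rexp τ)))) := by
  have h1 := gaussian_integral_le (G := fun x : Euc n => e (x, t₀ + rexp τ - a) ^ 2)
    ((h.cont.comp (by fun_prop)).pow 2) (fun x => sq_nonneg _) (M := C ^ 2 * R ^ 4)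
    (fun x => by
      rw [← sq_abs]
      refine (pow_le_pow_left₀ (abs_nonneg _) (h.err_le _) 2).trans_eq ?_
      ring) (exp_pos (τ / 2)) (r := 2) (by norm_num) τ
  have h2 : rexp (τ / 2) ^ 2 = rexp τ := by
    rw [← exp_nat_mul]; congr 1; push_cast; ring
  have h3 : ∫ x in ball (0 : Euc n) 2, e (x, t₀ + rexp τ - a) ^ 2 ≤ err e (t₀ + rexp τ - a) := by
    refine setIntegral_mono_set ?_ (Eventually.of_forall fun x => sq_nonneg _)
      ball_subset_closedBall.eventuallyLE
    exact ((h.cont.comp (by fun_prop)).pow 2).continuousOn.integrableOn_compact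
      (isCompact_closedBall _ _)
  rw [h2] at h1
  simp only [mul_pow, mul_assoc] at h1 ⊢
  rw [integral_const_mul]
  refine mul_le_mul_of_nonneg_left (h1.trans (add_le_add ?_ (le_of_eq ?_))) (by positivity)
  · exact mul_le_mul_of_nonneg_left h3 (by positivity)
  · have h4 : (-2 ^ 2 / (8 * rexp τ)) = -(1 / (2 * rexp τ)) := by
      field_simp
      norm_num
    rw [h4]
    ring

lemma integrable_gaussian_err (h : AlmostSol w e R C t₀ T κ) (a τ : ℝ) :
    Integrable fun x : Euc n => (rexp τ * e (selfSim t₀ a (x, τ))) ^ 2 * gau (x, τ) := by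
  refine integrable_mul_gau (M := (rexp τ * (C * R ^ 2)) ^ 2) ?_ (fun x => ?_) τ
  · exact (continuous_const.mul (h.cont.comp (contDiff_selfSim.continuous.comp (by fun_prop)))).pow 2
  · rw [abs_pow, abs_mul, abs_of_pos (exp_pos _)]
    exact pow_le_pow_left₀ (by positivity)
      (mul_le_mul_of_nonneg_left (h.err_le _) (exp_pos _).le) 2

lemma selfSim_ineq (h : AlmostSol w e R C t₀ T κ) (h0 : a ≤ rexp τ) (h1 : rexp τ ≤ T + a)
    (x : Euc n) :
    |pd (tdir n) (fun z => w (selfSim t₀ a z)) (x, τ) + ou (fun z => w (selfSim t₀ a z)) (x, τ)| ≤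
      rexp τ * R ^ 2 * |w (selfSim t₀ a (x, τ))| +
        √(rexp τ) * R * √(gsq (fun z => w (selfSim t₀ a z)) (x, τ)) +
        rexp τ * e (selfSim t₀ a (x, τ)) := by
  rw [pd_add_ou_comp_selfSim h.smooth, gsq_comp_selfSim h.smooth, abs_mul, abs_of_pos (exp_pos _),
    sqrt_mul (exp_pos _).le]
  have h2 := h.ineq (rexp (τ / 2) • x) (t₀ + rexp τ - a) ⟨by linarith, by linarith⟩
  refine (mul_le_mul_of_nonneg_left h2 (exp_pos τ).le).trans_eq ?_
  have h3 := Real.mul_self_sqrt (exp_pos τ).le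
  unfold selfSim
  simp only
  rw [show √(rexp τ) * R * (√(rexp τ) * √(gsq w (rexp (τ / 2) • x, t₀ + rexp τ - a))) =
    (√(rexp τ) * √(rexp τ)) * R * √(gsq w (rexp (τ / 2) • x, t₀ + rexp τ - a)) by ring, h3]
  ring

lemma mass_eq (w : Euc n × ℝ → ℝ) (t₀ a τ : ℝ) :
    mass (fun z => w (selfSim t₀ a z)) τ =
      ∫ x : Euc n, w (rexp (τ / 2) • x, t₀ + rexp τ - a) ^ 2 * gau (x, τ) := rfl

lemma energy_le (h : AlmostSol w e R C t₀ T κ) (a τ : ℝ) :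
    energy (fun z => w (selfSim t₀ a z)) τ ≤ rexp τ * (C * R) ^ 2 * gconst n := by
  have h1 : Integrable fun x : Euc n => rexp (-‖x‖ ^ 2 / 8) :=
    integrable_exp_neg_norm_sq (by norm_num)
  calc energy (fun z => w (selfSim t₀ a z)) τ
      ≤ ∫ x : Euc n, rexp τ * (C * R) ^ 2 * rexp (-‖x‖ ^ 2 / 8) := by
        refine integral_mono (integrable_energy (contDiff_comp_selfSim h.smooth)
          (spaceBdd_comp_selfSim h.supp) τ) (h1.const_mul _) fun x => ?_
        simp only
        rw [gsq_comp_selfSim h.smooth]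
        exact mul_le_mul (mul_le_mul_of_nonneg_left (h.gsq_le _) (exp_pos _).le) (gau_le _ _)
          (gau_pos _).le (by positivity)
    _ ≤ _ := by
        rw [integral_const_mul]
        refine mul_le_mul_of_nonneg_left ?_ (by positivity)
        unfold gconst
        linarith

/-- The Gaussian mass at unit parabolic distance does not drop much. -/
lemma mass_ge (h : AlmostSol w e R C t₀ T κ) (hR : 1 ≤ R) (hT : 40 * R ^ 2 * T = 1)
    (h0 : rexp τ₀ = T) (h1 : τ₀ ≤ τ) (h2 : rexp τ ≤ 2 * T) :
    1 / 2 * mass (fun z => w (selfSim t₀ T z)) τ₀ - ((√T ^ n)⁻¹ * κ +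
        C ^ 2 * R ^ 2 * gconst n * rexp (-(10 * R ^ 2)) / 40) / R ^ 2 ≤
      mass (fun z => w (selfSim t₀ T z)) τ := by
  have hTpos : 0 < T := h0 ▸ exp_pos _
  have hR0 : 0 < R := by linarith
  set W : Euc n × ℝ → ℝ := fun z => w (selfSim t₀ T z) with hW
  have hWs : ContDiff ℝ ∞ W := contDiff_comp_selfSim h.smooth
  have hWb : SpaceBdd W := spaceBdd_comp_selfSim h.supp
  have hd : ∀ σ, HasDerivAt (fun σ => -(rexp σ * mass W σ)) _ σ := fun σ =>
    ((hasDerivAt_exp σ).mul (hasDerivAt_mass hWs hWb σ)).neg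
  have key := sub_le_of_deriv_le h.continuous_err (t₀ := t₀) (a := T) h1 hd
    (c₁ := 2 * T / R ^ 2 * (√T ^ n)⁻¹)
    (c₂ := 2 * T / R ^ 2 * (C ^ 2 * R ^ 4 * gconst n * rexp (-(10 * R ^ 2)))) ?_
  · have h3 : ∫ t in (t₀ + rexp τ₀ - T)..(t₀ + rexp τ - T), err e t ≤ κ :=
      h.integral_err_le h0.ge h1 (by linarith)
    have h4 : 2 * T / R ^ 2 * (√T ^ n)⁻¹ * (∫ t in (t₀ + rexp τ₀ - T)..(t₀ + rexp τ - T), err e t) ≤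
        2 * T / R ^ 2 * (√T ^ n)⁻¹ * κ := mul_le_mul_of_nonneg_left h3 (by positivity)
    have hg : 0 ≤ gconst n := zero_le_one.trans one_le_gconst
    have h5 : 2 * T / R ^ 2 * (C ^ 2 * R ^ 4 * gconst n * rexp (-(10 * R ^ 2))) *
        (rexp τ - rexp τ₀) ≤
        2 * T / R ^ 2 * (C ^ 2 * R ^ 4 * gconst n * rexp (-(10 * R ^ 2))) * T :=
      mul_le_mul_of_nonneg_left (by linarith) (by positivity)
    have h6 : 2 * T / R ^ 2 * (C ^ 2 * R ^ 4 * gconst n * rexp (-(10 * R ^ 2))) * T =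
        2 * T / R ^ 2 * (C ^ 2 * R ^ 2 * gconst n * rexp (-(10 * R ^ 2)) / 40) := by
      have : T = 1 / (40 * R ^ 2) := by field_simp; linarith
      rw [this]
      field_simp
    have h7 : rexp τ * mass W τ ≤ 2 * T * mass W τ :=
      mul_le_mul_of_nonneg_right h2 (mass_nonneg _ _)
    have h8 : 2 * T * (1 / 2 * mass W τ₀ - ((√T ^ n)⁻¹ * κ +
        C ^ 2 * R ^ 2 * gconst n * rexp (-(10 * R ^ 2)) / 40) / R ^ 2) =
        T * mass W τ₀ - 2 * T / R ^ 2 * (√T ^ n)⁻¹ * κ -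
        2 * T / R ^ 2 * (C ^ 2 * R ^ 2 * gconst n * rexp (-(10 * R ^ 2)) / 40) := by ring
    rw [h0] at key
    rw [h0] at h4 h5
    refine le_of_mul_le_mul_left (a := 2 * T) ?_ (by positivity)
    rw [h8]
    linarith
  · rintro σ ⟨hσ0, hσ1⟩
    have hs0 : T ≤ rexp σ := h0 ▸ exp_le_exp.2 hσ0
    have hs1 : rexp σ ≤ 2 * T := (exp_le_exp.2 hσ1).trans h2
    have h3 := le_deriv_mass hWs hWb (exp_pos σ) hR0 (h.integrable_gaussian_err T σ)
      (h.selfSim_ineq (a := T) hs0 (by linarith))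
    have h4 := h.gaussian_err_le T σ
    set q := ∫ x : Euc n, (rexp σ * e (selfSim t₀ T (x, σ))) ^ 2 * gau (x, σ)
    set D := 2 * energy W σ + 2 * ∫ x, W (x, σ) * (pd (tdir n) W (x, σ) + ou W (x, σ)) * gau (x, σ)
    have h5 : (rexp (σ / 2) ^ n)⁻¹ ≤ (√T ^ n)⁻¹ := by
      have : √T ≤ rexp (σ / 2) := by
        rw [Real.exp_half]
        exact Real.sqrt_le_sqrt hs0
      have h6 : 0 < √T := Real.sqrt_pos.2 hTpos
      gcongr
    have h7 : rexp (-(1 / (2 * rexp σ))) ≤ rexp (-(10 * R ^ 2)) := by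
      refine exp_le_exp.2 (neg_le_neg ?_)
      rw [le_div_iff₀ (by positivity)]
      nlinarith [sq_nonneg R]
    have hg : 0 ≤ gconst n := zero_le_one.trans one_le_gconst
    have h8 : q ≤ rexp σ ^ 2 * ((√T ^ n)⁻¹ * err e (t₀ + rexp σ - T) +
        C ^ 2 * R ^ 4 * gconst n * rexp (-(10 * R ^ 2))) := by
      refine h4.trans (mul_le_mul_of_nonneg_left (add_le_add ?_ ?_) (by positivity))
      · exact mul_le_mul_of_nonneg_right h5 (err_nonneg _)
      · exact mul_le_mul_of_nonneg_left h7 (by positivity)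
    have h9 : 4 * rexp σ * R ^ 2 * mass W σ ≤ mass W σ := by
      refine mul_le_of_le_one_left (mass_nonneg _ _) ?_
      nlinarith [sq_nonneg R]
    have h10 : 0 ≤ (√T ^ n)⁻¹ * err e (t₀ + rexp σ - T) +
        C ^ 2 * R ^ 4 * gconst n * rexp (-(10 * R ^ 2)) := by
      have := err_nonneg (e := e) (t₀ + rexp σ - T)
      positivity
    set B := (√T ^ n)⁻¹ * err e (t₀ + rexp σ - T) +
        C ^ 2 * R ^ 4 * gconst n * rexp (-(10 * R ^ 2)) with hB
    have h11 : q / (rexp σ * R ^ 2) ≤ 2 * T / R ^ 2 * B := by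
      rw [div_le_iff₀ (by positivity)]
      have : 2 * T / R ^ 2 * B * (rexp σ * R ^ 2) = 2 * T * rexp σ * B := by
        field_simp
      rw [this]
      refine h8.trans (mul_le_mul_of_nonneg_right ?_ h10)
      rw [sq]
      exact mul_le_mul_of_nonneg_right hs1 (exp_pos _).le
    have h12 : -(rexp σ * mass W σ + rexp σ * D) = rexp σ * -(mass W σ + D) := by ring
    rw [h12]
    refine mul_le_mul_of_nonneg_left ?_ (exp_pos _).le
    have : 2 * T / R ^ 2 * (√T ^ n)⁻¹ * err e (t₀ + rexp σ - T) +
        2 * T / R ^ 2 * (C ^ 2 * R ^ 4 * gconst n * rexp (-(10 * R ^ 2))) = 2 * T / R ^ 2 * B := by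
      rw [hB]; ring
    rw [this]
    linarith

end AlmostSol

namespace AlmostSol

variable {w e : Euc n × ℝ → ℝ} {R C t₀ T κ a τ τ₀ τ₁ θ : ℝ}

lemma abs_sq_le (h : AlmostSol w e R C t₀ T κ) (z : Euc n × ℝ) : w z ^ 2 ≤ 1 := by
  rw [← sq_abs]
  exact pow_le_one₀ (abs_nonneg _) (h.abs_le z)

lemma mass_start (h : AlmostSol w e R C t₀ T κ) (hR : 1 ≤ R) (hT : 40 * R ^ 2 * T = 1)
    (h0 : rexp τ₀ = T)
    (hθ : θ ^ 2 / 2 * (R ^ n)⁻¹ ≤ ∫ x in ball (0 : Euc n) (1 / 20), w (x, t₀) ^ 2) :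
    θ ^ 2 / 2 * rexp (-(R ^ 2 / 40)) ≤ mass (fun z => w (selfSim t₀ T z)) τ₀ := by
  have hTpos : 0 < T := h0 ▸ exp_pos _
  have h1 := le_gaussian_integral (G := fun x : Euc n => w (x, t₀) ^ 2)
    ((h.smooth.continuous.comp (by fun_prop)).pow 2) (fun x => sq_nonneg _)
    (fun x => h.abs_sq_le _) (exp_pos (τ₀ / 2)) (1 / 20) τ₀
  have h2 : mass (fun z => w (selfSim t₀ T z)) τ₀ =
      ∫ x : Euc n, w (rexp (τ₀ / 2) • x, t₀) ^ 2 * gau (x, τ₀) := by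
    rw [mass_eq, h0, add_sub_cancel_right]
  rw [h2]
  refine le_trans ?_ h1
  have h3 : rexp (τ₀ / 2) = √T := by rw [Real.exp_half, h0]
  have h4 : √T ^ 2 = T := Real.sq_sqrt hTpos.le
  have h5 : 0 < √T := Real.sqrt_pos.2 hTpos
  rw [h3, h4]
  have h6 : -(1 / 20 : ℝ) ^ 2 / (4 * T) = -(R ^ 2 / 40) := by
    rw [neg_div, neg_inj, div_eq_iff (by positivity)]
    linarith
  rw [h6, mul_comm]
  refine mul_le_mul_of_nonneg_left ?_ (exp_pos _).le
  have h7 : √T * R ≤ 1 := by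
    refine abs_le_of_sq_le_sq' ?_ zero_le_one |>.2
    rw [mul_pow, h4]
    nlinarith
  have h8 : (√T * R) ^ n ≤ 1 := pow_le_one₀ (by positivity) h7
  calc θ ^ 2 / 2 = (√T ^ n)⁻¹ * (√T ^ n * (θ ^ 2 / 2)) := by field_simp
    _ ≤ (√T ^ n)⁻¹ * (θ ^ 2 / 2 * (R ^ n)⁻¹) := by
        refine mul_le_mul_of_nonneg_left ?_ (by positivity)
        rw [mul_comm (θ ^ 2 / 2), ← div_eq_inv_mul, le_div_iff₀ (by positivity)]
        rw [mul_pow] at h8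
        nlinarith [sq_nonneg θ]
    _ ≤ _ := mul_le_mul_of_nonneg_left hθ (by positivity)

lemma exp_small (hX : 10 ^ 6 * C ^ 2 * gconst n ≤ θ ^ 2 * rexp (R ^ 2 / 120))
    {b c : ℝ} (hbc : c + 1 / 120 ≤ b) :
    C ^ 2 * gconst n * rexp (-(b * R ^ 2)) ≤ θ ^ 2 / 10 ^ 6 * rexp (-(c * R ^ 2)) := by
  have h1 : C ^ 2 * gconst n ≤ θ ^ 2 / 10 ^ 6 * rexp (R ^ 2 / 120) := by linarith
  refine (mul_le_mul_of_nonneg_right h1 (exp_pos _).le).trans ?_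
  rw [mul_assoc, ← exp_add]
  refine mul_le_mul_of_nonneg_left (exp_le_exp.2 ?_) (by positivity)
  nlinarith

/-- The mass near the origin persists on a whole time interval. -/
lemma le_setIntegral (h : AlmostSol w e R C t₀ T κ) (hR : 1 ≤ R) (hT : 40 * R ^ 2 * T = 1)
    (hX : 10 ^ 6 * C ^ 2 * gconst n ≤ θ ^ 2 * rexp (R ^ 2 / 120)) (hC : 1 ≤ C)
    (hκ0 : 0 ≤ κ) (hκ : (√T ^ n)⁻¹ * κ ≤ θ ^ 2 / 16 * rexp (-(R ^ 2 / 40)))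
    (hθ : θ ^ 2 / 2 * (R ^ n)⁻¹ ≤ ∫ x in ball (0 : Euc n) (1 / 20), w (x, t₀) ^ 2)
    {t : ℝ} (ht : t ∈ Icc t₀ (t₀ + T / 2)) :
    θ ^ 2 / 16 * rexp (-(R ^ 2 / 40)) ≤
      (√T ^ n)⁻¹ * ∫ x in ball (0 : Euc n) (1 / 10), w (x, t) ^ 2 := by
  have hTpos : 0 < T := by
    by_contra hcon
    nlinarith [sq_nonneg R]
  have hg := one_le_gconst (n := n)
  have hs : 0 < t - t₀ + T := by linarith [ht.1]
  set τ := Real.log (t - t₀ + T) with hτ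
  have hτe : rexp τ = t - t₀ + T := Real.exp_log hs
  have h0 : rexp (Real.log T) = T := Real.exp_log hTpos
  have h1 := h.mass_start hR hT h0 hθ
  have h2 := h.mass_ge hR hT h0 (τ := τ) (Real.log_le_log hTpos (by linarith [ht.1]))
    (by linarith [ht.2])
  have h3 := exp_small (n := n) (b := 10) (c := 1 / 40) hX (by norm_num)
  rw [show (1 / 40 : ℝ) * R ^ 2 = R ^ 2 / 40 by ring] at h3
  have h4 : ((√T ^ n)⁻¹ * κ + C ^ 2 * R ^ 2 * gconst n * rexp (-(10 * R ^ 2)) / 40) / R ^ 2 ≤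
      θ ^ 2 / 16 * rexp (-(R ^ 2 / 40)) + θ ^ 2 / 16 * rexp (-(R ^ 2 / 40)) := by
    rw [add_div]
    refine add_le_add ((div_le_self (by positivity) (one_le_pow₀ hR)).trans hκ) ?_
    have : C ^ 2 * R ^ 2 * gconst n * rexp (-(10 * R ^ 2)) / 40 / R ^ 2 =
      C ^ 2 * gconst n * rexp (-(10 * R ^ 2)) / 40 := by field_simp
    rw [this]
    have : 0 ≤ θ ^ 2 * rexp (-(R ^ 2 / 40)) := by positivity
    linarith
  have h5 : θ ^ 2 / 8 * rexp (-(R ^ 2 / 40)) ≤ mass (fun z => w (selfSim t₀ T z)) τ := by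
    linarith
  have h6 := gaussian_integral_le (G := fun x : Euc n => w (x, t) ^ 2)
    ((h.smooth.continuous.comp (by fun_prop)).pow 2) (fun x => sq_nonneg _)
    (fun x => h.abs_sq_le _) (exp_pos (τ / 2)) (r := 1 / 10) (by norm_num) τ
  have h7 : mass (fun z => w (selfSim t₀ T z)) τ =
      ∫ x : Euc n, w (rexp (τ / 2) • x, t) ^ 2 * gau (x, τ) := by
    rw [mass_eq, hτe, show t₀ + (t - t₀ + T) - T = t by ring]
  have h8 : rexp (τ / 2) ^ 2 = t - t₀ + T := by
    rw [Real.exp_half, Real.sq_sqrt (exp_pos _).le, hτe]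
  have h9 : rexp (-(1 / 10) ^ 2 / (8 * rexp (τ / 2) ^ 2)) ≤ rexp (-(1 / 30 * R ^ 2)) := by
    rw [h8]
    refine exp_le_exp.2 ?_
    rw [neg_div, neg_le_neg_iff, le_div_iff₀ (by positivity)]
    nlinarith [ht.2, sq_nonneg R]
  have h10 := exp_small (n := n) (b := 1 / 30) (c := 1 / 40) hX (by norm_num)
  rw [show (1 / 40 : ℝ) * R ^ 2 = R ^ 2 / 40 by ring] at h10
  have h11 : rexp (-(1 / 10) ^ 2 / (8 * rexp (τ / 2) ^ 2)) * gconst n ≤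
      C ^ 2 * gconst n * rexp (-(1 / 30 * R ^ 2)) := by
    have h12 : 1 ≤ C ^ 2 := one_le_pow₀ hC
    have h13 : gconst n ≤ C ^ 2 * gconst n := le_mul_of_one_le_left (by linarith) h12
    rw [mul_comm]
    exact mul_le_mul h13 h9 (exp_pos _).le (by positivity)
  have h14 : (rexp (τ / 2) ^ n)⁻¹ ≤ (√T ^ n)⁻¹ := by
    have h15 : √T ≤ rexp (τ / 2) := by
      rw [Real.exp_half, hτe]
      exact Real.sqrt_le_sqrt (by linarith [ht.1])
    have h16 : 0 < √T := Real.sqrt_pos.2 hTpos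
    gcongr
  have h17 : (rexp (τ / 2) ^ n)⁻¹ * ∫ x in ball (0 : Euc n) (1 / 10), w (x, t) ^ 2 ≤
      (√T ^ n)⁻¹ * ∫ x in ball (0 : Euc n) (1 / 10), w (x, t) ^ 2 :=
    mul_le_mul_of_nonneg_right h14 (integral_nonneg fun x => sq_nonneg _)
  have h18 : 0 ≤ θ ^ 2 * rexp (-(R ^ 2 / 40)) := by positivity
  rw [← h7] at h6
  linarith

lemma mass_middle (h : AlmostSol w e R C t₀ T κ) (hR : 1 ≤ R) (hT : 40 * R ^ 2 * T = 1)
    (hX : 10 ^ 6 * C ^ 2 * gconst n ≤ θ ^ 2 * rexp (R ^ 2 / 120)) (hC : 1 ≤ C)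
    (hκ0 : 0 ≤ κ) (hκ : (√T ^ n)⁻¹ * κ ≤ θ ^ 2 / 16 * rexp (-(R ^ 2 / 40)))
    (hθ : θ ^ 2 / 2 * (R ^ n)⁻¹ ≤ ∫ x in ball (0 : Euc n) (1 / 20), w (x, t₀) ^ 2)
    (ha : 0 ≤ a) (ha1 : a ≤ T / 4) (h1 : T / 4 ≤ rexp τ) (h2 : rexp τ ≤ T / 2) :
    θ ^ 2 / 16 * rexp (-(17 / 40 * R ^ 2)) ≤ mass (fun z => w (selfSim t₀ a z)) τ := by
  have hTpos : 0 < T := by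
    by_contra hcon
    nlinarith [sq_nonneg R]
  have h3 := h.le_setIntegral hR hT hX hC hκ0 hκ hθ (t := t₀ + rexp τ - a)
    ⟨by linarith, by linarith⟩
  have h4 := le_gaussian_integral (G := fun x : Euc n => w (x, t₀ + rexp τ - a) ^ 2)
    ((h.smooth.continuous.comp (by fun_prop)).pow 2) (fun x => sq_nonneg _)
    (fun x => h.abs_sq_le _) (exp_pos (τ / 2)) (1 / 10) τ
  rw [← mass_eq] at h4
  refine le_trans ?_ h4
  have h8 : rexp (τ / 2) ^ 2 = rexp τ := by
    rw [Real.exp_half, Real.sq_sqrt (exp_pos _).le]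
  have h9 : rexp (-(2 / 5 * R ^ 2)) ≤ rexp (-(1 / 10) ^ 2 / (4 * rexp (τ / 2) ^ 2)) := by
    rw [h8]
    refine exp_le_exp.2 ?_
    rw [neg_div, neg_le_neg_iff, div_le_iff₀ (by positivity)]
    nlinarith [sq_nonneg R]
  have h14 : (√T ^ n)⁻¹ ≤ (rexp (τ / 2) ^ n)⁻¹ := by
    have h15 : rexp (τ / 2) ≤ √T := by
      rw [Real.exp_half]
      exact Real.sqrt_le_sqrt (by linarith)
    gcongr
  have h16 : θ ^ 2 / 16 * rexp (-(R ^ 2 / 40)) ≤ (rexp (τ / 2) ^ n)⁻¹ *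
      ∫ x in ball (0 : Euc n) (1 / 10), w (x, t₀ + rexp τ - a) ^ 2 :=
    h3.trans (mul_le_mul_of_nonneg_right h14 (integral_nonneg fun x => sq_nonneg _))
  refine le_trans (le_of_eq ?_) (mul_le_mul h9 h16 (by positivity) (exp_pos _).le)
  rw [mul_left_comm, ← exp_add]
  congr 2
  ring

end AlmostSol

/-- The Carleman weight in logarithmic time. -/
noncomputable def cwt (R τ : ℝ) : ℝ := rexp (-(4 * R ^ 2 * τ) + 20 * R ^ 4 * rexp τ)

/-- The coefficient attached to the Carleman weight. -/
noncomputable def ccoef (R τ : ℝ) : ℝ := R ^ 2 * (2 - 10 * R ^ 2 * rexp τ)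

/-- The Carleman functional. -/
noncomputable def cfun (f : Euc n × ℝ → ℝ) (R τ : ℝ) : ℝ :=
  cwt R τ * (ccoef R τ * mass f τ - energy f τ)

lemma hasDerivAt_cwt (R τ : ℝ) : HasDerivAt (cwt R) (-(2 * ccoef R τ) * cwt R τ) τ := by
  have h1 : HasDerivAt (cwt R) _ τ :=
    (((hasDerivAt_id τ).const_mul (4 * R ^ 2)).neg.add
      ((hasDerivAt_exp τ).const_mul (20 * R ^ 4))).exp
  convert h1 using 1
  simp [cwt, ccoef]
  ring

lemma hasDerivAt_ccoef (R τ : ℝ) : HasDerivAt (ccoef R) (-(10 * rexp τ * R ^ 4)) τ := by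
  have h1 : HasDerivAt (ccoef R) _ τ :=
    (((hasDerivAt_exp τ).const_mul (10 * R ^ 2)).const_sub 2).const_mul (R ^ 2)
  convert h1 using 1
  ring

lemma cwt_pos (R τ : ℝ) : 0 < cwt R τ := exp_pos _

namespace AlmostSol

variable {w e : Euc n × ℝ → ℝ} {R C t₀ T κ a τ τ₀ τ₁ τ₂ θ P L Q : ℝ}

lemma cfun_sub_le (h : AlmostSol w e R C t₀ T κ) (hR : 1 ≤ R) (hT : 40 * R ^ 2 * T = 1)
    (ha : 0 < a) (ha1 : a ≤ T / 8) (h0 : a ≤ rexp τ₀) (h1 : τ₀ ≤ τ₁) (h2 : rexp τ₁ ≤ T + a)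
    (hL : ∀ τ ∈ Icc τ₀ τ₁, L ≤ 3 * R ^ 4 * cwt R τ * mass (fun z => w (selfSim t₀ a z)) τ)
    (hP : ∀ τ ∈ Icc τ₀ τ₁, cwt R τ ≤ P)
    (hQ : ∀ τ ∈ Icc τ₀ τ₁, cwt R τ * rexp (-(1 / (2 * rexp τ))) ≤ Q) :
    cfun (fun z => w (selfSim t₀ a z)) R τ₁ - cfun (fun z => w (selfSim t₀ a z)) R τ₀ ≤
      3 * P * (√a ^ n)⁻¹ * κ +
        (6 * T * (C ^ 2 * R ^ 4 * gconst n) * Q - L) * (rexp τ₁ - rexp τ₀) := by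
  have hTpos : 0 < T := by linarith
  have hg : 0 ≤ gconst n := zero_le_one.trans one_le_gconst
  have hP0 : 0 ≤ P := (cwt_pos _ _).le.trans (hP τ₀ (left_mem_Icc.2 h1))
  set W : Euc n × ℝ → ℝ := fun z => w (selfSim t₀ a z) with hW
  have hWs : ContDiff ℝ ∞ W := contDiff_comp_selfSim h.smooth
  have hWb : SpaceBdd W := spaceBdd_comp_selfSim h.supp
  have hd : ∀ σ, HasDerivAt (cfun W R) _ σ := fun σ =>
    (hasDerivAt_cwt R σ).mul (((hasDerivAt_ccoef R σ).mul (hasDerivAt_mass hWs hWb σ)).sub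
      (hasDerivAt_energy hWs hWb σ))
  refine (sub_le_of_deriv_le h.continuous_err (t₀ := t₀) (a := a) h1 hd
    (c₁ := 3 * P * (√a ^ n)⁻¹)
    (c₂ := 6 * T * (C ^ 2 * R ^ 4 * gconst n) * Q - L) ?_).trans ?_
  · rintro σ ⟨hσ0, hσ1⟩
    have hs0 : a ≤ rexp σ := h0.trans (exp_le_exp.2 hσ0)
    have hs1 : rexp σ ≤ T + a := (exp_le_exp.2 hσ1).trans h2
    have hT1 : T ≤ 1 / 40 := by nlinarith [one_le_pow₀ hR (n := 2)]
    have hα : ccoef R σ ≤ 2 * R ^ 2 := by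
      unfold ccoef
      have : 0 ≤ R ^ 2 * (10 * R ^ 2 * rexp σ) := by positivity
      linarith
    have h3 := frequency_deriv_le hWs hWb (exp_pos σ) (by linarith) hα
      (h.integrable_gaussian_err a σ) (h.selfSim_ineq hs0 hs1)
    have h4 := h.gaussian_err_le a σ
    set q := ∫ x : Euc n, (rexp σ * e (selfSim t₀ a (x, σ))) ^ 2 * gau (x, σ)
    have hp := cwt_pos R σ
    have h5 := mul_le_mul_of_nonneg_left h3 hp.le
    have hLσ := mul_le_mul_of_nonneg_left (hL σ ⟨hσ0, hσ1⟩) (exp_pos σ).le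
    have h6 : (rexp (σ / 2) ^ n)⁻¹ ≤ (√a ^ n)⁻¹ := by
      have h7 : √a ≤ rexp (σ / 2) := by
        rw [Real.exp_half]
        exact Real.sqrt_le_sqrt hs0
      have h8 : 0 < √a := Real.sqrt_pos.2 ha
      gcongr
    have hk := err_nonneg (e := e) (t₀ + rexp σ - a)
    have h9 : cwt R σ * (rexp σ ^ 2 * ((rexp (σ / 2) ^ n)⁻¹ * err e (t₀ + rexp σ - a))) ≤
        rexp σ * (P * (√a ^ n)⁻¹ * err e (t₀ + rexp σ - a)) := by
      have h10 : rexp σ ^ 2 ≤ rexp σ := by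
        rw [sq]
        exact mul_le_of_le_one_left (exp_pos _).le (by linarith)
      calc _ ≤ P * (rexp σ * ((√a ^ n)⁻¹ * err e (t₀ + rexp σ - a))) := by
            refine mul_le_mul (hP σ ⟨hσ0, hσ1⟩) ?_ (by positivity) hP0
            exact mul_le_mul h10 (mul_le_mul_of_nonneg_right h6 hk) (by positivity)
              (exp_pos _).le
        _ = _ := by ring
    have h11 : cwt R σ * (rexp σ ^ 2 * (C ^ 2 * R ^ 4 * gconst n *
        rexp (-(1 / (2 * rexp σ))))) ≤
        rexp σ * (2 * T * (C ^ 2 * R ^ 4 * gconst n) * Q) := by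
      calc _ = rexp σ * (rexp σ * (C ^ 2 * R ^ 4 * gconst n)) *
              (cwt R σ * rexp (-(1 / (2 * rexp σ)))) := by ring
        _ ≤ rexp σ * (2 * T * (C ^ 2 * R ^ 4 * gconst n)) * Q := by
            refine mul_le_mul ?_ (hQ σ ⟨hσ0, hσ1⟩) (by positivity) (by positivity)
            refine mul_le_mul_of_nonneg_left ?_ (exp_pos _).le
            exact mul_le_mul_of_nonneg_right (by linarith) (by positivity)
        _ = _ := by ring
    have h12 := mul_le_mul_of_nonneg_left h4 hp.le
    linarith
  · refine add_le_add ?_ le_rfl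
    exact mul_le_mul_of_nonneg_left (h.integral_err_le h0 h1 h2) (by positivity)

end AlmostSol

section

variable {R T a σ τ : ℝ}

lemma cwt_le_crude (ha : 0 < a) (h0 : a ≤ rexp τ) (h1 : rexp τ ≤ 1) :
    cwt R τ ≤ rexp (-(4 * R ^ 2 * Real.log a) + 20 * R ^ 4) := by
  have h2 : Real.log a ≤ τ := (Real.log_le_iff_le_exp ha).2 h0
  refine exp_le_exp.2 (add_le_add (neg_le_neg ?_) ?_)
  · exact mul_le_mul_of_nonneg_left h2 (by positivity)
  · exact mul_le_of_le_one_right (by positivity) h1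

lemma le_cwt (hT : 40 * R ^ 2 * T = 1) (hσ : rexp σ = T / 2)
    (h2 : rexp τ ≤ T / 2) : cwt R σ ≤ cwt R τ := by
  refine exp_le_exp.2 ?_
  have hT0 : 0 < T := by linarith [exp_pos σ]
  have h3 : rexp τ = T / 2 * rexp (τ - σ) := by rw [← hσ, ← exp_add]; ring_nf
  have h4 := Real.add_one_le_exp (τ - σ)
  have h5 : rexp (τ - σ) ≤ 1 := by
    rw [h3] at h2
    nlinarith
  have h7 : 20 * R ^ 4 * (T / 2) = R ^ 2 / 4 := by
    linear_combination R ^ 2 / 4 * hT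
  have h8 : 20 * R ^ 4 * rexp τ = R ^ 2 / 4 * rexp (τ - σ) := by rw [h3, ← h7]; ring
  rw [hσ, h7, h8]
  nlinarith [sq_nonneg R]

lemma cwt_mul_exp_le (hT : 40 * R ^ 2 * T = 1) (hT0 : 0 < T) (hσ : rexp σ = T / 2)
    (h2 : rexp τ ≤ 9 / 8 * T) :
    cwt R τ * rexp (-(1 / (2 * rexp τ))) ≤ cwt R σ * rexp (-(17 * R ^ 2)) := by
  unfold cwt
  rw [← exp_add, ← exp_add]
  refine exp_le_exp.2 ?_
  have h3 : rexp τ = T / 2 * rexp (τ - σ) := by rw [← hσ, ← exp_add]; ring_nf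
  have h4 := Real.add_one_le_exp (σ - τ)
  have h5 : rexp (τ - σ) ≤ 9 / 4 := by
    rw [h3] at h2
    nlinarith
  have h5' : rexp (τ - σ) * rexp (σ - τ) = 1 := by rw [← exp_add]; simp
  have h6 : 4 / 9 ≤ rexp (σ - τ) := by
    nlinarith [exp_pos (σ - τ)]
  have h7 : 20 * R ^ 4 * (T / 2) = R ^ 2 / 4 := by
    linear_combination R ^ 2 / 4 * hT
  have h8 : 20 * R ^ 4 * rexp τ = R ^ 2 / 4 * rexp (τ - σ) := by rw [h3, ← h7]; ring
  have h9 : 1 / (2 * rexp τ) = 40 * R ^ 2 * rexp (σ - τ) := by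
    rw [div_eq_iff (by positivity), h3]
    linear_combination (-rexp (τ - σ) * rexp (σ - τ)) * hT - h5'
  rw [hσ, h7, h8, h9]
  nlinarith [sq_nonneg R]

lemma cwt_end_le (hT : 40 * R ^ 2 * T = 1) (hσ : rexp σ = T / 2)
    (h1 : T ≤ rexp τ) (h2 : rexp τ ≤ 9 / 8 * T) :
    cwt R τ ≤ cwt R σ * rexp (-(2 * R ^ 2)) := by
  unfold cwt
  rw [← exp_add]
  refine exp_le_exp.2 ?_
  have hT0 : 0 < T := by linarith [exp_pos σ]
  have h3 : rexp τ = T / 2 * rexp (τ - σ) := by rw [← hσ, ← exp_add]; ring_nf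
  have h5 : rexp (τ - σ) ≤ 9 / 4 := by
    rw [h3] at h2
    nlinarith
  have h6 : 2 ≤ rexp (τ - σ) := by
    rw [h3] at h1
    nlinarith
  have h4 : Real.log 2 ≤ τ - σ := (Real.log_le_iff_le_exp two_pos).2 h6
  have h7 : 20 * R ^ 4 * (T / 2) = R ^ 2 / 4 := by
    linear_combination R ^ 2 / 4 * hT
  have h8 : 20 * R ^ 4 * rexp τ = R ^ 2 / 4 * rexp (τ - σ) := by rw [h3, ← h7]; ring
  rw [hσ, h7, h8]
  nlinarith [sq_nonneg R, Real.log_two_gt_d9]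

lemma cwt_ratio_le (hσ : rexp σ = T / 2) (ha : 0 < a)
    (ha1 : a ≤ T / 2) :
    cwt R (Real.log a) * rexp (-(4 * R ^ 2 * (σ - Real.log a))) ≤ cwt R σ := by
  unfold cwt
  rw [← exp_add]
  refine exp_le_exp.2 ?_
  rw [Real.exp_log ha, hσ]
  have : 20 * R ^ 4 * a ≤ 20 * R ^ 4 * (T / 2) := mul_le_mul_of_nonneg_left ha1 (by positivity)
  linarith

end

namespace AlmostSol

variable {w e : Euc n × ℝ → ℝ} {R C t₀ T κ a θ : ℝ}

/-- At the final time the Carleman functional is not too negative. -/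
lemma le_cfun_end (h : AlmostSol w e R C t₀ T κ) (hR : 1 ≤ R) (hT : 40 * R ^ 2 * T = 1)
    {σ : ℝ} (hσ : rexp σ = T / 2) (ha : 0 < a) (ha1 : a ≤ T / 8) :
    -(cwt R σ * (C ^ 2 * gconst n * rexp (-(2 * R ^ 2)))) ≤
      cfun (fun z => w (selfSim t₀ a z)) R (Real.log (T + a)) := by
  have hTpos : 0 < T := by linarith
  have hR2 : 1 ≤ R ^ 2 := one_le_pow₀ hR
  have hg := one_le_gconst (n := n)
  have hp := cwt_pos R σ
  have he3 : rexp (Real.log (T + a)) = T + a := Real.exp_log (by linarith)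
  have ha2 : R ^ 2 * a ≤ R ^ 2 * (T / 8) := mul_le_mul_of_nonneg_left ha1 (by positivity)
  set W : Euc n × ℝ → ℝ := fun z => w (selfSim t₀ a z) with hW
  set M := C ^ 2 * gconst n with hM
  have hM0 : 0 ≤ M := by positivity
  have h1 : 0 ≤ ccoef R (Real.log (T + a)) := by
    unfold ccoef
    rw [he3]
    exact mul_nonneg (sq_nonneg _) (by linarith)
  have h2 := h.energy_le a (Real.log (T + a))
  rw [he3] at h2
  have h3 : (T + a) * (C * R) ^ 2 * gconst n ≤ M := by
    have : (T + a) * (C * R) ^ 2 * gconst n = (T + a) * R ^ 2 * M := by rw [hM]; ring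
    rw [this]
    exact mul_le_of_le_one_left hM0 (by linarith)
  have h4 := cwt_end_le hT hσ (by rw [he3]; linarith) (by rw [he3]; linarith)
    (τ := Real.log (T + a))
  have h5 : 0 ≤ ccoef R (Real.log (T + a)) * mass W (Real.log (T + a)) :=
    mul_nonneg h1 (mass_nonneg _ _)
  have h6 : cwt R (Real.log (T + a)) * energy W (Real.log (T + a)) ≤
      cwt R σ * rexp (-(2 * R ^ 2)) * M :=
    mul_le_mul h4 (h2.trans h3) (energy_nonneg _ _) (by positivity)
  have h7 := mul_nonneg (cwt_pos R (Real.log (T + a))).le h5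
  unfold cfun
  linarith

set_option maxHeartbeats 400000 in
/-- The outcome of the Carleman argument: at scale `a` the energy is controlled by the mass,
and the mass is not too small. -/
lemma mass_small_scale (h : AlmostSol w e R C t₀ T κ) (hR : 1 ≤ R) (hT : 40 * R ^ 2 * T = 1)
    (hX : 10 ^ 6 * C ^ 2 * gconst n ≤ θ ^ 2 * rexp (R ^ 2 / 120)) (hC : 1 ≤ C)
    (hκ0 : 0 ≤ κ) (hκ : (√T ^ n)⁻¹ * κ ≤ θ ^ 2 / 16 * rexp (-(R ^ 2 / 40)))
    (hθ : θ ^ 2 / 2 * (R ^ n)⁻¹ ≤ ∫ x in ball (0 : Euc n) (1 / 20), w (x, t₀) ^ 2)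
    (hθ0 : 0 < θ) (ha : 0 < a) (ha1 : a ≤ T / 8)
    (hκ2 : 9 * rexp (-(4 * R ^ 2 * Real.log a) + 20 * R ^ 4) * (√a ^ n)⁻¹ * κ ≤
      cwt R (Real.log (T / 2)) * (C ^ 2 * gconst n * rexp (-(2 * R ^ 2)))) :
    energy (fun z => w (selfSim t₀ a z)) (Real.log a) ≤
        2 * R ^ 2 * mass (fun z => w (selfSim t₀ a z)) (Real.log a) ∧
      rexp (-(4 * R ^ 2 * (Real.log (T / 2) - Real.log a))) *
        (θ ^ 2 / 2560 * rexp (-(17 / 40 * R ^ 2))) ≤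
          mass (fun z => w (selfSim t₀ a z)) (Real.log a) := by
  have hTpos : 0 < T := by linarith
  have hg := one_le_gconst (n := n)
  have hT1 : T ≤ 1 / 40 := by nlinarith [one_le_pow₀ hR (n := 2)]
  have hR2 : 1 ≤ R ^ 2 := one_le_pow₀ hR
  have hRT : R ^ 4 * T = R ^ 2 / 40 := by linear_combination R ^ 2 / 40 * hT
  have hmid : ∀ τ, T / 4 ≤ rexp τ → rexp τ ≤ T / 2 → _ := fun τ h1 h2 =>
    h.mass_middle (a := a) (τ := τ) hR hT hX hC hκ0 hκ hθ ha.le (by linarith) h1 h2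
  set W : Euc n × ℝ → ℝ := fun z => w (selfSim t₀ a z) with hW
  set σ := Real.log (T / 2) with hσd
  have hσ : rexp σ = T / 2 := Real.exp_log (by linarith)
  have hea : rexp (Real.log a) = a := Real.exp_log ha
  have he1 : rexp (Real.log (T / 4)) = T / 4 := Real.exp_log (by linarith)
  have he3 : rexp (Real.log (T + a)) = T + a := Real.exp_log (by linarith)
  have l1 : Real.log a ≤ Real.log (T / 4) := Real.log_le_log ha (by linarith)
  have l2 : Real.log (T / 4) ≤ σ := Real.log_le_log (by linarith) (by linarith)
  have l3 : σ ≤ Real.log (T + a) := Real.log_le_log (by linarith) (by linarith)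
  set P := rexp (-(4 * R ^ 2 * Real.log a) + 20 * R ^ 4) with hPd
  set Q := cwt R σ * rexp (-(17 * R ^ 2)) with hQd
  set M := C ^ 2 * gconst n with hM
  set μ := θ ^ 2 / 16 * rexp (-(17 / 40 * R ^ 2)) with hμ
  have hp := cwt_pos R σ
  have hbd : ∀ τ, Real.log a ≤ τ → τ ≤ Real.log (T + a) →
      cwt R τ ≤ P ∧ cwt R τ * rexp (-(1 / (2 * rexp τ))) ≤ Q := fun τ h1 h2 => by
    have h3 : a ≤ rexp τ := hea ▸ exp_le_exp.2 h1
    have h4 : rexp τ ≤ T + a := he3 ▸ exp_le_exp.2 h2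
    exact ⟨cwt_le_crude ha h3 (by linarith), cwt_mul_exp_le hT hTpos hσ (by linarith)⟩
  have hnn : ∀ τ, 0 ≤ 3 * R ^ 4 * cwt R τ * mass W τ := fun τ => by
    have := mass_nonneg W τ
    have := cwt_pos R τ
    positivity
  have s1 := h.cfun_sub_le (L := 0) hR hT ha ha1 hea.ge l1 (by rw [he1]; linarith)
    (fun τ _ => hnn τ) (fun τ hτ => (hbd τ hτ.1 (by linarith [hτ.2])).1)
    (fun τ hτ => (hbd τ hτ.1 (by linarith [hτ.2])).2)
  have s2 := h.cfun_sub_le (L := 3 * R ^ 4 * cwt R σ * μ) hR hT ha ha1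
    (by rw [he1]; linarith) l2 (by rw [hσ]; linarith)
    (fun τ hτ => by
      have h1 : T / 4 ≤ rexp τ := he1 ▸ exp_le_exp.2 hτ.1
      have h2 : rexp τ ≤ T / 2 := hσ ▸ exp_le_exp.2 hτ.2
      have h3 := hmid τ h1 h2
      have h4 := le_cwt hT hσ h2
      have h5 := cwt_pos R τ
      have h6 : 0 ≤ μ := by positivity
      gcongr)
    (fun τ hτ => (hbd τ (by linarith [hτ.1]) (by linarith [hτ.2])).1)
    (fun τ hτ => (hbd τ (by linarith [hτ.1]) (by linarith [hτ.2])).2)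
  have s3 := h.cfun_sub_le (L := 0) hR hT ha ha1 (by rw [hσ]; linarith) l3 he3.le
    (fun τ _ => hnn τ) (fun τ hτ => (hbd τ (by linarith [hτ.1]) hτ.2).1)
    (fun τ hτ => (hbd τ (by linarith [hτ.1]) hτ.2).2)
  rw [he1, hea] at s1
  rw [he1, hσ] at s2
  rw [hσ, he3] at s3
  change cfun W R _ - cfun W R _ ≤ _ at s1 s2 s3
  have hend : -(cwt R σ * (M * rexp (-(2 * R ^ 2)))) ≤ cfun W R (Real.log (T + a)) :=
    h.le_cfun_end hR hT hσ ha ha1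
  have hsm2 := exp_small (n := n) (b := 2) (c := 17 / 40) hX (by norm_num)
  have hsm17 := exp_small (n := n) (b := 17) (c := 17 / 40) hX (by norm_num)
  rw [← hM] at hsm2 hsm17
  have hμ0 : 0 < μ := by positivity
  have e2 : M * rexp (-(2 * R ^ 2)) ≤ μ / 10 ^ 4 := by rw [hμ]; linarith
  have e17 : M * rexp (-(17 * R ^ 2)) ≤ μ / 10 ^ 4 := by rw [hμ]; linarith
  have e3 : 6 * T * (C ^ 2 * R ^ 4 * gconst n) * Q * T ≤ cwt R σ * (μ / 10 ^ 4) := by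
    have h1 : 6 * T * (C ^ 2 * R ^ 4 * gconst n) * Q * T =
        6 / 1600 * (cwt R σ * (M * rexp (-(17 * R ^ 2)))) := by
      rw [hQd, hM]
      linear_combination (6 * C ^ 2 * gconst n * cwt R σ * rexp (-(17 * R ^ 2))) *
        (R ^ 2 * T / 40 + 1 / 1600) * hT
    rw [h1]
    have h2 := mul_le_mul_of_nonneg_left e17 hp.le
    have h3 : 0 ≤ cwt R σ * (M * rexp (-(17 * R ^ 2))) := by positivity
    linarith
  have e4 : 3 * R ^ 4 * cwt R σ * μ * (T / 4) = 3 / 160 * R ^ 2 * (cwt R σ * μ) := by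
    linear_combination (3 / 4 * cwt R σ * μ) * hRT
  have e5 : cwt R σ * μ ≤ R ^ 2 * (cwt R σ * μ) := le_mul_of_one_le_left (by positivity) hR2
  have hp2 := mul_le_mul_of_nonneg_left e2 hp.le
  have hpμ := mul_pos hp hμ0
  have hstart : 1 / 80 * R ^ 2 * (cwt R σ * μ) ≤ cfun W R (Real.log a) := by
    linarith
  have hpa := cwt_pos R (Real.log a)
  have hm := mass_nonneg W (Real.log a)
  have hα : ccoef R (Real.log a) ≤ 2 * R ^ 2 := by
    unfold ccoef
    have : 0 ≤ R ^ 2 * (10 * R ^ 2 * rexp (Real.log a)) := by positivity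
    linarith
  have hαm := mul_le_mul_of_nonneg_right hα hm
  have hpos : 0 < 1 / 80 * R ^ 2 * (cwt R σ * μ) := by positivity
  constructor
  · have h1 : 0 < cfun W R (Real.log a) := hpos.trans_le hstart
    have h2 : 0 < ccoef R (Real.log a) * mass W (Real.log a) - energy W (Real.log a) :=
      (mul_pos_iff_of_pos_left hpa).1 h1
    linarith
  · have h1 : cfun W R (Real.log a) ≤ cwt R (Real.log a) * (2 * R ^ 2 * mass W (Real.log a)) := by
      unfold cfun
      refine mul_le_mul_of_nonneg_left ?_ hpa.le
      linarith [energy_nonneg W (Real.log a)]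
    have h2 := cwt_ratio_le (R := R) hσ ha (by linarith)
    have h3 : θ ^ 2 / 2560 * rexp (-(17 / 40 * R ^ 2)) = μ / 160 := by rw [hμ]; ring
    rw [h3]
    have h4 := mul_le_mul_of_nonneg_right h2 hμ0.le
    refine le_of_mul_le_mul_left (a := cwt R (Real.log a) * (2 * R ^ 2)) ?_ (by positivity)
    have h5 := mul_le_mul_of_nonneg_left h4 (by positivity : 0 ≤ 1 / 80 * R ^ 2)
    linarith

/-- Quantitative lower bound on small balls. -/
lemma le_setIntegral_ball (h : AlmostSol w e R C t₀ T κ) (hR : 1 ≤ R)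
    (hT : 40 * R ^ 2 * T = 1) (hRn : (n : ℝ) ≤ R ^ 2)
    (hX : 10 ^ 6 * C ^ 2 * gconst n ≤ θ ^ 2 * rexp (R ^ 2 / 120)) (hC : 1 ≤ C)
    (hκ0 : 0 ≤ κ) (hκ : (√T ^ n)⁻¹ * κ ≤ θ ^ 2 / 16 * rexp (-(R ^ 2 / 40)))
    (hθ : θ ^ 2 / 2 * (R ^ n)⁻¹ ≤ ∫ x in ball (0 : Euc n) (1 / 20), w (x, t₀) ^ 2)
    (hθ0 : 0 < θ) {r : ℝ} (hr : 0 < r) (hr1 : r ≤ 1 / 2) (ha : a = (r / (10 * R)) ^ 2)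
    (hκ2 : 9 * rexp (-(4 * R ^ 2 * Real.log a) + 20 * R ^ 4) * (√a ^ n)⁻¹ * κ ≤
      cwt R (Real.log (T / 2)) * (C ^ 2 * gconst n * rexp (-(2 * R ^ 2)))) :
    (r / (10 * R)) ^ n * (rexp (-(8 * R ^ 2 * Real.log (2 / r))) *
        (θ ^ 2 / 5120 * rexp (-(17 / 40 * R ^ 2)))) ≤
      ∫ x in ball (0 : Euc n) r, w (x, t₀) ^ 2 := by
  have hR0 : 0 < R := by linarith
  have hTeq : T = 1 / (40 * R ^ 2) := by field_simp; linarith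
  have ha0 : 0 < a := by rw [ha]; positivity
  have haT : a = 2 / 5 * r ^ 2 * T := by rw [ha, hTeq]; field_simp; norm_num
  have hTpos : 0 < T := by rw [hTeq]; positivity
  have hr2 : r ^ 2 ≤ 1 / 4 := by nlinarith
  obtain ⟨h1, h2⟩ := h.mass_small_scale hR hT hX hC hκ0 hκ hθ hθ0 ha0 (by nlinarith) hκ2
  set W : Euc n × ℝ → ℝ := fun z => w (selfSim t₀ a z) with hW
  set τ := Real.log a with hτ
  have hWs : ContDiff ℝ ∞ W := contDiff_comp_selfSim h.smooth
  have hWb : SpaceBdd W := spaceBdd_comp_selfSim h.supp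
  have hea : rexp τ = a := Real.exp_log ha0
  have hl : rexp (τ / 2) = r / (10 * R) := by
    rw [Real.exp_half, hea, ha, Real.sqrt_sq (by positivity)]
  have h3 := integral_norm_sq_mul_sq_le hWs hWb τ
  have i1 := integrable_mass hWs hWb τ
  have i0 : Integrable fun x : Euc n => ‖x‖ ^ 2 * W (x, τ) ^ 2 * gau (x, τ) := by
    have hsq : SpaceBdd fun z => W z ^ 2 := by simpa only [sq] using hWb.mul_right W
    have hnorm : ContDiff ℝ ∞ fun z : Euc n × ℝ => ‖z.1‖ ^ 2 :=
      (contDiff_norm_sq ℝ).comp contDiff_fst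
    exact ((hsq.mul_left fun z => ‖z.1‖ ^ 2).mul_right gau).integrable
      ((hnorm.mul (hWs.pow 2)).mul contDiff_gau).continuous τ
  have i2 : IntegrableOn (fun x : Euc n => W (x, τ) ^ 2) (ball 0 (10 * R)) :=
    ((hWs.continuous.comp (by fun_prop)).pow 2 |>.continuousOn.integrableOn_compact
      (isCompact_closedBall _ _)).mono_set ball_subset_closedBall
  have hm := mass_nonneg W τ
  have h4 : mass W τ ≤ (∫ x in ball (0 : Euc n) (10 * R), W (x, τ) ^ 2) +
      1 / (10 * R) ^ 2 * ∫ x : Euc n, ‖x‖ ^ 2 * W (x, τ) ^ 2 * gau (x, τ) := by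
    unfold mass
    rw [← integral_add_compl (measurableSet_ball (x := 0) (ε := 10 * R)) i1]
    refine add_le_add (setIntegral_mono_on i1.integrableOn i2 measurableSet_ball fun x hx => ?_) ?_
    · refine mul_le_of_le_one_right (sq_nonneg _) ?_
      unfold gau
      exact exp_le_one_iff.2 (by simp only; nlinarith [sq_nonneg ‖x‖])
    · rw [← integral_const_mul]
      refine (setIntegral_mono_on i1.integrableOn (i0.const_mul _).integrableOn
        measurableSet_ball.compl fun x hx => ?_).trans
        (setIntegral_le_integral (i0.const_mul _) (Eventually.of_forall fun x => by
          have := (gau_pos (x, τ)).le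
          positivity))
      have h5 : 10 * R ≤ ‖x‖ := by simpa using hx
      have h6 : 1 ≤ 1 / (10 * R) ^ 2 * ‖x‖ ^ 2 := by
        rw [one_div, ← div_eq_inv_mul, le_div_iff₀ (by positivity), one_mul]
        exact pow_le_pow_left₀ (by positivity) h5 2
      rw [mul_assoc (‖x‖ ^ 2), ← mul_assoc (1 / (10 * R) ^ 2)]
      exact le_mul_of_one_le_left (mul_nonneg (sq_nonneg _) (gau_pos (x, τ)).le) h6
  have h5 : 1 / (10 * R) ^ 2 * (∫ x : Euc n, ‖x‖ ^ 2 * W (x, τ) ^ 2 * gau (x, τ)) ≤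
      1 / 2 * mass W τ := by
    rw [one_div, ← div_eq_inv_mul, div_le_iff₀ (by positivity)]
    nlinarith [mul_le_mul_of_nonneg_right hRn hm]
  have h6 := setIntegral_smul_ball (n := n) (G := fun x => w (x, t₀) ^ 2)
    (l := r / (10 * R)) (by positivity) r
  have h7 : r / (r / (10 * R)) = 10 * R := by field_simp
  have h8 : ∀ x : Euc n, W (x, τ) = w ((r / (10 * R)) • x, t₀) := fun x => by
    simp only [hW, selfSim]
    rw [hl, hea, add_sub_cancel_right]
  have h6' : ∫ x in ball (0 : Euc n) (10 * R), W (x, τ) ^ 2 =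
      ((r / (10 * R)) ^ n)⁻¹ * ∫ x in ball (0 : Euc n) r, w (x, t₀) ^ 2 := by
    rw [← h6, h7]
    simp only [h8]
  rw [h6'] at h4
  have h9 : rexp (-(8 * R ^ 2 * Real.log (2 / r))) ≤
      rexp (-(4 * R ^ 2 * (Real.log (T / 2) - τ))) := by
    refine exp_le_exp.2 (neg_le_neg ?_)
    have h10 : Real.log (T / 2) - τ ≤ 2 * Real.log (2 / r) := by
      rw [hτ, ← Real.log_div (by positivity) ha0.ne', ← Real.log_rpow (by positivity)]
      refine Real.log_le_log (by positivity) ?_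
      rw [haT, Real.rpow_two, div_pow, div_div, div_le_div_iff₀ (by positivity) (by positivity)]
      have : 0 < T * r ^ 2 := by positivity
      linarith
    have := mul_le_mul_of_nonneg_left h10 (by positivity : 0 ≤ 4 * R ^ 2)
    linarith
  have h11 : 1 / 2 * mass W τ ≤
      ((r / (10 * R)) ^ n)⁻¹ * ∫ x in ball (0 : Euc n) r, w (x, t₀) ^ 2 := by linarith
  have h12 : rexp (-(8 * R ^ 2 * Real.log (2 / r))) *
        (θ ^ 2 / 5120 * rexp (-(17 / 40 * R ^ 2))) ≤ 1 / 2 * mass W τ := by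
    have := mul_le_mul_of_nonneg_right h9
      (by positivity : 0 ≤ θ ^ 2 / 5120 * rexp (-(17 / 40 * R ^ 2)))
    linarith
  have h13 := h12.trans h11
  rwa [← div_eq_inv_mul, le_div_iff₀ (by positivity), mul_comm] at h13

end AlmostSol

/-- The lower bound of `AlmostSol.le_setIntegral_ball` in closed form. -/
lemma exp_le_lower_bound {N R r θ : ℝ} (hN : (n : ℝ) + 10 ≤ N) (hR : N ≤ R) (hr : 0 < r)
    (hr1 : r ≤ 1 / 2) (hθ : 0 < θ) (hθR : 5120 / θ ^ 2 ≤ R) :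
    rexp (-(N * R ^ 2 * Real.log (N / r))) ^ 2 ≤
      (r / (10 * R)) ^ n * (rexp (-(8 * R ^ 2 * Real.log (2 / r))) *
        (θ ^ 2 / 5120 * rexp (-(17 / 40 * R ^ 2)))) := by
  have hn : (0 : ℝ) ≤ n := n.cast_nonneg
  have hN0 : 0 < N := by linarith
  have hR0 : 0 < R := by linarith
  have hR1 : R ≤ R ^ 2 := by nlinarith
  set l := Real.log (N / r) with hl
  have hl1 : 1 ≤ l := by
    rw [hl, Real.le_log_iff_exp_le (by positivity), le_div_iff₀ hr]
    nlinarith [Real.exp_one_lt_d9, exp_pos 1]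
  have h2 : Real.log (2 / r) ≤ l := by
    refine Real.log_le_log (by positivity) ?_
    gcongr
    linarith
  have h3 : Real.log (10 * R / r) ≤ 2 * R ^ 2 * l := by
    have h4 : 10 * R / r = 10 / r * R := by ring
    have h5 : Real.log (10 / r) ≤ l := by
      refine Real.log_le_log (by positivity) ?_
      gcongr
      linarith
    have h6 := Real.log_le_sub_one_of_pos hR0
    rw [h4, Real.log_mul (by positivity) hR0.ne']
    nlinarith
  have e1 : (r / (10 * R)) ^ n = rexp (-(n * Real.log (10 * R / r))) := by
    rw [← inv_div, inv_pow, exp_neg, exp_nat_mul, Real.exp_log (by positivity)]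
  have e2 : rexp (-R ^ 2) ≤ θ ^ 2 / 5120 := by
    rw [exp_neg, ← inv_div, inv_le_inv₀ (exp_pos _) (by positivity)]
    linarith [Real.add_one_le_exp (R ^ 2)]
  have e3 : rexp (-(n * Real.log (10 * R / r))) * (rexp (-(8 * R ^ 2 * Real.log (2 / r))) *
      (rexp (-R ^ 2) * rexp (-(17 / 40 * R ^ 2)))) ≤
      (r / (10 * R)) ^ n * (rexp (-(8 * R ^ 2 * Real.log (2 / r))) *
        (θ ^ 2 / 5120 * rexp (-(17 / 40 * R ^ 2)))) := by
    rw [e1]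
    gcongr
  refine le_trans ?_ e3
  rw [← exp_nat_mul, ← exp_add, ← exp_add, ← exp_add]
  refine exp_le_exp.2 ?_
  have h7 := mul_le_mul_of_nonneg_left h3 hn
  have h8 := mul_le_mul_of_nonneg_left h2 (by positivity : 0 ≤ 8 * R ^ 2)
  have h9 := mul_le_mul_of_nonneg_left hl1 (by positivity : 0 ≤ R ^ 2)
  have h10 := mul_le_mul_of_nonneg_right hN (by positivity : 0 ≤ R ^ 2 * l)
  push_cast
  linarith

/-- Quantitative unique continuation for almost solutions with a small enough error. -/
lemma exists_forall_almostSol (n : ℕ) {C θ : ℝ} (hC : 1 ≤ C) (hθ : 0 < θ) :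
    ∃ N ≥ (1 : ℝ), ∀ R ≥ N, ∀ r : ℝ, 0 < r → r ≤ 1 / 2 → ∃ κ > 0,
      ∀ (w e : Euc n × ℝ → ℝ) (t₀ : ℝ), AlmostSol w e R C t₀ (1 / (40 * R ^ 2)) κ →
        θ ^ 2 / 2 * (R ^ n)⁻¹ ≤ ∫ x in ball (0 : Euc n) (1 / 20), w (x, t₀) ^ 2 →
        rexp (-(N * R ^ 2 * Real.log (N / r))) ^ 2 ≤
          ∫ x in ball (0 : Euc n) r, w (x, t₀) ^ 2 := by
  have hg := one_le_gconst (n := n)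
  have hn : (0 : ℝ) ≤ n := n.cast_nonneg
  have k1 : 0 ≤ 120 * (10 ^ 6 * C ^ 2 * gconst n) / θ ^ 2 := by positivity
  have k2 : 0 ≤ 5120 / θ ^ 2 := by positivity
  refine ⟨n + 10 + 120 * (10 ^ 6 * C ^ 2 * gconst n) / θ ^ 2 + 5120 / θ ^ 2, by linarith,
    fun R hR r hr hr1 => ?_⟩
  have hR1 : 1 ≤ R := by linarith
  have hR2 : R ≤ R ^ 2 := by nlinarith
  have hX : 10 ^ 6 * C ^ 2 * gconst n ≤ θ ^ 2 * rexp (R ^ 2 / 120) := by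
    have h1 : 120 * (10 ^ 6 * C ^ 2 * gconst n) / θ ^ 2 ≤ R ^ 2 := by linarith
    rw [div_le_iff₀ (by positivity)] at h1
    have h2 := mul_le_mul_of_nonneg_left (Real.add_one_le_exp (R ^ 2 / 120)) (sq_nonneg θ)
    nlinarith [sq_nonneg θ]
  set T := 1 / (40 * R ^ 2) with hT
  set a := (r / (10 * R)) ^ 2 with ha
  have hTpos : 0 < T := by positivity
  have hapos : 0 < a := by positivity
  set b₁ := (√T ^ n)⁻¹
  set b₂ := 9 * rexp (-(4 * R ^ 2 * Real.log a) + 20 * R ^ 4) * (√a ^ n)⁻¹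
  set c₁ := θ ^ 2 / 16 * rexp (-(R ^ 2 / 40))
  set c₂ := cwt R (Real.log (T / 2)) * (C ^ 2 * gconst n * rexp (-(2 * R ^ 2)))
  have hb₁ : 0 < b₁ := by positivity
  have hb₂ : 0 < b₂ := by positivity
  have hc₁ : 0 < c₁ := by positivity
  have hc₂ : 0 < c₂ := mul_pos (cwt_pos _ _) (by positivity)
  refine ⟨min (c₁ / b₁) (c₂ / b₂), lt_min (by positivity) (by positivity),
    fun w e t₀ h hw => ?_⟩
  refine (exp_le_lower_bound (n := n) (θ := θ) (by linarith) hR hr hr1 hθ (by linarith)).trans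
    (h.le_setIntegral_ball hR1 (by rw [hT]; field_simp) (by linarith) hX hC
      (le_min (by positivity) (by positivity)) ?_ hw hθ hr hr1 ha ?_)
  · exact (mul_le_mul_of_nonneg_left (min_le_left _ _) hb₁.le).trans_eq (mul_div_cancel₀ _ hb₁.ne')
  · exact (mul_le_mul_of_nonneg_left (min_le_right _ _) hb₂.le).trans_eq (mul_div_cancel₀ _ hb₂.ne')

lemma contDiff_fderiv_apply {h : Euc n → ℝ} {k m : WithTop ℕ∞} (hh : ContDiff ℝ k h)
    (hm : m + 1 ≤ k) (e : Euc n) : ContDiff ℝ m fun y => fderiv ℝ h y e :=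
  (hh.fderiv_right hm).clm_apply contDiff_const

lemma continuous_slap {h : Euc n → ℝ} (hh : ContDiff ℝ 2 h) : Continuous (slap h) := by
  unfold slap
  refine continuous_finsetSum _ fun i _ => ?_
  exact (contDiff_fderiv_apply (m := 0) (contDiff_fderiv_apply (m := 1) hh
    (by norm_num) _) (by norm_num) _).continuous

lemma slap_sub {f g : Euc n → ℝ} (hf : ContDiff ℝ 2 f) (hg : ContDiff ℝ 2 g) (x : Euc n) :
    slap (fun y => f y - g y) x = slap f x - slap g x := by
  unfold slap
  rw [← Finset.sum_sub_distrib]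
  refine Finset.sum_congr rfl fun i _ => ?_
  have h1 : (fun y => fderiv ℝ (fun y => f y - g y) y (EuclideanSpace.single i 1)) =
      fun y => fderiv ℝ f y (EuclideanSpace.single i 1) -
        fderiv ℝ g y (EuclideanSpace.single i 1) := by
    ext y
    rw [fderiv_fun_sub (hf.differentiable (by norm_num) y) (hg.differentiable (by norm_num) y)]
    rfl
  rw [h1, fderiv_fun_sub]
  · rfl
  · exact (contDiff_fderiv_apply (m := 1) hf (by norm_num) _).differentiable (by norm_num) x
  · exact (contDiff_fderiv_apply (m := 1) hg (by norm_num) _).differentiable (by norm_num) x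

lemma slap_neg (f : Euc n → ℝ) (x : Euc n) : slap (fun y => -f y) x = -slap f x := by
  simp [slap, fderiv_fun_neg]

/-- The Laplacian is nonpositive at a local maximum. -/
lemma slap_nonpos_of_isLocalMax {h : Euc n → ℝ} (hh : ContDiff ℝ 2 h) {x : Euc n}
    (hx : IsLocalMax h x) : slap h x ≤ 0 := by
  refine Finset.sum_nonpos fun i _ => ?_
  set e : Euc n := EuclideanSpace.single i 1
  set k : ℝ → ℝ := fun τ => h (x + τ • e)
  have hl : ∀ τ : ℝ, HasDerivAt (fun τ : ℝ => x + τ • e) e τ := fun τ => by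
    simpa using ((hasDerivAt_id τ).smul_const e).const_add x
  have hk : deriv k = fun τ => fderiv ℝ h (x + τ • e) e := by
    ext τ
    exact ((hh.differentiable (by norm_num) _).hasFDerivAt.comp_hasDerivAt τ (hl τ)).deriv
  have hkk : deriv (deriv k) 0 = fderiv ℝ (fun y => fderiv ℝ h y e) x e := by
    rw [hk]
    have := ((contDiff_fderiv_apply (m := 1) hh (by norm_num) e).differentiable (by norm_num)
      (x + (0 : ℝ) • e)).hasFDerivAt.comp_hasDerivAt 0 (hl 0)
    simpa [Function.comp_def] using this.deriv
  have hkmax : IsLocalMax k 0 := by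
    have hc : ContinuousAt (fun τ : ℝ => x + τ • e) 0 := (hl 0).continuousAt
    have hx' : IsLocalMax h (x + (0 : ℝ) • e) := by simpa using hx
    exact hc.tendsto.eventually hx'
  rw [← hkk]
  by_contra! hpos
  have hmin := isLocalMin_of_deriv_deriv_pos hpos hkmax.deriv_eq_zero
    (hh.continuous.comp (by fun_prop : Continuous fun τ : ℝ => x + τ • e)).continuousAt
  have heq : k =ᶠ[𝓝 0] fun _ => k 0 := by
    filter_upwards [hkmax, hmin] with τ h1 h2 using le_antisymm h1 h2
  have h3 := heq.deriv.deriv_eq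
  simp at h3
  linarith

/-- A compactly supported, spatially `C²` function which is differentiable in time and satisfies
a differential inequality, without any joint regularity of the derivatives. -/
structure RoughSol (v g : Euc n × ℝ → ℝ) (S G : ℝ) : Prop where
  cont : Continuous v
  slice : ∀ t, ContDiff ℝ 2 fun x => v (x, t)
  supp : ∀ x t, 4 ≤ ‖x‖ → v (x, t) = 0
  diff : ∀ x, ∀ t ∈ Ioo 0 S, DifferentiableAt ℝ (fun s => v (x, s)) t
  ineq : ∀ x, ∀ t ∈ Ioo 0 S,
    |slap (fun y => v (y, t)) x + deriv (fun s => v (x, s)) t| ≤ g (x, t)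
  meas : Measurable g
  nonneg : ∀ z, 0 ≤ g z
  le : ∀ z, g z ≤ G

namespace RoughSol

variable {v g : Euc n × ℝ → ℝ} {S G : ℝ}

lemma neg (h : RoughSol v g S G) : RoughSol (fun z => -v z) g S G where
  cont := h.cont.neg
  slice t := (h.slice t).neg
  supp x t hx := by rw [h.supp x t hx, neg_zero]
  diff x t ht := (h.diff x t ht).neg
  ineq x t ht := by
    have := h.ineq x t ht
    rw [slap_neg, deriv.fun_neg, ← neg_add, abs_neg]
    exact this
  meas := h.meas
  nonneg := h.nonneg
  le := h.le

lemma hasCompactSupport_slice (h : RoughSol v g S G) (t : ℝ) : HasCompactSupport fun x => v (x, t) :=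
  HasCompactSupport.of_support_subset_isCompact (isCompact_closedBall (0 : Euc n) 4) fun x hx => by
    by_contra hc
    exact hx (h.supp x t (by simpa using (not_le.1 fun h' => hc (by simpa using h')).le))

lemma exists_slap_le (h : RoughSol v g S G) (t : ℝ) :
    ∃ A : ℝ, 0 ≤ A ∧ ∀ x, |slap (fun y => v (y, t)) x| ≤ A := by
  obtain ⟨A, hA⟩ := (isCompact_closedBall (0 : Euc n) 5).exists_bound_of_continuousOn
    (continuous_slap (h.slice t)).continuousOn
  refine ⟨max A 0, le_max_right _ _, fun x => ?_⟩
  by_cases hx : x ∈ closedBall (0 : Euc n) 5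
  · exact (hA x hx).trans (le_max_left _ _)
  · have hx' : (4 : ℝ) < ‖x‖ := by
      have : 5 < ‖x‖ := by simpa using hx
      linarith
    have h0 : ∀ᶠ y in 𝓝 x, v (y, t) = 0 := by
      filter_upwards [(isOpen_lt continuous_const continuous_norm).mem_nhds hx'] with y hy
      exact h.supp y t (le_of_lt hy)
    have h1 : ∀ i : Fin n, (fun y => fderiv ℝ (fun y => v (y, t)) y
        (EuclideanSpace.single i 1)) =ᶠ[𝓝 x] fun _ => 0 := fun i => by
      filter_upwards [h0.eventually_nhds] with y hy
      have : (fun y => v (y, t)) =ᶠ[𝓝 y] fun _ => 0 := hy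
      rw [this.fderiv_eq]
      simp
    have h2 : slap (fun y => v (y, t)) x = 0 := by
      refine Finset.sum_eq_zero fun i _ => ?_
      rw [(h1 i).fderiv_eq]
      simp
    rw [h2, abs_zero]
    exact le_max_right _ _

lemma exists_sub_le (h : RoughSol v g S G) {s : ℝ} (hs : s ∈ Ioo 0 S) :
    ∃ K : ℝ, 0 ≤ K ∧ ∀ x, ∀ t ∈ Icc (s / 2) s, v (x, t) - v (x, s) ≤ K * (s - t) := by
  obtain ⟨A, hA0, hA⟩ := h.exists_slap_le s
  have hG0 : 0 ≤ G := (h.nonneg 0).trans (h.le 0)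
  refine ⟨A + G + 1, by linarith, ?_⟩
  by_contra! hc
  obtain ⟨x₁, t₁, ht₁, h1⟩ := hc
  set K := A + G + 1
  set b : Euc n × ℝ → ℝ := fun z => v z - v (z.1, s) - K * (s - z.2) with hb
  have hbc : Continuous b := by
    have := h.cont
    fun_prop
  have hout : ∀ x, ∀ t ∈ Icc (s / 2) s, 4 ≤ ‖x‖ → b (x, t) ≤ 0 := fun x t ht hx => by
    simp only [hb, h.supp x t hx, h.supp x s hx]
    have : 0 ≤ K * (s - t) := mul_nonneg (by linarith) (by linarith [ht.2])
    linarith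
  have hb1 : 0 < b (x₁, t₁) := by simp only [hb]; linarith
  have hx₁ : ‖x₁‖ < 4 := by
    by_contra! hx
    linarith [hout x₁ t₁ ht₁ hx]
  obtain ⟨⟨x₀, t₀⟩, hz₀, hmax⟩ := ((isCompact_closedBall (0 : Euc n) 4).prod
    (isCompact_Icc (a := s / 2) (b := s))).exists_isMaxOn
      ⟨(x₁, t₁), by simpa using hx₁.le, ht₁⟩ hbc.continuousOn
  have hb0 : 0 < b (x₀, t₀) := hb1.trans_le (hmax ⟨by simpa using hx₁.le, ht₁⟩)
  have ht₀ : t₀ ∈ Icc (s / 2) s := hz₀.2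
  have hmax' : ∀ x, ∀ t ∈ Icc (s / 2) s, b (x, t) ≤ b (x₀, t₀) := fun x t ht => by
    rcases le_or_gt ‖x‖ 4 with hx | hx
    · exact hmax (a := (x, t)) ⟨by simpa using hx, ht⟩
    · exact (hout x t ht hx.le).trans hb0.le
  have hlt : t₀ < s := lt_of_le_of_ne ht₀.2 fun hts => by
    rw [hts] at hb0
    simp [hb] at hb0
  have ht₀S : t₀ ∈ Ioo 0 S := ⟨by linarith [ht₀.1, hs.1], hlt.trans hs.2⟩
  have hsp : slap (fun y => v (y, t₀)) x₀ ≤ A := by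
    have hloc : IsLocalMax (fun y => v (y, t₀) - v (y, s)) x₀ := Eventually.of_forall fun x => by
      have := hmax' x t₀ ht₀
      simp only [hb] at this
      simp only
      linarith
    have := slap_nonpos_of_isLocalMax ((h.slice t₀).sub (h.slice s)) hloc
    rw [slap_sub (h.slice t₀) (h.slice s)] at this
    linarith [le_abs_self (slap (fun y => v (y, s)) x₀), hA x₀]
  have hdt : deriv (fun τ => v (x₀, τ)) t₀ ≤ -K := by
    have hd := (h.diff x₀ t₀ ht₀S).hasDerivAt.hasDerivWithinAt (s := Ioi t₀)
    rw [hasDerivWithinAt_iff_tendsto_slope' (by simp)] at hd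
    refine le_of_tendsto hd ?_
    filter_upwards [Ioo_mem_nhdsGT hlt] with t ht
    have := hmax' x₀ t ⟨by linarith [ht.1, ht₀.1], ht.2.le⟩
    simp only [hb] at this
    rw [slope_def_field, div_le_iff₀ (by linarith [ht.1])]
    linarith
  have h5 := neg_le_of_abs_le (h.ineq x₀ t₀ ht₀S)
  have h6 := h.le (x₀, t₀)
  have hK : K = A + G + 1 := rfl
  linarith

lemma exists_abs_sub_le (h : RoughSol v g S G) {s : ℝ} (hs : s ∈ Ioo 0 S) :
    ∃ K : ℝ, 0 ≤ K ∧ ∀ x, ∀ t ∈ Icc (s / 2) s, |v (x, t) - v (x, s)| ≤ K * (s - t) := by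
  obtain ⟨K₁, h1, h1'⟩ := h.exists_sub_le hs
  obtain ⟨K₂, h2, h2'⟩ := h.neg.exists_sub_le hs
  refine ⟨K₁ + K₂, by positivity, fun x t ht => abs_le.2 ⟨?_, ?_⟩⟩
  · have := h2' x t ht
    have := mul_nonneg h1 (by linarith [ht.2] : 0 ≤ s - t)
    linarith
  · have := h1' x t ht
    have := mul_nonneg h2 (by linarith [ht.2] : 0 ≤ s - t)
    linarith

end RoughSol

lemma integral_mul_fderiv_apply {f g : Euc n → ℝ} (hf : ContDiff ℝ 1 f) (hg : ContDiff ℝ 1 g)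
    (hc : HasCompactSupport g) (e : Euc n) :
    ∫ x, f x * fderiv ℝ g x e = -∫ x, fderiv ℝ f x e * g x := by
  have hf' := (contDiff_fderiv_apply (m := 0) hf (by norm_num) e).continuous
  have hg' := (contDiff_fderiv_apply (m := 0) hg (by norm_num) e).continuous
  refine integral_mul_fderiv_eq_neg_fderiv_mul_of_integrable ?_ ?_ ?_
    (fun x _ => hf.differentiable (by norm_num) x) (fun x _ => hg.differentiable (by norm_num) x)
  · exact (hf'.mul hg.continuous).integrable_of_hasCompactSupport hc.mul_left
  · exact (hf.continuous.mul hg').integrable_of_hasCompactSupport (hc.fderiv_apply ℝ e).mul_left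
  · exact (hf.continuous.mul hg.continuous).integrable_of_hasCompactSupport hc.mul_left

lemma integral_mul_slap {f g : Euc n → ℝ} (hf : ContDiff ℝ 2 f) (hg : ContDiff ℝ 2 g)
    (hc : HasCompactSupport g) : ∫ x, f x * slap g x = ∫ x, slap f x * g x := by
  have c1 : ∀ {h : Euc n → ℝ}, ContDiff ℝ 2 h → ∀ e, ContDiff ℝ 1 fun y => fderiv ℝ h y e :=
    fun hh e => contDiff_fderiv_apply hh (by norm_num) e
  have c0 : ∀ {h : Euc n → ℝ}, ContDiff ℝ 2 h → ∀ e,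
      Continuous fun x => fderiv ℝ (fun y => fderiv ℝ h y e) x e :=
    fun hh e => (contDiff_fderiv_apply (m := 0) (c1 hh e) (by norm_num) e).continuous
  unfold slap
  simp only [Finset.mul_sum, Finset.sum_mul]
  rw [integral_finsetSum, integral_finsetSum]
  · refine Finset.sum_congr rfl fun i _ => ?_
    rw [integral_mul_fderiv_apply (hf.of_le (by norm_num)) (c1 hg _) (hc.fderiv_apply ℝ _),
      integral_mul_fderiv_apply (c1 hf _) (hg.of_le (by norm_num)) hc, neg_neg]
  · exact fun i _ => ((c0 hf _).mul hg.continuous).integrable_of_hasCompactSupport hc.mul_left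
  · exact fun i _ => (hf.continuous.mul (c0 hg _)).integrable_of_hasCompactSupport
      (HasCompactSupport.mul_left ((hc.fderiv_apply ℝ _).fderiv_apply ℝ _))

lemma pd_eventuallyEq_zero {f : Euc n × ℝ → ℝ} {z : Euc n × ℝ} (h : f =ᶠ[𝓝 z] 0)
    (e : Euc n × ℝ) : pd e f =ᶠ[𝓝 z] 0 := by
  filter_upwards [h.eventually_nhds] with y hy
  have : f =ᶠ[𝓝 y] fun _ => 0 := hy
  unfold pd
  rw [this.fderiv_eq]
  simp

lemma lap_eq_zero_of_eventuallyEq {f : Euc n × ℝ → ℝ} {z : Euc n × ℝ} (h : f =ᶠ[𝓝 z] 0) :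
    lap f z = 0 :=
  Finset.sum_eq_zero fun _ _ =>
    (pd_eventuallyEq_zero (pd_eventuallyEq_zero h _) _).self_of_nhds

lemma hasCompactSupport_pd {f : Euc n × ℝ → ℝ} (h : HasCompactSupport f) (e : Euc n × ℝ) :
    HasCompactSupport (pd e f) :=
  h.fderiv_apply ℝ e

lemma hasCompactSupport_lap {f : Euc n × ℝ → ℝ} (h : HasCompactSupport f) :
    HasCompactSupport (lap f) :=
  h.mono' fun z hz => by
    by_contra hc
    exact hz (lap_eq_zero_of_eventuallyEq (notMem_tsupport_iff_eventuallyEq.1 hc))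

lemma hasCompactSupport_comp_slice {f : Euc n × ℝ → ℝ} (h : HasCompactSupport f) (t : ℝ) :
    HasCompactSupport fun x => f (x, t) := by
  refine HasCompactSupport.intro (h.isCompact.image continuous_fst) fun x hx => ?_
  by_contra hne
  exact hx ⟨(x, t), subset_tsupport _ hne, rfl⟩

/-- The increment of a function is at most the integral of a bound for its left derivative. -/
lemma sub_le_integral_of_hasDeriv_left {V V' Φ : ℝ → ℝ} {a b : ℝ} (hab : a ≤ b)
    (hV : Continuous V) (hd : ∀ t ∈ Ioo a b, HasDerivWithinAt V (V' t) (Iio t) t)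
    (hΦ : Integrable Φ) (hle : ∀ t ∈ Ioo a b, V' t ≤ Φ t) :
    V b - V a ≤ ∫ t in a..b, Φ t := by
  have key := intervalIntegral.sub_le_integral_of_hasDeriv_right_of_le (a := -b) (b := -a)
    (g := fun t => -V (-t)) (g' := fun t => V' (-t)) (φ := fun t => Φ (-t)) (by linarith)
    (by fun_prop) (fun t ht => ?_) hΦ.comp_neg.integrableOn
    (fun t ht => hle (-t) ⟨by linarith [ht.2], by linarith [ht.1]⟩)
  · simp only [neg_neg, intervalIntegral.integral_comp_neg] at key
    linarith
  · have h1 := hd (-t) ⟨by linarith [ht.2], by linarith [ht.1]⟩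
    have h2 : HasDerivWithinAt (fun s : ℝ => -s) (-1) (Ioi t) t := (hasDerivWithinAt_id t _).neg
    have h3 := (h1.scomp t h2 fun s hs => by
      simp only [mem_Ioi, mem_Iio] at hs ⊢
      linarith).neg
    simpa [Function.comp_def, Pi.neg_def] using h3

namespace RoughSol

variable {v g ψ : Euc n × ℝ → ℝ} {S G : ℝ}

lemma continuous_integral_mul (h : RoughSol v g S G) (hψ : ContDiff ℝ ∞ ψ) :
    Continuous fun t => ∫ x, ψ (x, t) * v (x, t) := by
  have h1 : ∀ t, ∫ x, ψ (x, t) * v (x, t) =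
      ∫ x in closedBall (0 : Euc n) 4, ψ (x, t) * v (x, t) := fun t =>
    (setIntegral_eq_integral_of_forall_compl_eq_zero fun x hx => by
      rw [h.supp x t (le_of_lt (by simpa using hx)), mul_zero]).symm
  simp_rw [h1]
  refine continuous_parametric_integral_of_continuous
    (f := fun t x => ψ (x, t) * v (x, t)) ?_ (isCompact_closedBall _ _)
  have := h.cont
  have := hψ.continuous
  simp only [Function.uncurry_def]
  fun_prop

lemma hasDerivWithinAt_integral_mul (h : RoughSol v g S G) (hψ : ContDiff ℝ ∞ ψ)
    (hc : HasCompactSupport ψ) {s : ℝ} (hs : s ∈ Ioo 0 S) :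
    HasDerivWithinAt (fun t => ∫ x, ψ (x, t) * v (x, t))
      (∫ x, (pd (tdir n) ψ (x, s) * v (x, s) + ψ (x, s) * deriv (fun τ => v (x, τ)) s))
      (Iio s) s := by
  obtain ⟨K, hK0, hK⟩ := h.exists_abs_sub_le hs
  obtain ⟨M, hM⟩ := hc.exists_bound_of_continuous hψ.continuous
  obtain ⟨L, hL⟩ := (hasCompactSupport_pd hc (tdir n)).exists_bound_of_continuous
    (contDiff_pd hψ _).continuous
  obtain ⟨B, hB⟩ := (h.hasCompactSupport_slice s).exists_bound_of_continuous
    (h.slice s).continuous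
  have hψd : ∀ z, DifferentiableAt ℝ ψ z := fun z => hψ.differentiable (by simp) z
  have hint : ∀ t, Integrable fun x => ψ (x, t) * v (x, t) := fun t =>
    ((hψ.continuous.comp (by fun_prop : Continuous fun x : Euc n => (x, t))).mul
      (h.slice t).continuous).integrable_of_hasCompactSupport
        (h.hasCompactSupport_slice t).mul_left
  rw [hasDerivWithinAt_iff_tendsto_slope' (by simp)]
  have hslope : slope (fun t => ∫ x, ψ (x, t) * v (x, t)) s = fun t =>
      ∫ x, slope (fun τ => ψ (x, τ) * v (x, τ)) s t := by
    ext t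
    simp only [slope_def_field]
    rw [integral_div, integral_sub (hint t) (hint s)]
  rw [hslope]
  refine tendsto_integral_filter_of_dominated_convergence
    ((closedBall (0 : Euc n) 4).indicator fun _ => M * K + L * B) ?_ ?_ ?_ ?_
  · refine Eventually.of_forall fun t => Continuous.aestronglyMeasurable ?_
    simp only [slope_def_field]
    have := h.cont
    have := hψ.continuous
    fun_prop
  · filter_upwards [Ioo_mem_nhdsLT (by linarith [hs.1] : s / 2 < s)] with t ht
    refine Eventually.of_forall fun x => ?_
    by_cases hx : x ∈ closedBall (0 : Euc n) 4
    · rw [indicator_of_mem hx, slope_def_field, norm_div, Real.norm_eq_abs (t - s),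
        abs_of_neg (by linarith [ht.2]), div_le_iff₀ (by linarith [ht.2])]
      have e1 := hK x t ⟨ht.1.le, ht.2.le⟩
      have e2 : ‖ψ (x, t) - ψ (x, s)‖ ≤ L * ‖t - s‖ :=
        convex_univ.norm_image_sub_le_of_norm_deriv_le (f := fun τ => ψ (x, τ))
          (fun τ _ => (hasDerivAt_time (hψd (x, τ))).differentiableAt)
          (fun τ _ => by rw [(hasDerivAt_time (hψd (x, τ))).deriv]; exact hL _)
          (mem_univ s) (mem_univ t)
      rw [Real.norm_eq_abs (t - s), abs_of_neg (by linarith [ht.2])] at e2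
      have e3 : ψ (x, t) * v (x, t) - ψ (x, s) * v (x, s) =
          ψ (x, t) * (v (x, t) - v (x, s)) + (ψ (x, t) - ψ (x, s)) * v (x, s) := by ring
      rw [e3]
      refine (norm_add_le _ _).trans ?_
      rw [norm_mul, norm_mul]
      have e4 : ‖ψ (x, t)‖ * ‖v (x, t) - v (x, s)‖ ≤ M * (K * (s - t)) :=
        mul_le_mul (hM _) e1 (norm_nonneg _) ((norm_nonneg _).trans (hM (x, t)))
      have e5 : ‖ψ (x, t) - ψ (x, s)‖ * ‖v (x, s)‖ ≤ L * -(t - s) * B :=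
        mul_le_mul e2 (hB x) (norm_nonneg _) ((norm_nonneg _).trans e2)
      linarith
    · have hx' : 4 ≤ ‖x‖ := le_of_lt (by simpa using hx)
      simp [slope_def_field, h.supp x _ hx', indicator_of_notMem hx]
  · exact (integrable_indicator_iff measurableSet_closedBall).2
      (integrableOn_const (isCompact_closedBall _ _).measure_lt_top.ne)
  · refine Eventually.of_forall fun x => ?_
    have h1 := ((hasDerivAt_time (hψd (x, s))).mul (h.diff x s hs).hasDerivAt).hasDerivWithinAt
      (s := Iio s)
    rw [hasDerivWithinAt_iff_tendsto_slope' (by simp)] at h1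
    exact h1

lemma integral_le (h : RoughSol v g S G) (hψ : ContDiff ℝ ∞ ψ) (hc : HasCompactSupport ψ)
    (h0 : ∀ z, 0 ≤ ψ z) {s : ℝ} (hs : s ∈ Ioo 0 S) :
    ∫ x, (pd (tdir n) ψ (x, s) * v (x, s) + ψ (x, s) * deriv (fun τ => v (x, τ)) s) ≤
      ∫ x, (pd (tdir n) ψ (x, s) * v (x, s) - v (x, s) * lap ψ (x, s) +
        ψ (x, s) * g (x, s)) := by
  obtain ⟨A, hA0, hA⟩ := h.exists_slap_le s
  have hψs : ContDiff ℝ 2 fun x => ψ (x, s) :=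
    (hψ.comp (by fun_prop : ContDiff ℝ ∞ fun x : Euc n => (x, s))).of_le (WithTop.coe_le_coe.2 le_top)
  have hcs := hasCompactSupport_comp_slice hc s
  have hvs := h.hasCompactSupport_slice s
  have hvc := (h.slice s).continuous
  have hpc : Continuous fun x => pd (tdir n) ψ (x, s) :=
    (contDiff_pd hψ _).continuous.comp (by fun_prop)
  have hi1 : Integrable fun x => pd (tdir n) ψ (x, s) * v (x, s) :=
    (hpc.mul hvc).integrable_of_hasCompactSupport hvs.mul_left
  have hψi : Integrable fun x => ψ (x, s) := hψs.continuous.integrable_of_hasCompactSupport hcs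
  have hgm : Measurable fun x => g (x, s) := h.meas.comp (by fun_prop)
  have hi3 : Integrable fun x => ψ (x, s) * g (x, s) :=
    hψi.mul_bdd (c := G) hgm.aestronglyMeasurable (Eventually.of_forall fun x => by
      rw [Real.norm_eq_abs, abs_of_nonneg (h.nonneg _)]; exact h.le _)
  have hdm : Measurable fun x => deriv (fun τ => v (x, τ)) s :=
    (measurable_deriv_with_param (f := fun x τ => v (x, τ)) h.cont).comp
      (by fun_prop : Measurable fun x : Euc n => (x, s))
  have hi2 : Integrable fun x => ψ (x, s) * deriv (fun τ => v (x, τ)) s :=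
    hψi.mul_bdd (c := G + A) hdm.aestronglyMeasurable (Eventually.of_forall fun x => by
      have h1 := abs_le.1 (h.ineq x s hs)
      have h2 := abs_le.1 (hA x)
      have h3 := h.le (x, s)
      rw [Real.norm_eq_abs, abs_le]
      constructor <;> linarith [h1.1, h1.2, h2.1, h2.2])
  have hlc : Continuous fun x => slap (fun y => v (y, s)) x := continuous_slap (h.slice s)
  have hi4 : Integrable fun x => ψ (x, s) * slap (fun y => v (y, s)) x :=
    (hψs.continuous.mul hlc).integrable_of_hasCompactSupport hcs.mul_right
  have hi5 : Integrable fun x => v (x, s) * lap ψ (x, s) :=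
    (hvc.mul ((contDiff_lap hψ).continuous.comp (by fun_prop))).integrable_of_hasCompactSupport
      hvs.mul_right
  have hibp : ∫ x, v (x, s) * lap ψ (x, s) = ∫ x, ψ (x, s) * slap (fun y => v (y, s)) x := by
    simp_rw [← slap_slice hψ]
    rw [integral_mul_slap (h.slice s) hψs hcs]
    simp_rw [mul_comm]
  have hle : ∫ x, ψ (x, s) * deriv (fun τ => v (x, τ)) s ≤
      ∫ x, (ψ (x, s) * g (x, s) - ψ (x, s) * slap (fun y => v (y, s)) x) := by
    refine integral_mono hi2 (hi3.sub hi4) fun x => ?_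
    have h1 := (abs_le.1 (h.ineq x s hs)).2
    have h2 := mul_le_mul_of_nonneg_left h1 (h0 (x, s))
    simp only
    linarith
  rw [integral_sub hi3 hi4] at hle
  have hi15 : Integrable fun x => pd (tdir n) ψ (x, s) * v (x, s) - v (x, s) * lap ψ (x, s) :=
    hi1.sub hi5
  rw [integral_add hi1 hi2, integral_add hi15 hi3, integral_sub hi1 hi5, hibp]
  linarith

/-- The differential inequality in weak form. -/
lemma weak_le (h : RoughSol v g S G) (hψ : ContDiff ℝ ∞ ψ) (hc : HasCompactSupport ψ)
    (h0 : ∀ z, 0 ≤ ψ z) {a b : ℝ} (ha : 0 < a) (hb : b < S) (hab : a ≤ b)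
    (hψt : ∀ z : Euc n × ℝ, z.2 ∉ Icc a b → ψ z = 0) :
    ∫ z, v z * (lap ψ z - pd (tdir n) ψ z) ≤ ∫ z, ψ z * g z := by
  have hpc := (contDiff_pd hψ (tdir n)).continuous
  have hlc := (contDiff_lap hψ).continuous
  have hi1 : Integrable fun z => pd (tdir n) ψ z * v z :=
    (hpc.mul h.cont).integrable_of_hasCompactSupport (hasCompactSupport_pd hc _).mul_right
  have hi2 : Integrable fun z => v z * lap ψ z :=
    (h.cont.mul hlc).integrable_of_hasCompactSupport (hasCompactSupport_lap hc).mul_left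
  have hi3 : Integrable fun z => ψ z * g z :=
    (hψ.continuous.integrable_of_hasCompactSupport hc).mul_bdd (c := G) h.meas.aestronglyMeasurable
      (Eventually.of_forall fun x => by
        rw [Real.norm_eq_abs, abs_of_nonneg (h.nonneg _)]; exact h.le _)
  have hi12 : Integrable fun z => pd (tdir n) ψ z * v z - v z * lap ψ z := hi1.sub hi2
  have hi := hi12.add hi3
  set Φ : ℝ → ℝ := fun s => ∫ x, (pd (tdir n) ψ (x, s) * v (x, s) - v (x, s) * lap ψ (x, s) +
        ψ (x, s) * g (x, s))
  have hz : ∀ x t, t ∉ Icc a b → ψ =ᶠ[𝓝 (x, t)] 0 := fun x t ht => by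
    have : ∀ᶠ z : Euc n × ℝ in 𝓝 (x, t), z.2 ∈ (Icc a b)ᶜ :=
      continuous_snd.continuousAt.eventually (isClosed_Icc.isOpen_compl.mem_nhds ht)
    filter_upwards [this] with z hz using hψt z hz
  have hΦs : Function.support Φ ⊆ Ioc (a / 2) ((b + S) / 2) := fun t ht => by
    by_contra hc'
    refine ht ?_
    have ht' : t ∉ Icc a b := fun h' => hc' ⟨by linarith [h'.1], by linarith [h'.2]⟩
    have : ∀ x : Euc n, pd (tdir n) ψ (x, t) * v (x, t) - v (x, t) * lap ψ (x, t) +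
        ψ (x, t) * g (x, t) = 0 := fun x => by
      rw [(pd_eventuallyEq_zero (hz x t ht') _).self_of_nhds,
        lap_eq_zero_of_eventuallyEq (hz x t ht'), hψt _ ht']
      simp
    simp only [Φ, this, integral_zero]
  have key := sub_le_integral_of_hasDeriv_left (a := a / 2) (b := (b + S) / 2) (by linarith)
    (h.continuous_integral_mul hψ) (Φ := Φ)
    (fun t ht => h.hasDerivWithinAt_integral_mul hψ hc ⟨by linarith [ht.1], by linarith [ht.2]⟩)
    (hi.integral_prod_right (μ := (volume : Measure (Euc n))) (ν := (volume : Measure ℝ)))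
    (fun t ht => h.integral_le hψ hc h0 ⟨by linarith [ht.1], by linarith [ht.2]⟩)
  have hz' : ∀ t, t ∉ Icc a b → ∫ x, ψ (x, t) * v (x, t) = 0 := fun t ht => by
    simp [hψt (_, t) ht]
  rw [hz' _ fun h' => by linarith [h'.2], hz' _ fun h' => by linarith [h'.1], sub_zero,
    intervalIntegral.integral_eq_integral_of_support_subset hΦs] at key
  have e1 : ∫ t, Φ t = ∫ z, (pd (tdir n) ψ z * v z - v z * lap ψ z + ψ z * g z) :=
    (integral_prod_symm (μ := (volume : Measure (Euc n))) (ν := (volume : Measure ℝ)) _ hi).symm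
  rw [e1, integral_add hi12 hi3, integral_sub hi1 hi2] at key
  have e2 : ∫ z, v z * (lap ψ z - pd (tdir n) ψ z) =
      (∫ z, v z * lap ψ z) - ∫ z, pd (tdir n) ψ z * v z := by
    rw [← integral_sub hi2 hi1]
    congr 1
    ext z
    ring
  rw [e2]
  linarith

lemma abs_weak_le (h : RoughSol v g S G) (hψ : ContDiff ℝ ∞ ψ) (hc : HasCompactSupport ψ)
    (h0 : ∀ z, 0 ≤ ψ z) {a b : ℝ} (ha : 0 < a) (hb : b < S) (hab : a ≤ b)
    (hψt : ∀ z : Euc n × ℝ, z.2 ∉ Icc a b → ψ z = 0) :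
    |∫ z, v z * (lap ψ z - pd (tdir n) ψ z)| ≤ ∫ z, ψ z * g z := by
  have h1 := h.neg.weak_le hψ hc h0 ha hb hab hψt
  simp only [neg_mul, integral_neg] at h1
  exact abs_le.2 ⟨by linarith, h.weak_le hψ hc h0 ha hb hab hψt⟩

end RoughSol

/-- A smooth nonnegative kernel on space-time of integral one, supported in a ball of
radius `ε`. -/
structure Mollifier (η : Euc n × ℝ → ℝ) (ε : ℝ) : Prop where
  smooth : ContDiff ℝ ∞ η
  nonneg : ∀ z, 0 ≤ η z
  integral : ∫ z, η z = 1
  supp : ∀ z, ε ≤ ‖z‖ → η z = 0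

/-- The convolution of a function on space-time with a kernel. -/
noncomputable def mollify (η f : Euc n × ℝ → ℝ) (z : Euc n × ℝ) : ℝ := ∫ y, f y * η (z - y)

instance isAddHaarMeasure_spaceTime : (volume : Measure (Euc n × ℝ)).IsAddHaarMeasure :=
  Measure.prod.instIsAddHaarMeasure _ _

lemma mollifier_normed (φ : ContDiffBump (0 : Euc n × ℝ)) : Mollifier (φ.normed volume) φ.rOut where
  smooth := φ.contDiff_normed
  nonneg := φ.nonneg_normed
  integral := φ.integral_normed
  supp z hz := by
    have : z ∉ Function.support (φ.normed volume) := by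
      rw [φ.support_normed_eq]
      simpa using hz
    simpa using this

lemma locallyIntegrable_of_abs_le {f : Euc n × ℝ → ℝ} {M : ℝ} (hf : Measurable f)
    (hM : ∀ z, |f z| ≤ M) : LocallyIntegrable f (volume : Measure (Euc n × ℝ)) :=
  (locallyIntegrable_const M).mono hf.aestronglyMeasurable
    (Eventually.of_forall fun z => (hM z).trans (le_abs_self M))

lemma contDiff_mollify {η f : Euc n × ℝ → ℝ} {M : ℝ} (hη : ContDiff ℝ ∞ η)
    (hc : HasCompactSupport η) (hf : Measurable f) (hM : ∀ z, |f z| ≤ M) :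
    ContDiff ℝ ∞ (mollify η f) :=
  hc.contDiff_convolution_right (ContinuousLinearMap.mul ℝ ℝ) (locallyIntegrable_of_abs_le hf hM) hη

lemma pd_mollify {η f : Euc n × ℝ → ℝ} {M : ℝ} (hη : ContDiff ℝ ∞ η)
    (hc : HasCompactSupport η) (hf : Measurable f) (hM : ∀ z, |f z| ≤ M) (e : Euc n × ℝ) :
    pd e (mollify η f) = mollify (pd e η) f := by
  have hl := locallyIntegrable_of_abs_le hf hM
  ext z
  have h1 := hc.hasFDerivAt_convolution_right (ContinuousLinearMap.mul ℝ ℝ) hl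
    (hη.of_le (by simp)) z
  have h2 : fderiv ℝ (mollify η f) z = _ := h1.fderiv
  unfold pd
  rw [h2, convolution_precompR_apply _ hl (hc.fderiv (𝕜 := ℝ))
    (hη.continuous_fderiv (by simp))]
  rfl

lemma integrable_mollify {η f : Euc n × ℝ → ℝ} {M : ℝ} (hη : Continuous η)
    (hc : HasCompactSupport η) (hf : Measurable f) (hM : ∀ z, |f z| ≤ M) (z : Euc n × ℝ) :
    Integrable fun y => f y * η (z - y) := by
  have h1 : Integrable fun y => η (z - y) := (hη.integrable_of_hasCompactSupport hc).comp_sub_left z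
  exact h1.bdd_mul (c := M) hf.aestronglyMeasurable (Eventually.of_forall hM)

lemma lap_mollify {η f : Euc n × ℝ → ℝ} {M : ℝ} (hη : ContDiff ℝ ∞ η)
    (hc : HasCompactSupport η) (hf : Measurable f) (hM : ∀ z, |f z| ≤ M) :
    lap (mollify η f) = mollify (lap η) f := by
  ext z
  unfold lap
  simp_rw [pd_mollify hη hc hf hM,
    pd_mollify (contDiff_pd hη _) (hasCompactSupport_pd hc _) hf hM, mollify, Finset.mul_sum]
  rw [integral_finsetSum]
  exact fun i _ => integrable_mollify (contDiff_pd (contDiff_pd hη _) _).continuous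
    (hasCompactSupport_pd (hasCompactSupport_pd hc _) _) hf hM z

lemma pd_comp_sub {η : Euc n × ℝ → ℝ} (hη : ContDiff ℝ ∞ η) (z e : Euc n × ℝ) :
    pd e (fun y => η (z - y)) = fun y => -pd e η (z - y) := by
  ext y
  have h1 : HasFDerivAt (fun y : Euc n × ℝ => z - y)
      (-ContinuousLinearMap.id ℝ (Euc n × ℝ)) y := (hasFDerivAt_id y).const_sub z
  have h2 := ((hη.differentiable (by simp) (z - y)).hasFDerivAt.comp y h1).fderiv
  unfold pd
  simp only [Function.comp_def] at h2
  rw [h2]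
  simp

lemma lap_comp_sub {η : Euc n × ℝ → ℝ} (hη : ContDiff ℝ ∞ η) (z y : Euc n × ℝ) :
    lap (fun y => η (z - y)) y = lap η (z - y) := by
  unfold lap
  refine Finset.sum_congr rfl fun i _ => ?_
  rw [pd_comp_sub hη]
  have h1 := pd_comp_sub (contDiff_pd hη (sdir i)) z (sdir i)
  have h2 : pd (sdir i) (fun y => -pd (sdir i) η (z - y)) y =
      -pd (sdir i) (fun y => pd (sdir i) η (z - y)) y := by
    unfold pd
    rw [fderiv_fun_neg]
    rfl
  rw [h2, h1, neg_neg]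

namespace Mollifier

variable {η f g : Euc n × ℝ → ℝ} {ε M : ℝ}

lemma hasCompactSupport (h : Mollifier η ε) : HasCompactSupport η :=
  HasCompactSupport.intro (isCompact_closedBall (0 : Euc n × ℝ) ε) fun z hz =>
    h.supp z (le_of_lt (by simpa using hz))

lemma integrable (h : Mollifier η ε) (hf : Measurable f) (hM : ∀ z, |f z| ≤ M) (z : Euc n × ℝ) :
    Integrable fun y => f y * η (z - y) :=
  integrable_mollify h.smooth.continuous h.hasCompactSupport hf hM z

lemma integral_sub (h : Mollifier η ε) (z : Euc n × ℝ) : ∫ y, η (z - y) = 1 := by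
  rw [integral_sub_left_eq_self, h.integral]

lemma integrable_sub (h : Mollifier η ε) (z : Euc n × ℝ) : Integrable fun y => η (z - y) :=
  (h.smooth.continuous.integrable_of_hasCompactSupport h.hasCompactSupport).comp_sub_left z

lemma abs_mollify_sub_le (h : Mollifier η ε) (hf : Measurable f) (hM : ∀ z, |f z| ≤ M)
    {z : Euc n × ℝ} {a δ : ℝ} (hδ : ∀ y, ‖z - y‖ < ε → |f y - a| ≤ δ) :
    |mollify η f z - a| ≤ δ := by
  have h1 : mollify η f z - a = ∫ y, (f y - a) * η (z - y) := by
    simp_rw [sub_mul]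
    rw [MeasureTheory.integral_sub (h.integrable hf hM z) ((h.integrable_sub z).const_mul a),
      integral_const_mul, h.integral_sub, mul_one]
    rfl
  have h2 : δ = ∫ y, δ * η (z - y) := by rw [integral_const_mul, h.integral_sub, mul_one]
  rw [h1, h2, ← Real.norm_eq_abs]
  refine norm_integral_le_of_norm_le ((h.integrable_sub z).const_mul δ)
    (Eventually.of_forall fun y => ?_)
  rw [norm_mul, Real.norm_eq_abs, Real.norm_eq_abs, abs_of_nonneg (h.nonneg _)]
  by_cases hy : ‖z - y‖ < ε
  · exact mul_le_mul_of_nonneg_right (hδ y hy) (h.nonneg _)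
  · simp [h.supp _ (not_lt.1 hy)]

lemma abs_mollify_le (h : Mollifier η ε) (hf : Measurable f) (hM : ∀ z, |f z| ≤ M)
    (z : Euc n × ℝ) : |mollify η f z| ≤ M := by
  simpa using h.abs_mollify_sub_le (a := 0) hf hM (z := z) (δ := M) fun y _ => by simpa using hM y

lemma mollify_eq_zero (h : Mollifier η ε) (z : Euc n × ℝ)
    (hz : ∀ y, ‖z - y‖ < ε → f y = 0) : mollify η f z = 0 := by
  unfold mollify
  rw [← integral_zero (Euc n × ℝ) ℝ]
  congr 1
  ext y
  by_cases hy : ‖z - y‖ < ε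
  · simp [hz y hy]
  · simp [h.supp _ (not_lt.1 hy)]

/-- Convolution with a kernel turns the weak differential inequality into a pointwise one. -/
lemma abs_lap_add_pd_le (h : Mollifier η ε) {v g : Euc n × ℝ → ℝ} {S G : ℝ} (hv : RoughSol v g S G)
    (hM : ∀ z, |v z| ≤ M) (hε : 0 < ε) (x : Euc n) {t : ℝ} (ht : ε < t) (ht' : t + ε < S) :
    |lap (mollify η v) (x, t) + pd (tdir n) (mollify η v) (x, t)| ≤ mollify η g (x, t) := by
  have hvm := hv.cont.measurable
  set ψ : Euc n × ℝ → ℝ := fun y => η ((x, t) - y) with hψ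
  have hψc : HasCompactSupport ψ := HasCompactSupport.intro
    (isCompact_closedBall ((x, t) : Euc n × ℝ) ε) fun y hy => h.supp _ (by
      rw [mem_closedBall, dist_comm, dist_eq_norm, not_le] at hy
      exact hy.le)
  have key := hv.abs_weak_le (ψ := ψ) (h.smooth.comp (by fun_prop)) hψc
    (fun z => h.nonneg _) (a := t - ε) (b := t + ε) (by linarith) ht' (by linarith) fun y hy =>
      h.supp _ (by
        refine le_trans ?_ (norm_snd_le _)
        by_contra! hlt
        refine hy ?_
        have := abs_lt.1 hlt
        simp only [Prod.snd_sub] at this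
        exact ⟨by linarith [this.2], by linarith [this.1]⟩)
  have e1 : ∫ z, v z * (lap ψ z - pd (tdir n) ψ z) =
      lap (mollify η v) (x, t) + pd (tdir n) (mollify η v) (x, t) := by
    rw [lap_mollify h.smooth h.hasCompactSupport hvm hM,
      pd_mollify h.smooth h.hasCompactSupport hvm hM]
    unfold mollify
    rw [← integral_add (integrable_mollify (contDiff_lap h.smooth).continuous
        (hasCompactSupport_lap h.hasCompactSupport) hvm hM _)
      (integrable_mollify (contDiff_pd h.smooth _).continuous
        (hasCompactSupport_pd h.hasCompactSupport _) hvm hM _)]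
    congr 1
    ext y
    rw [hψ, lap_comp_sub h.smooth, pd_comp_sub h.smooth]
    ring
  have e2 : ∫ z, ψ z * g z = mollify η g (x, t) := by
    unfold mollify
    congr 1
    ext y
    rw [mul_comm]
  rwa [e1, e2] at key

lemma pd_sdir_mollify (h : Mollifier η ε) {v : Euc n × ℝ → ℝ} (hv : Continuous v)
    (hs : ∀ t, ContDiff ℝ 1 fun x => v (x, t)) (hM : ∀ z, |v z| ≤ M) {D : ℝ}
    (hD : ∀ z : Euc n × ℝ, ‖fderiv ℝ (fun x => v (x, z.2)) z.1‖ ≤ D)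
    (hm : Measurable fun z : Euc n × ℝ => fderiv ℝ (fun x => v (x, z.2)) z.1) (i : Fin n) :
    pd (sdir i) (mollify η v) = mollify η fun z => fderiv ℝ (fun x => v (x, z.2)) z.1
      (EuclideanSpace.single i 1) := by
  have hc := h.hasCompactSupport
  rw [pd_mollify h.smooth hc hv.measurable hM]
  ext z
  have hi1 := integrable_mollify (contDiff_pd h.smooth (sdir i)).continuous
    (hasCompactSupport_pd hc _) hv.measurable hM z
  have hi2 := h.integrable (f := fun z => fderiv ℝ (fun x => v (x, z.2)) z.1
      (EuclideanSpace.single i 1)) (M := D) (hm.apply_continuousLinearMap _)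
    (fun z => by
      have := (fderiv ℝ (fun x => v (x, z.2)) z.1).le_opNorm (EuclideanSpace.single i 1)
      rw [PiLp.norm_single, norm_one, mul_one] at this
      exact this.trans (hD z)) z
  unfold mollify
  have e1 := integral_prod_symm (μ := (volume : Measure (Euc n))) (ν := (volume : Measure ℝ)) _ hi1
  have e2 := integral_prod_symm (μ := (volume : Measure (Euc n))) (ν := (volume : Measure ℝ)) _ hi2
  refine e1.trans (Eq.trans ?_ e2.symm)
  congr 1
  ext s
  have hψ : ContDiff ℝ ∞ fun y : Euc n × ℝ => η (z - y) := h.smooth.comp (by fun_prop)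
  have hψc : HasCompactSupport fun y : Euc n × ℝ => η (z - y) := HasCompactSupport.intro
    (isCompact_closedBall z ε) fun y hy => h.supp _ (by
      rw [mem_closedBall, dist_comm, dist_eq_norm, not_le] at hy
      exact hy.le)
  have h1 := integral_mul_fderiv_apply (hs s) (g := fun x => η (z - (x, s)))
    ((hψ.of_le (by simp)).comp (by fun_prop : ContDiff ℝ 1 fun x : Euc n => (x, s)))
    (hasCompactSupport_comp_slice hψc s) (EuclideanSpace.single i 1)
  have h2 : ∀ x, fderiv ℝ (fun x => η (z - (x, s))) x (EuclideanSpace.single i 1) =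
      -pd (sdir i) η (z - (x, s)) := fun x => by
    rw [fderiv_slice (f := fun y => η (z - y)) (hψ.differentiable (by simp) _)]
    exact congrFun (pd_comp_sub h.smooth z (sdir i)) (x, s)
  simp_rw [h2, mul_neg, integral_neg] at h1
  exact neg_injective h1

end Mollifier

lemma ae_tendsto_mollify {φ : ℕ → ContDiffBump (0 : Euc n × ℝ)}
    (hφ : Tendsto (fun k => (φ k).rOut) atTop (𝓝 0)) (hφ' : ∀ k, (φ k).rOut ≤ 2 * (φ k).rIn)
    {f : Euc n × ℝ → ℝ} {M : ℝ} (hf : Measurable f) (hM : ∀ z, |f z| ≤ M) :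
    ∀ᵐ z, Tendsto (fun k => mollify ((φ k).normed volume) f z) atTop (𝓝 (f z)) := by
  filter_upwards [ContDiffBump.ae_convolution_tendsto_right_of_locallyIntegrable (μ := volume)
    hφ (Eventually.of_forall hφ') (locallyIntegrable_of_abs_le hf hM)] with z hz
  refine hz.congr fun k => ?_
  rw [convolution_eq_swap]
  unfold mollify
  congr 1
  ext y
  simp [mul_comm]

/-- The length of the spatial gradient of a function on space-time. -/
noncomputable def gradNorm (v : Euc n × ℝ → ℝ) (z : Euc n × ℝ) : ℝ :=
  ‖fderiv ℝ (fun x => v (x, z.2)) z.1‖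

/-- The indicator of the exterior of the cylinder of radius three. -/
noncomputable def outer (z : Euc n × ℝ) : ℝ := {z : Euc n × ℝ | 3 ≤ ‖z.1‖}.indicator (fun _ => 1) z

lemma measurable_outer : Measurable (outer (n := n)) :=
  measurable_const.indicator (measurableSet_le measurable_const (by fun_prop))

lemma outer_nonneg (z : Euc n × ℝ) : 0 ≤ outer z :=
  indicator_nonneg (fun _ _ => zero_le_one) z

lemma outer_le_one (z : Euc n × ℝ) : outer z ≤ 1 :=
  indicator_le_self' (fun _ _ => zero_le_one) z

lemma abs_outer_le (z : Euc n × ℝ) : |outer z| ≤ 1 :=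
  (abs_of_nonneg (outer_nonneg z)).trans_le (outer_le_one z)

/-- The error in the differential inequality caused by a convolution. -/
noncomputable def mollifyErr (η v : Euc n × ℝ → ℝ) (R B : ℝ) (z : Euc n × ℝ) : ℝ :=
  R ^ 2 * (mollify η (fun z => |v z|) z - |mollify η v z|) +
    R * (mollify η (gradNorm v) z - √(gsq (mollify η v) z)) + B * R ^ 2 * mollify η outer z

/-- The right-hand side of the rough differential inequality. -/
noncomputable def roughBound (v : Euc n × ℝ → ℝ) (R B : ℝ) (z : Euc n × ℝ) : ℝ :=
  R ^ 2 * |v z| + R * gradNorm v z + B * R ^ 2 * outer z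

lemma measurable_fderiv_slice {v : Euc n × ℝ → ℝ} (hv : Continuous v) :
    Measurable fun z : Euc n × ℝ => fderiv ℝ (fun x => v (x, z.2)) z.1 :=
  (measurable_fderiv_with_param ℝ (f := fun (t : ℝ) (x : Euc n) => v (x, t))
    (by simp only [Function.uncurry_def]; fun_prop)).comp measurable_swap

lemma measurable_gradNorm {v : Euc n × ℝ → ℝ} (hv : Continuous v) : Measurable (gradNorm v) :=
  (measurable_fderiv_slice hv).norm

lemma gradNorm_nonneg (v : Euc n × ℝ → ℝ) (z : Euc n × ℝ) : 0 ≤ gradNorm v z := norm_nonneg _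

namespace Mollifier

variable {η v : Euc n × ℝ → ℝ} {ε R B D C G S : ℝ}

lemma gsq_mollify (h : Mollifier η ε) (hv : Continuous v)
    (hs : ∀ t, ContDiff ℝ 1 fun x => v (x, t)) (hM : ∀ z, |v z| ≤ 1)
    (hD : ∀ z, gradNorm v z ≤ D) (z : Euc n × ℝ) :
    gsq (mollify η v) z = ∑ i, mollify η (fun z => fderiv ℝ (fun x => v (x, z.2)) z.1
      (EuclideanSpace.single i 1)) z ^ 2 := by
  unfold gsq
  simp_rw [h.pd_sdir_mollify hv hs hM hD (measurable_fderiv_slice hv)]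

lemma abs_fderiv_single_le (hD : ∀ z, gradNorm v z ≤ D) (i : Fin n) (z : Euc n × ℝ) :
    |fderiv ℝ (fun x => v (x, z.2)) z.1 (EuclideanSpace.single i 1)| ≤ D := by
  have := (fderiv ℝ (fun x => v (x, z.2)) z.1).le_opNorm (EuclideanSpace.single i 1)
  rw [PiLp.norm_single, norm_one, mul_one] at this
  exact this.trans (hD z)

lemma gsq_mollify_le (h : Mollifier η ε) (hv : Continuous v)
    (hs : ∀ t, ContDiff ℝ 1 fun x => v (x, t)) (hM : ∀ z, |v z| ≤ 1)
    (hD : ∀ z, gradNorm v z ≤ D) (z : Euc n × ℝ) :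
    gsq (mollify η v) z ≤ (n * D) ^ 2 := by
  rw [h.gsq_mollify hv hs hM hD]
  have h1 : ∀ i ∈ (Finset.univ : Finset (Fin n)), mollify η (fun z =>
      fderiv ℝ (fun x => v (x, z.2)) z.1 (EuclideanSpace.single i 1)) z ^ 2 ≤ D ^ 2 :=
    fun i _ => by
      refine sq_le_sq' ?_ ?_ <;>
      linarith [abs_le.1 (h.abs_mollify_le ((measurable_fderiv_slice hv).apply_continuousLinearMap
        (EuclideanSpace.single i 1)) (abs_fderiv_single_le hD i) z)]
  refine (Finset.sum_le_sum h1).trans ?_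
  rw [Finset.sum_const, Finset.card_univ, Fintype.card_fin, nsmul_eq_mul, mul_pow]
  refine mul_le_mul_of_nonneg_right ?_ (sq_nonneg _)
  exact_mod_cast Nat.le_self_pow two_ne_zero n

lemma abs_mollifyErr_le (h : Mollifier η ε) (hv : Continuous v)
    (hs : ∀ t, ContDiff ℝ 1 fun x => v (x, t)) (hM : ∀ z, |v z| ≤ 1)
    (hR : 0 < R) (hB : 0 ≤ B) (hD0 : 0 ≤ D) (hD : ∀ z, gradNorm v z ≤ D * R)
    (hC : 2 + (n + 1) * D + B ≤ C) (z : Euc n × ℝ) :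
    |mollifyErr η v R B z| ≤ C * R ^ 2 := by
  have a1 := h.abs_mollify_le hv.measurable.norm (M := 1) (fun z => by simpa using hM z) z
  have a2 := h.abs_mollify_le hv.measurable hM z
  have a3 := h.abs_mollify_le (measurable_gradNorm hv) (M := D * R) (fun z => by
    rw [abs_of_nonneg (gradNorm_nonneg _ _)]; exact hD z) z
  have a4 := h.abs_mollify_le measurable_outer abs_outer_le z
  have hDR : 0 ≤ D * R := by positivity
  have a5 : √(gsq (mollify η v) z) ≤ n * (D * R) :=
    Real.sqrt_le_iff.2 ⟨by positivity, h.gsq_mollify_le hv hs hM hD z⟩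
  have a6 := Real.sqrt_nonneg (gsq (mollify η v) z)
  simp only [Real.norm_eq_abs] at a1
  have b1 : |mollify η (fun z => |v z|) z - (|mollify η v z|)| ≤ 2 := by
    have := abs_nonneg (mollify η v z)
    rw [abs_le] at a1 ⊢
    constructor <;> linarith [a1.1, a1.2]
  have b2 : |mollify η (gradNorm v) z - √(gsq (mollify η v) z)| ≤ (n + 1) * (D * R) := by
    have : 0 ≤ n * (D * R) := by positivity
    rw [abs_le] at a3 ⊢
    constructor <;> linarith [a3.1, a3.2]
  unfold mollifyErr
  refine (abs_add_three _ _ _).trans ?_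
  rw [abs_mul, abs_mul, abs_mul, abs_of_pos hR, abs_of_nonneg (by positivity : 0 ≤ R ^ 2),
    abs_of_nonneg (by positivity : 0 ≤ B * R ^ 2)]
  calc _ ≤ R ^ 2 * 2 + R * ((n + 1) * (D * R)) + B * R ^ 2 * 1 := by gcongr
    _ = (2 + (n + 1) * D + B) * R ^ 2 := by ring
    _ ≤ _ := by gcongr

lemma continuous_mollifyErr (h : Mollifier η ε) (hv : Continuous v)
    (hM : ∀ z, |v z| ≤ 1) (hD : ∀ z, gradNorm v z ≤ D) :
    Continuous (mollifyErr η v R B) := by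
  have c1 := (contDiff_mollify h.smooth h.hasCompactSupport hv.measurable.norm (M := 1)
    (fun z => by simpa using hM z)).continuous
  have c2 := contDiff_mollify h.smooth h.hasCompactSupport hv.measurable hM
  have c3 := (contDiff_mollify h.smooth h.hasCompactSupport (measurable_gradNorm hv) (M := D)
    (fun z => by rw [abs_of_nonneg (gradNorm_nonneg _ _)]; exact hD z)).continuous
  have c4 := (contDiff_mollify h.smooth h.hasCompactSupport measurable_outer abs_outer_le).continuous
  have c5 := (contDiff_gsq c2).continuous
  have c6 := c2.continuous
  simp only [Real.norm_eq_abs] at c1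
  unfold mollifyErr
  fun_prop

lemma mollify_roughBound (h : Mollifier η ε) (hv : Continuous v)
    (hM : ∀ z, |v z| ≤ 1) (hD : ∀ z, gradNorm v z ≤ D) (z : Euc n × ℝ) :
    mollify η (roughBound v R B) z = R ^ 2 * |mollify η v z| + R * √(gsq (mollify η v) z) +
      mollifyErr η v R B z := by
  have i1 := h.integrable hv.measurable.norm (M := 1) (fun z => by simpa using hM z) z
  have i3 := h.integrable (measurable_gradNorm hv) (M := D)
    (fun z => by rw [abs_of_nonneg (gradNorm_nonneg _ _)]; exact hD z) z
  have i4 := h.integrable measurable_outer abs_outer_le z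
  simp only [Real.norm_eq_abs] at i1
  have i13 : Integrable fun y => R ^ 2 * (|v y| * η (z - y)) + R * (gradNorm v y * η (z - y)) :=
    (i1.const_mul _).add (i3.const_mul _)
  have e : mollify η (roughBound v R B) z = R ^ 2 * mollify η (fun z => |v z|) z +
      R * mollify η (gradNorm v) z + B * R ^ 2 * mollify η outer z := by
    unfold mollify
    rw [← integral_const_mul, ← integral_const_mul, ← integral_const_mul,
      ← integral_add (i1.const_mul _) (i3.const_mul _),
      ← integral_add i13 (i4.const_mul _)]
    congr 1
    ext y
    rw [roughBound]
    ring
  rw [e, mollifyErr]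
  ring

end Mollifier

/-- The error caused by a convolution disappears in the limit inside the inner cylinder. -/
lemma ae_tendsto_mollifyErr {φ : ℕ → ContDiffBump (0 : Euc n × ℝ)}
    (hφ : Tendsto (fun k => (φ k).rOut) atTop (𝓝 0)) (hφ' : ∀ k, (φ k).rOut ≤ 2 * (φ k).rIn)
    {v : Euc n × ℝ → ℝ} {R B D : ℝ} (hv : Continuous v)
    (hs : ∀ t, ContDiff ℝ 1 fun x => v (x, t)) (hM : ∀ z, |v z| ≤ 1)
    (hD : ∀ z, gradNorm v z ≤ D) :
    ∀ᵐ z : Euc n × ℝ, ‖z.1‖ ≤ 2 →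
      Tendsto (fun k => mollifyErr ((φ k).normed volume) v R B z) atTop (𝓝 0) := by
  have t1 := ae_tendsto_mollify hφ hφ' hv.measurable.norm (M := 1) (fun z => by simpa using hM z)
  have t2 := ae_tendsto_mollify hφ hφ' hv.measurable hM
  have t3 := ae_tendsto_mollify hφ hφ' (measurable_gradNorm hv) (M := D)
    (fun z => by rw [abs_of_nonneg (gradNorm_nonneg _ _)]; exact hD z)
  have t4 := ae_tendsto_mollify hφ hφ' measurable_outer (abs_outer_le (n := n))
  have t5 := ae_all_iff.2 fun i => ae_tendsto_mollify hφ hφ'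
    ((measurable_fderiv_slice hv).apply_continuousLinearMap (EuclideanSpace.single i 1))
    (Mollifier.abs_fderiv_single_le hD i)
  simp only [Real.norm_eq_abs] at t1
  filter_upwards [t1, t2, t3, t4, t5] with z h1 h2 h3 h4 h5 hz
  have h6 : Tendsto (fun k => gsq (mollify ((φ k).normed volume) v) z) atTop
      (𝓝 (gradNorm v z ^ 2)) := by
    simp_rw [(mollifier_normed (φ _)).gsq_mollify hv hs hM hD]
    rw [gradNorm, norm_sq_eq_sum_apply_sq]
    exact tendsto_finsetSum _ fun i _ => (h5 i).pow 2
  have h7 := h6.sqrt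
  rw [Real.sqrt_sq (gradNorm_nonneg _ _)] at h7
  have h8 : outer z = 0 := indicator_of_notMem (by simp only [mem_ofPred_eq]; linarith) _
  have h9 := (((h1.sub h2.abs).const_mul (R ^ 2)).add ((h3.sub h7).const_mul R)).add
    (h4.const_mul (B * R ^ 2))
  simpa [h8, mollifyErr] using h9

lemma tendsto_setIntegral_mollifyErr {φ : ℕ → ContDiffBump (0 : Euc n × ℝ)}
    (hφ : Tendsto (fun k => (φ k).rOut) atTop (𝓝 0)) (hφ' : ∀ k, (φ k).rOut ≤ 2 * (φ k).rIn)
    {v : Euc n × ℝ → ℝ} {R B D C : ℝ} (hv : Continuous v)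
    (hs : ∀ t, ContDiff ℝ 1 fun x => v (x, t)) (hM : ∀ z, |v z| ≤ 1)
    (hR : 0 < R) (hB : 0 ≤ B) (hD0 : 0 ≤ D) (hD : ∀ z, gradNorm v z ≤ D * R)
    (hC : 2 + (n + 1) * D + B ≤ C) (S : ℝ) :
    Tendsto (fun k => ∫ z in closedBall (0 : Euc n) 2 ×ˢ Icc 0 S,
      mollifyErr ((φ k).normed volume) v R B z ^ 2) atTop (𝓝 0) := by
  have hK : IsCompact (closedBall (0 : Euc n) 2 ×ˢ Icc 0 S) :=
    (isCompact_closedBall _ _).prod isCompact_Icc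
  have key : Tendsto (fun k => ∫ z in closedBall (0 : Euc n) 2 ×ˢ Icc 0 S,
      mollifyErr ((φ k).normed volume) v R B z ^ 2) atTop
      (𝓝 (∫ _ in closedBall (0 : Euc n) 2 ×ˢ Icc 0 S, (0 : ℝ))) := by
    refine tendsto_integral_of_dominated_convergence (fun _ => (C * R ^ 2) ^ 2) (fun k => ?_) ?_
      (fun k => Eventually.of_forall fun z => ?_) ?_
    · exact (((mollifier_normed (φ k)).continuous_mollifyErr hv hM hD).pow 2).aestronglyMeasurable
    · exact integrableOn_const (μ := (volume : Measure (Euc n × ℝ))) hK.measure_lt_top.ne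
    · rw [norm_pow, Real.norm_eq_abs]
      exact pow_le_pow_left₀ (abs_nonneg _)
        ((mollifier_normed (φ k)).abs_mollifyErr_le hv hs hM hR hB hD0 hD hC z) 2
    · refine (ae_restrict_iff' hK.measurableSet).2 ?_
      filter_upwards [ae_tendsto_mollifyErr (R := R) (B := B) hφ hφ' hv hs hM hD] with z hz hzK
      simpa using (hz (by simpa using hzK.1)).pow 2
  rwa [integral_zero] at key

/-- A rough solution of the differential inequality is approximated by smooth almost solutions. -/
lemma RoughSol.exists_almostSol {v : Euc n × ℝ → ℝ} {R B D C G S T κ δ : ℝ}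
    (h : RoughSol v (roughBound v R B) S G) (hM : ∀ z, |v z| ≤ 1)
    (hR : 0 < R) (hB : 0 ≤ B) (hD0 : 0 ≤ D) (hD : ∀ z, gradNorm v z ≤ D * R)
    (hC : 2 + (n + 1) * D + B ≤ C) (hT : 0 ≤ T) (hTS : T < S) (hκ : 0 < κ) (hδ : 0 < δ) :
    ∃ w e t₀, AlmostSol w e R C t₀ T κ ∧ ∀ x ∈ closedBall (0 : Euc n) 1,
      |w (x, t₀) - v (x, 0)| ≤ δ := by
  have hv := h.cont
  have hs : ∀ t, ContDiff ℝ 1 fun x => v (x, t) := fun t => (h.slice t).of_le (by norm_num)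
  set φ : ℕ → ContDiffBump (0 : Euc n × ℝ) := fun k =>
    ⟨1 / ((k : ℝ) + 1) / 2, 1 / ((k : ℝ) + 1), by positivity, half_lt_self (by positivity)⟩ with hφd
  have hφ : Tendsto (fun k => (φ k).rOut) atTop (𝓝 0) := tendsto_one_div_add_atTop_nhds_zero_nat
  have hφ' : ∀ k, (φ k).rOut ≤ 2 * (φ k).rIn := fun k => by simp only [hφd]; linarith
  have huc := ((isCompact_closedBall (0 : Euc n) 2).prod
    (isCompact_Icc (a := (-1 : ℝ)) (b := 1))).uniformContinuousOn_of_continuous hv.continuousOn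
  obtain ⟨δ', hδ', huc⟩ := Metric.uniformContinuousOn_iff.1 huc δ hδ
  have ev1 := hφ.eventually_lt_const (show 0 < min (δ' / 3) (min (1 / 3) ((S - T) / 3)) from
    lt_min (by linarith) (lt_min (by norm_num) (by linarith)))
  have ev2 := (tendsto_setIntegral_mollifyErr hφ hφ' hv hs hM hR hB hD0 hD hC S).eventually_lt_const hκ
  obtain ⟨k, hk1, hk2⟩ := (ev1.and ev2).exists
  have hη := mollifier_normed (φ k)
  have hε := (φ k).rOut_pos
  set η := (φ k).normed (volume : Measure (Euc n × ℝ))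
  set ε := (φ k).rOut
  obtain ⟨hk3, hk4, hk5⟩ : ε < δ' / 3 ∧ ε < 1 / 3 ∧ ε < (S - T) / 3 := by simpa using hk1
  have hec := hη.continuous_mollifyErr (R := R) (B := B) hv hM hD
  refine ⟨mollify η v, mollifyErr η v R B, 2 * ε, ⟨?_, ?_, ?_, ?_, ?_, ?_, ?_, ?_⟩, ?_⟩
  · exact contDiff_mollify hη.smooth hη.hasCompactSupport hv.measurable hM
  · refine fun x t hx => hη.mollify_eq_zero _ fun y hy => h.supp y.1 y.2 ?_
    have h1 : ‖x - y.1‖ < ε := (norm_fst_le ((x, t) - y)).trans_lt hy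
    have h2 := norm_sub_norm_le x y.1
    linarith
  · exact hη.abs_mollify_le hv.measurable hM
  · refine fun z => (hη.gsq_mollify_le hv hs hM hD z).trans ?_
    have : n * D ≤ C := by nlinarith
    rw [← mul_assoc]
    gcongr
  · exact hec
  · exact hη.abs_mollifyErr_le hv hs hM hR hB hD0 hD hC
  · intro x t ht
    rw [← hη.mollify_roughBound hv hM hD]
    exact hη.abs_lap_add_pd_le h hM hε x (by linarith [ht.1]) (by linarith [ht.2])
  · have hi : IntegrableOn (fun z => mollifyErr η v R B z ^ 2)
        (closedBall (0 : Euc n) 2 ×ˢ Icc 0 S) :=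
      (hec.pow 2).continuousOn.integrableOn_compact
        ((isCompact_closedBall _ _).prod isCompact_Icc)
    have hsub : closedBall (0 : Euc n) 2 ×ˢ Ioc (2 * ε) (2 * ε + T) ⊆
        closedBall (0 : Euc n) 2 ×ˢ Icc 0 S :=
      prod_mono_right fun t ht => ⟨by linarith [ht.1], by linarith [ht.2]⟩
    rw [intervalIntegral.integral_of_le (by linarith)]
    have e1 := setIntegral_prod (μ := (volume : Measure (Euc n))) (ν := (volume : Measure ℝ))
      (fun z => mollifyErr η v R B z ^ 2) (hi.mono_set hsub)
    have e2 : ∫ x in closedBall (0 : Euc n) 2, ∫ t in Ioc (2 * ε) (2 * ε + T),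
        mollifyErr η v R B (x, t) ^ 2 = ∫ t in Ioc (2 * ε) (2 * ε + T),
        ∫ x in closedBall (0 : Euc n) 2, mollifyErr η v R B (x, t) ^ 2 := by
      refine integral_integral_swap ?_
      rw [Measure.prod_restrict]
      exact hi.mono_set hsub
    rw [← e2, ← e1]
    exact (setIntegral_mono_set hi (Eventually.of_forall fun z => sq_nonneg _)
      (Eventually.of_forall hsub)).trans hk2.le
  · intro x hx
    refine hη.abs_mollify_sub_le hv.measurable hM fun y hy => ?_
    have h1 : ‖x - y.1‖ < ε := (norm_fst_le ((x, 2 * ε) - y)).trans_lt hy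
    have h2 : |2 * ε - y.2| < ε := (norm_snd_le ((x, 2 * ε) - y)).trans_lt hy
    rw [abs_lt] at h2
    have hx1 : ‖x‖ ≤ 1 := by simpa using hx
    have h3 := norm_sub_norm_le y.1 x
    rw [norm_sub_rev] at h3
    refine (huc y ⟨by simp; linarith, by linarith [h2.2], by linarith [h2.1]⟩ (x, 0)
      ⟨by simp; linarith, by norm_num, by norm_num⟩ ?_).le
    rw [Prod.dist_eq, max_lt_iff, dist_comm, dist_eq_norm, Real.dist_eq, abs_lt]
    refine ⟨by linarith, ?_, ?_⟩ <;> simp only [sub_zero] <;> linarith [h2.1, h2.2]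

lemma slap_mul {f g : Euc n → ℝ} {x : Euc n} (hf : ContDiffAt ℝ 2 f x) (hg : ContDiffAt ℝ 2 g x) :
    slap (fun y => f y * g y) x = f x * slap g x + g x * slap f x +
      2 * ∑ i, fderiv ℝ f x (EuclideanSpace.single i 1) *
        fderiv ℝ g x (EuclideanSpace.single i 1) := by
  have hd : ∀ {h : Euc n → ℝ}, ContDiffAt ℝ 2 h x → ∀ e : Euc n,
      DifferentiableAt ℝ (fun y => fderiv ℝ h y e) x := fun hh e =>
    ((hh.fderiv_right (m := 1) (by norm_num)).differentiableAt (by norm_num)).clm_apply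
      (differentiableAt_const e)
  have hev : ∀ {h : Euc n → ℝ}, ContDiffAt ℝ 2 h x → ∀ᶠ y in 𝓝 x, DifferentiableAt ℝ h y :=
    fun hh => (hh.eventually (by simp)).mono fun y hy => hy.differentiableAt (by norm_num)
  have h1 : ∀ e : Euc n, (fun y => fderiv ℝ (fun y => f y * g y) y e) =ᶠ[𝓝 x]
      fun y => f y * fderiv ℝ g y e + g y * fderiv ℝ f y e := fun e => by
    filter_upwards [hev hf, hev hg] with y h2 h3
    rw [fderiv_fun_mul h2 h3]
    simp
  have hf' := hf.differentiableAt (by norm_num)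
  have hg' := hg.differentiableAt (by norm_num)
  unfold slap
  rw [Finset.mul_sum, Finset.mul_sum, Finset.mul_sum, ← Finset.sum_add_distrib,
    ← Finset.sum_add_distrib]
  refine Finset.sum_congr rfl fun i _ => ?_
  rw [(h1 _).fderiv_eq, fderiv_fun_add (hf'.fun_mul (hd hg _)) (hg'.fun_mul (hd hf _)),
    fderiv_fun_mul hf' (hd hg _), fderiv_fun_mul hg' (hd hf _)]
  simp
  ring

lemma abs_fderiv_single_le_norm (f : Euc n → ℝ) (x : Euc n) (i : Fin n) :
    |fderiv ℝ f x (EuclideanSpace.single i 1)| ≤ ‖fderiv ℝ f x‖ := by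
  have := (fderiv ℝ f x).le_opNorm (EuclideanSpace.single i 1)
  rwa [PiLp.norm_single, norm_one, mul_one] at this

lemma slap_congr {f g : Euc n → ℝ} {x : Euc n} (h : f =ᶠ[𝓝 x] g) : slap f x = slap g x := by
  refine Finset.sum_congr rfl fun i _ => ?_
  have : (fun y => fderiv ℝ f y (EuclideanSpace.single i 1)) =ᶠ[𝓝 x]
      fun y => fderiv ℝ g y (EuclideanSpace.single i 1) := by
    filter_upwards [h.eventually_nhds] with y hy
    rw [EventuallyEq.fderiv_eq hy]
  rw [this.fderiv_eq]

/-- A spatial cutoff function with bounds on its first two derivatives. -/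
structure Cutoff (χ : Euc n → ℝ) (D A : ℝ) : Prop where
  smooth : ContDiff ℝ ∞ χ
  nonneg : ∀ x, 0 ≤ χ x
  le_one : ∀ x, χ x ≤ 1
  eq_one : ∀ x, ‖x‖ ≤ 3 → χ x = 1
  eq_zero : ∀ x, 7 / 2 ≤ ‖x‖ → χ x = 0
  norm_fderiv_le : ∀ x, ‖fderiv ℝ χ x‖ ≤ D
  abs_slap_le : ∀ x, |slap χ x| ≤ A

lemma exists_cutoff (n : ℕ) : ∃ (χ : Euc n → ℝ) (D A : ℝ), Cutoff χ D A := by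
  set φ : ContDiffBump (0 : Euc n) := ⟨3, 7 / 2, by norm_num, by norm_num⟩
  have hs : ContDiff ℝ ∞ φ := φ.contDiff
  have h2 : ContDiff ℝ 2 φ := φ.contDiff
  have hc : HasCompactSupport φ := φ.hasCompactSupport
  obtain ⟨D, hD⟩ := (hc.fderiv (𝕜 := ℝ)).exists_bound_of_continuous
    (hs.continuous_fderiv (by simp))
  have hsc : HasCompactSupport (slap φ) := hc.mono' fun x hx => by
    by_contra hn
    refine hx ?_
    rw [slap_congr (notMem_tsupport_iff_eventuallyEq.1 hn)]
    simp [slap, Pi.zero_def]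
  obtain ⟨A, hA⟩ := hsc.exists_bound_of_continuous (continuous_slap h2)
  exact ⟨φ, D, A, hs, fun x => φ.nonneg, fun x => φ.le_one,
    fun x hx => φ.one_of_mem_closedBall (by simpa using hx),
    fun x hx => φ.zero_of_le_dist (by simpa using hx), hD, hA⟩

/-- A classical solution of the differential inequality in a cylinder of radius four. -/
structure ClassicalSol (u : Euc n → ℝ → ℝ) (R S : ℝ) : Prop where
  slice : ∀ t ∈ Icc 0 S, ContDiffOn ℝ 2 (fun x => u x t) (ball 0 4)
  time : ∀ x ∈ ball (0 : Euc n) 4, ContDiffOn ℝ 1 (u x) (Icc 0 S)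
  ineq : ∀ x ∈ ball (0 : Euc n) 4, ∀ t ∈ Icc 0 S,
    |slap (fun y => u y t) x + derivWithin (u x) (Icc 0 S) t| ≤
      R ^ 2 * |u x t| + R * ‖fderiv ℝ (fun y => u y t) x‖
  abs_le : ∀ x ∈ ball (0 : Euc n) 4, ∀ t ∈ Icc 0 S, |u x t| ≤ 1
  norm_fderiv_le : ∀ x ∈ ball (0 : Euc n) 4, ∀ t ∈ Icc 0 S, ‖fderiv ℝ (fun y => u y t) x‖ ≤ R

/-- The product of a cutoff function and a function extended constantly in time. -/
noncomputable def cutoffExtend (χ : Euc n → ℝ) (u : Euc n → ℝ → ℝ) (S : ℝ) (z : Euc n × ℝ) : ℝ :=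
  χ z.1 * u z.1 (max 0 (min S z.2))

namespace ClassicalSol

variable {u : Euc n → ℝ → ℝ} {χ : Euc n → ℝ} {R S D A : ℝ}

lemma clamp_mem (hS : 0 ≤ S) (t : ℝ) : max 0 (min S t) ∈ Icc 0 S :=
  ⟨le_max_left _ _, max_le hS (min_le_left _ _)⟩

lemma contDiffAt_slice (h : ClassicalSol u R S) {t : ℝ} (ht : t ∈ Icc 0 S) {x : Euc n}
    (hx : ‖x‖ < 4) : ContDiffAt ℝ 2 (fun y => u y t) x :=
  (h.slice t ht).contDiffAt (isOpen_ball.mem_nhds (by simpa using hx))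

lemma eventually_eq_zero (hχ : Cutoff χ D A) {x : Euc n} (hx : 7 / 2 < ‖x‖) (t : ℝ) :
    (fun y => χ y * u y t) =ᶠ[𝓝 x] fun _ => 0 := by
  filter_upwards [(isOpen_lt continuous_const continuous_norm).mem_nhds hx] with y hy
  rw [hχ.eq_zero y (le_of_lt hy), zero_mul]

lemma contDiff_mul (h : ClassicalSol u R S) (hχ : Cutoff χ D A) {t : ℝ} (ht : t ∈ Icc 0 S) :
    ContDiff ℝ 2 fun x => χ x * u x t := by
  rw [contDiff_iff_contDiffAt]
  intro x
  by_cases hx : ‖x‖ < 4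
  · exact (hχ.smooth.contDiffAt.of_le (WithTop.coe_le_coe.2 le_top)).mul (h.contDiffAt_slice ht hx)
  · exact contDiffAt_const.congr_of_eventuallyEq
      (eventually_eq_zero hχ (by linarith : 7 / 2 < ‖x‖) t)

lemma norm_fderiv_mul_le (h : ClassicalSol u R S) (hχ : Cutoff χ D A) {t : ℝ} (ht : t ∈ Icc 0 S)
    (hR : 1 ≤ R) (x : Euc n) : ‖fderiv ℝ (fun x => χ x * u x t) x‖ ≤ (D + 1) * R := by
  have hD : 0 ≤ D := (norm_nonneg _).trans (hχ.norm_fderiv_le 0)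
  by_cases hx : ‖x‖ < 4
  · have hxb : x ∈ ball (0 : Euc n) 4 := by simpa using hx
    rw [fderiv_fun_mul (hχ.smooth.differentiable (by simp) x)
      ((h.contDiffAt_slice ht hx).differentiableAt (by norm_num))]
    refine (norm_add_le _ _).trans ?_
    rw [norm_smul, norm_smul, Real.norm_eq_abs, Real.norm_eq_abs, abs_of_nonneg (hχ.nonneg x)]
    have h1 := mul_le_mul (hχ.le_one x) (h.norm_fderiv_le x hxb t ht) (norm_nonneg _) zero_le_one
    have h2 := mul_le_mul (h.abs_le x hxb t ht) (hχ.norm_fderiv_le x) (norm_nonneg _) zero_le_one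
    nlinarith
  · rw [(eventually_eq_zero hχ (by linarith : 7 / 2 < ‖x‖) t).fderiv_eq]
    simp
    positivity

lemma continuous_cutoffExtend (h : ClassicalSol u R S) (hχ : Cutoff χ D A) (hS : 0 ≤ S)
    (hR : 1 ≤ R) : Continuous (cutoffExtend χ u S) := by
  have hD : 0 ≤ D := (norm_nonneg _).trans (hχ.norm_fderiv_le 0)
  refine continuous_prod_of_continuous_lipschitzWith (cutoffExtend χ u S)
    ⟨(D + 1) * R, by positivity⟩ ?_ ?_
  · intro x
    by_cases hx : ‖x‖ < 4
    · have h1 := (h.time x (by simpa using hx)).continuousOn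
      have h2 : Continuous fun t => u x (max 0 (min S t)) :=
        h1.comp_continuous (by fun_prop) fun t => clamp_mem hS t
      exact h2.const_mul (χ x)
    · simp only [cutoffExtend, hχ.eq_zero x (by linarith), zero_mul]
      exact continuous_const
  · intro t
    have ht := clamp_mem hS t
    exact lipschitzWith_of_nnnorm_fderiv_le
      ((h.contDiff_mul hχ ht).differentiable (by norm_num))
      fun x => h.norm_fderiv_mul_le hχ ht hR x

lemma abs_cutoffExtend_le (h : ClassicalSol u R S) (hχ : Cutoff χ D A) (hS : 0 ≤ S)
    (z : Euc n × ℝ) : |cutoffExtend χ u S z| ≤ 1 := by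
  unfold cutoffExtend
  by_cases hx : ‖z.1‖ < 4
  · rw [abs_mul, abs_of_nonneg (hχ.nonneg _)]
    exact mul_le_one₀ (hχ.le_one _) (abs_nonneg _)
      (h.abs_le _ (by simpa using hx) _ (clamp_mem hS _))
  · rw [hχ.eq_zero _ (by linarith), zero_mul, abs_zero]
    exact zero_le_one

lemma gradNorm_cutoffExtend_le (h : ClassicalSol u R S) (hχ : Cutoff χ D A) (hS : 0 ≤ S)
    (hR : 1 ≤ R) (z : Euc n × ℝ) : gradNorm (cutoffExtend χ u S) z ≤ (D + 1) * R :=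
  h.norm_fderiv_mul_le hχ (clamp_mem hS _) hR z.1

lemma clamp_eq {t : ℝ} (ht : t ∈ Icc 0 S) : max 0 (min S t) = t := by
  rw [min_eq_right ht.2, max_eq_right ht.1]

lemma hasDerivAt_cutoffExtend (h : ClassicalSol u R S) {x : Euc n} (hx : ‖x‖ < 4) {t : ℝ}
    (ht : t ∈ Ioo 0 S) : HasDerivAt (fun s => cutoffExtend χ u S (x, s))
      (χ x * derivWithin (u x) (Icc 0 S) t) t := by
  have hn : Icc 0 S ∈ 𝓝 t := Icc_mem_nhds ht.1 ht.2
  have h1 := ((h.time x (by simpa using hx)).differentiableOn (by norm_num) t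
    (Ioo_subset_Icc_self ht)).hasDerivWithinAt.hasDerivAt hn
  refine (h1.const_mul (χ x)).congr_of_eventuallyEq ?_
  filter_upwards [hn] with s hs
  rw [cutoffExtend, clamp_eq hs]

lemma cutoffExtend_eq_zero (hχ : Cutoff χ D A) {x : Euc n} (hx : 7 / 2 ≤ ‖x‖) (t : ℝ) :
    cutoffExtend χ u S (x, t) = 0 := by
  rw [cutoffExtend, hχ.eq_zero x hx, zero_mul]

lemma cutoffExtend_ineq (h : ClassicalSol u R S) (hχ : Cutoff χ D A)
    (hR : 1 ≤ R) (x : Euc n) {t : ℝ} (ht : t ∈ Ioo 0 S) :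
    |slap (fun y => cutoffExtend χ u S (y, t)) x +
      deriv (fun s => cutoffExtend χ u S (x, s)) t| ≤
      roughBound (cutoffExtend χ u S) R (2 + A + 2 * n * D) (x, t) := by
  have hD : 0 ≤ D := (norm_nonneg _).trans (hχ.norm_fderiv_le 0)
  have hA : 0 ≤ A := (abs_nonneg _).trans (hχ.abs_slap_le 0)
  have ht' := Ioo_subset_Icc_self ht
  have e0 : (fun y => cutoffExtend χ u S (y, t)) = fun y => χ y * u y t := by
    ext y
    rw [cutoffExtend, clamp_eq ht']
  have hR2 : R ≤ R ^ 2 := by nlinarith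
  have hg0 := gradNorm_nonneg (cutoffExtend χ u S) (x, t)
  have hB : 0 ≤ 2 + A + 2 * n * D := by positivity
  by_cases hx : ‖x‖ < 4
  · have hxb : x ∈ ball (0 : Euc n) 4 := by simpa using hx
    rw [(h.hasDerivAt_cutoffExtend hx ht).deriv]
    have hu := h.ineq x hxb t ht'
    by_cases hx3 : ‖x‖ < 3
    · have e1 : (fun y => cutoffExtend χ u S (y, t)) =ᶠ[𝓝 x] fun y => u y t := by
        filter_upwards [(isOpen_lt continuous_norm continuous_const).mem_nhds hx3] with y hy
        rw [cutoffExtend, clamp_eq ht', hχ.eq_one y (le_of_lt hy), one_mul]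
      have e2 : cutoffExtend χ u S (x, t) = u x t := e1.self_of_nhds
      rw [slap_congr e1, hχ.eq_one x hx3.le, one_mul, roughBound, gradNorm, e1.fderiv_eq, e2]
      have := mul_nonneg (mul_nonneg hB (sq_nonneg R)) (outer_nonneg (x, t))
      linarith
    · have ho : outer (x, t) = 1 := indicator_of_mem (by simpa using hx3) _
      rw [e0, slap_mul (hχ.smooth.contDiffAt.of_le (WithTop.coe_le_coe.2 le_top))
        (h.contDiffAt_slice ht' hx), roughBound, ho]
      have hu1 := h.abs_le x hxb t ht'
      have hu2 := h.norm_fderiv_le x hxb t ht'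
      have b1 : |χ x * (slap (fun y => u y t) x + derivWithin (u x) (Icc 0 S) t)| ≤ 2 * R ^ 2 := by
        rw [abs_mul, abs_of_nonneg (hχ.nonneg x)]
        have b2 : R ^ 2 * |u x t| + R * ‖fderiv ℝ (fun y => u y t) x‖ ≤ 2 * R ^ 2 := by nlinarith
        calc _ ≤ 1 * (2 * R ^ 2) := mul_le_mul (hχ.le_one x) (hu.trans b2) (abs_nonneg _)
              zero_le_one
          _ = _ := one_mul _
      have b3 : |u x t * slap χ x| ≤ A * R ^ 2 := by
        rw [abs_mul]
        calc _ ≤ 1 * A := mul_le_mul hu1 (hχ.abs_slap_le x) (abs_nonneg _) zero_le_one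
          _ ≤ _ := by nlinarith
      have b4 : |∑ i, fderiv ℝ χ x (EuclideanSpace.single i 1) *
          fderiv ℝ (fun y => u y t) x (EuclideanSpace.single i 1)| ≤ n * D * R ^ 2 := by
        refine (Finset.abs_sum_le_sum_abs _ _).trans ?_
        have b5 : ∀ i ∈ (Finset.univ : Finset (Fin n)), |fderiv ℝ χ x (EuclideanSpace.single i 1) *
            fderiv ℝ (fun y => u y t) x (EuclideanSpace.single i 1)| ≤ D * R ^ 2 := fun i _ => by
          rw [abs_mul]
          refine mul_le_mul ((abs_fderiv_single_le_norm _ _ _).trans (hχ.norm_fderiv_le x))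
            ((abs_fderiv_single_le_norm _ _ _).trans (hu2.trans hR2)) (abs_nonneg _) hD
        refine (Finset.sum_le_sum b5).trans_eq ?_
        rw [Finset.sum_const, Finset.card_univ, Fintype.card_fin, nsmul_eq_mul, mul_assoc]
      have b6 := mul_nonneg (sq_nonneg R) (abs_nonneg (cutoffExtend χ u S (x, t)))
      have b7 := mul_nonneg (zero_le_one.trans hR) hg0
      rw [_root_.abs_le] at b1 b3 b4 ⊢
      constructor <;> nlinarith [b1.1, b1.2, b3.1, b3.2, b4.1, b4.2]
  · have hx' : 7 / 2 < ‖x‖ := by linarith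
    have e1 : (fun s => cutoffExtend χ u S (x, s)) = fun _ => 0 := by
      ext s
      exact cutoffExtend_eq_zero hχ hx'.le s
    rw [e0, slap_congr (eventually_eq_zero hχ hx' t), e1]
    have e2 : slap (fun _ : Euc n => (0 : ℝ)) x = 0 := by simp [slap]
    rw [e2, deriv_const, add_zero, abs_zero, roughBound]
    have := outer_nonneg (x, t)
    positivity

/-- Cutting off a classical solution gives a rough solution of a perturbed inequality. -/
lemma roughSol (h : ClassicalSol u R S) (hχ : Cutoff χ D A) (hS : 0 ≤ S) (hR : 1 ≤ R) :
    RoughSol (cutoffExtend χ u S) (roughBound (cutoffExtend χ u S) R (2 + A + 2 * n * D)) S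
      (R ^ 2 + R * ((D + 1) * R) + (2 + A + 2 * n * D) * R ^ 2) where
  cont := h.continuous_cutoffExtend hχ hS hR
  slice t := h.contDiff_mul hχ (clamp_mem hS t)
  supp x t hx := cutoffExtend_eq_zero hχ (by linarith) t
  diff x t ht := by
    by_cases hx : ‖x‖ < 4
    · exact (h.hasDerivAt_cutoffExtend hx ht).differentiableAt
    · simp only [cutoffExtend_eq_zero hχ (by linarith : 7 / 2 ≤ ‖x‖)]
      exact differentiableAt_const _
  ineq x t ht := h.cutoffExtend_ineq hχ hR x ht
  meas := by
    have h1 := h.continuous_cutoffExtend hχ hS hR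
    have h2 := measurable_gradNorm h1
    have h3 := measurable_outer (n := n)
    have h4 : Measurable fun z => |cutoffExtend χ u S z| := h1.abs.measurable
    unfold roughBound
    fun_prop
  nonneg z := by
    have hD : 0 ≤ D := (norm_nonneg _).trans (hχ.norm_fderiv_le 0)
    have hA : 0 ≤ A := (abs_nonneg _).trans (hχ.abs_slap_le 0)
    have h1 := gradNorm_nonneg (cutoffExtend χ u S) z
    have h2 := outer_nonneg z
    unfold roughBound
    positivity
  le z := by
    have hD : 0 ≤ D := (norm_nonneg _).trans (hχ.norm_fderiv_le 0)
    have hA : 0 ≤ A := (abs_nonneg _).trans (hχ.abs_slap_le 0)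
    have h1 := h.gradNorm_cutoffExtend_le hχ hS hR z
    have h2 := outer_le_one z
    have h3 := h.abs_cutoffExtend_le hχ hS z
    unfold roughBound
    calc _ ≤ R ^ 2 * 1 + R * ((D + 1) * R) + (2 + A + 2 * n * D) * R ^ 2 * 1 := by gcongr
      _ = _ := by ring

lemma cutoffExtend_zero (hχ : Cutoff χ D A) (hS : 0 ≤ S) {x : Euc n} (hx : ‖x‖ ≤ 3) :
    cutoffExtend χ u S (x, 0) = u x 0 := by
  rw [cutoffExtend, clamp_eq ⟨le_rfl, hS⟩, hχ.eq_one x hx, one_mul]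

end ClassicalSol

lemma abs_setIntegral_sq_sub_le {f g : Euc n → ℝ} (hf : Continuous f) (hg : Continuous g) {r δ : ℝ}
    (hr : r ≤ 1) (hf1 : ∀ x ∈ closedBall (0 : Euc n) 1, |f x| ≤ 1)
    (hg1 : ∀ x ∈ closedBall (0 : Euc n) 1, |g x| ≤ 1)
    (hd : ∀ x ∈ closedBall (0 : Euc n) 1, |f x - g x| ≤ δ) :
    |(∫ x in ball (0 : Euc n) r, f x ^ 2) - ∫ x in ball (0 : Euc n) r, g x ^ 2| ≤
      2 * δ * volume.real (closedBall (0 : Euc n) 1) := by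
  have hsub : ball (0 : Euc n) r ⊆ closedBall 0 1 :=
    ball_subset_closedBall.trans (closedBall_subset_closedBall hr)
  have hi : ∀ {h : Euc n → ℝ}, Continuous h → IntegrableOn (fun x => h x ^ 2) (ball (0 : Euc n) r) :=
    fun hh => ((hh.pow 2).continuousOn.integrableOn_compact (isCompact_closedBall _ _)).mono_set hsub
  have hδ : 0 ≤ δ := (abs_nonneg _).trans (hd 0 (by simp))
  have hlt : volume (ball (0 : Euc n) r) < ⊤ := measure_ball_lt_top
  rw [← integral_sub (hi hf) (hi hg), ← Real.norm_eq_abs]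
  refine (norm_setIntegral_le_of_norm_le_const (C := 2 * δ) hlt fun x hx => ?_).trans ?_
  · have hx' := hsub hx
    have h1 : |f x + g x| ≤ 2 := (abs_add_le _ _).trans (by linarith [hf1 x hx', hg1 x hx'])
    rw [Real.norm_eq_abs, sq_sub_sq, abs_mul]
    exact mul_le_mul h1 (hd x hx') (abs_nonneg _) (by norm_num)
  · exact mul_le_mul_of_nonneg_left
      (measureReal_mono hsub (isCompact_closedBall _ _).measure_lt_top.ne) (by positivity)

lemma norm_gradient_eq_norm_fderiv (f : Euc n → ℝ) (x : Euc n) :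
    ‖gradient f x‖ = ‖fderiv ℝ f x‖ := by
  rw [gradient, LinearIsometryEquiv.norm_map]

/-- The quantitative unique continuation estimate for classical solutions. -/
lemma exists_forall_classicalSol (n : ℕ) {θ : ℝ} (hθ : 0 < θ) : ∃ N ≥ (1 : ℝ), ∀ R ≥ N,
    ∀ r, 0 < r → r ≤ 1 / 2 → ∀ u : Euc n → ℝ → ℝ, ClassicalSol u R (1 / R ^ 2) →
    θ ^ 2 * (R ^ n)⁻¹ ≤ ∫ x in ball (0 : Euc n) (1 / 20), u x 0 ^ 2 →
    rexp (-(N * R ^ 2 * Real.log (N / r))) ^ 2 ≤ ∫ x in ball (0 : Euc n) r, u x 0 ^ 2 := by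
  obtain ⟨χ, D, A, hχ⟩ := exists_cutoff n
  have hD : 0 ≤ D := (norm_nonneg _).trans (hχ.norm_fderiv_le 0)
  have hA : 0 ≤ A := (abs_nonneg _).trans (hχ.abs_slap_le 0)
  have hB : 0 ≤ 2 + A + 2 * n * D := by positivity
  have hC : 1 ≤ 2 + (n + 1) * (D + 1) + (2 + A + 2 * n * D) := by
    have : 0 ≤ (n + 1) * (D + 1) := by positivity
    linarith
  obtain ⟨N, hN, hmain⟩ := exists_forall_almostSol n hC hθ
  refine ⟨N, hN, fun R hRN r hr hr2 u hu hθu => ?_⟩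
  have hR : 1 ≤ R := hN.trans hRN
  have hR0 : 0 < R := zero_lt_one.trans_le hR
  have hS : 0 ≤ 1 / R ^ 2 := by positivity
  obtain ⟨κ, hκ, hmain⟩ := hmain R hRN r hr hr2
  set v := cutoffExtend χ u (1 / R ^ 2) with hv
  set V := volume.real (closedBall (0 : Euc n) 1)
  have hV : 0 ≤ V := measureReal_nonneg
  have hvc : Continuous fun x => v (x, 0) :=
    (hu.continuous_cutoffExtend hχ hS hR).comp (by fun_prop)
  have hvu : ∀ s ≤ (1 : ℝ),
      ∫ x in ball (0 : Euc n) s, u x 0 ^ 2 = ∫ x in ball (0 : Euc n) s, v (x, 0) ^ 2 := fun s hs =>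
    setIntegral_congr_fun measurableSet_ball fun x hx => by
      have hx' : ‖x‖ ≤ 3 := by
        have : ‖x‖ < s := by simpa using hx
        linarith
      simp only [hv, ClassicalSol.cutoffExtend_zero hχ hS hx']
  rw [hvu _ (by linarith)]
  rw [hvu _ (by norm_num)] at hθu
  have hpos : 0 < θ ^ 2 / 2 * (R ^ n)⁻¹ := by positivity
  have key : ∀ δ > 0, 2 * δ * V ≤ θ ^ 2 / 2 * (R ^ n)⁻¹ →
      rexp (-(N * R ^ 2 * Real.log (N / r))) ^ 2 ≤
        (∫ x in ball (0 : Euc n) r, v (x, 0) ^ 2) + 2 * δ * V := by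
    intro δ hδ hδV
    obtain ⟨w, e, t₀, hw, hwv⟩ := (hu.roughSol hχ hS hR).exists_almostSol
      (T := 1 / (40 * R ^ 2)) (hu.abs_cutoffExtend_le hχ hS) hR0 hB (by positivity : 0 ≤ D + 1)
      (hu.gradNorm_cutoffExtend_le hχ hS hR) le_rfl (by positivity)
      (one_div_lt_one_div_of_lt (by positivity) (by nlinarith)) hκ hδ
    have hwc : Continuous fun x => w (x, t₀) := hw.smooth.continuous.comp (by fun_prop)
    have hdiff := fun s (hs : s ≤ (1 : ℝ)) => abs_le.1 (abs_setIntegral_sq_sub_le hwc hvc hs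
      (fun x _ => hw.abs_le _) (fun x _ => hu.abs_cutoffExtend_le hχ hS _) hwv)
    have h1 := hmain w e t₀ hw (by linarith [(hdiff (1 / 20) (by norm_num)).1])
    linarith [(hdiff r (by linarith)).2]
  refine le_of_forall_pos_le_add fun ε hε => ?_
  set m := min ε (θ ^ 2 / 2 * (R ^ n)⁻¹)
  have hm : 0 < m := lt_min hε hpos
  have hmV : 2 * (m / (2 * (V + 1))) * V ≤ m := by
    rw [show 2 * (m / (2 * (V + 1))) * V = m * (V / (V + 1)) by field_simp]
    exact mul_le_of_le_one_right hm.le ((div_le_one (by positivity)).2 (by linarith))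
  exact (key (m / (2 * (V + 1))) (by positivity) (hmV.trans (min_le_right _ _))).trans
    (by linarith [min_le_left ε (θ ^ 2 / 2 * (R ^ n)⁻¹)])

end Auxiliary

/-- given `θ ∈ (0,1]` there are `N = N(n,θ) ≥ 1` and `ρ = ρ(n,θ) ∈ (0,1]`
such that if `u` is `C^{2,1}` on `B₄ × [0,1/R²]` with `|Δu + ∂ₜu| ≤ R²|u| + R|∇u|`,
`‖u‖_∞ ≤ 1`, `‖∇u‖_∞ ≤ R` and `‖u(·,0)‖_{L²(B_ρ)} ≥ θ R^{-n/2}`, then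
`‖u(·,0)‖_{L²(B_r)} ≥ e^{-N R² log(N/r)}` for `0 < r ≤ 1/2` and `R ≥ N`. -/
theorem stmt_14 (n : ℕ) : ∀ θ : ℝ, θ ∈ Ioc (0 : ℝ) 1 →
    ∃ N ≥ (1 : ℝ), ∃ ρ ∈ Ioc (0 : ℝ) 1, ∀ R : ℝ, 0 < R →
    ∀ u : EuclideanSpace ℝ (Fin n) → ℝ → ℝ,
    (∀ t ∈ Icc (0 : ℝ) (1 / R ^ 2),
      ContDiffOn ℝ 2 (fun x => u x t) (ball (0 : EuclideanSpace ℝ (Fin n)) 4)) →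
    (∀ x ∈ ball (0 : EuclideanSpace ℝ (Fin n)) 4,
      ContDiffOn ℝ 1 (u x) (Icc (0 : ℝ) (1 / R ^ 2))) →
    (∀ x ∈ ball (0 : EuclideanSpace ℝ (Fin n)) 4, ∀ t ∈ Icc (0 : ℝ) (1 / R ^ 2),
      |slap (fun y => u y t) x + derivWithin (u x) (Icc (0 : ℝ) (1 / R ^ 2)) t| ≤
        R ^ 2 * |u x t| + R * ‖gradient (fun y => u y t) x‖) →
    (∀ x ∈ ball (0 : EuclideanSpace ℝ (Fin n)) 4, ∀ t ∈ Icc (0 : ℝ) (1 / R ^ 2),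
      |u x t| ≤ 1) →
    (∀ x ∈ ball (0 : EuclideanSpace ℝ (Fin n)) 4, ∀ t ∈ Icc (0 : ℝ) (1 / R ^ 2),
      ‖gradient (fun y => u y t) x‖ ≤ R) →
    Real.sqrt (∫ x in ball (0 : EuclideanSpace ℝ (Fin n)) ρ, u x 0 ^ 2) ≥
      θ * R ^ (-(n : ℝ) / 2) →
    ∀ r : ℝ, 0 < r → r ≤ 1 / 2 → R ≥ N →
      Real.sqrt (∫ x in ball (0 : EuclideanSpace ℝ (Fin n)) r, u x 0 ^ 2) ≥
        Real.exp (-(N * R ^ 2 * Real.log (N / r))) := by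
  intro θ hθ
  obtain ⟨N, hN, hmain⟩ := exists_forall_classicalSol n hθ.1
  refine ⟨N, hN, 1 / 20, ⟨by norm_num, by norm_num⟩, fun R hR u hs ht hi hu hg hL r hr hr2 hRN => ?_⟩
  simp only [norm_gradient_eq_norm_fderiv] at hi hg
  refine Real.le_sqrt_of_sq_le (hmain R hRN r hr hr2 u ⟨hs, ht, hi, hu, hg⟩ ?_)
  have h1 := (Real.le_sqrt (mul_nonneg hθ.1.le (by positivity)) (integral_nonneg fun x => sq_nonneg _)).1 hL
  refine le_of_eq_of_le ?_ h1
  rw [mul_pow, ← Real.rpow_natCast (R ^ (-(n : ℝ) / 2)), ← Real.rpow_mul hR.le, Nat.cast_ofNat,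
    div_mul_cancel₀ _ (two_ne_zero' ℝ), Real.rpow_neg hR.le, Real.rpow_natCast]
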